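/- arXiv:2510.03492 — 2 statements merged into one kernel-verified Lean document; each statement's English description precedes it below -/
import Mathlib

section
/- Let Γ be a group generated by a finite symmetric set X, and suppose Γ is sharply MIF: there is a constant C > 0 such that for every nontrivial w ∈ Γ∗⟨x⟩ there exists γ ∈ Γ with ‖γ‖_X ≤ C·log(‖w‖ + 1) and w(γ) ≠ 1. Then Γ is linearly MIF: there is a constant C' > 0 such that for every positive integer n there exists a single element γ ∈ Γ with ‖γ‖_X ≤ C'·n and w(γ) ≠ 1 for every nontrivial w ∈ Γ∗⟨x⟩ with ‖w‖ ≤ n. -/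
open Matrix

/-- The free product `Γ ∗ ⟨x⟩` of a group `Γ` with an infinite cyclic group `⟨x⟩`. -/
abbrev MixedWordGroup (G : Type*) [Group G] : Type _ :=
  Monoid.Coprod G (Multiplicative ℤ)

/-- The distinguished generator `x` of the free factor `⟨x⟩` in `Γ ∗ ⟨x⟩`. -/
def xGen (G : Type*) [Group G] : MixedWordGroup G :=
  Monoid.Coprod.inr (Multiplicative.ofAdd (1 : ℤ))

/-- Evaluation of a mixed word: the unique homomorphism `Γ ∗ ⟨x⟩ → Γ` restricting to the
identity on `Γ` and sending `x` to `γ`. -/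
def evalWord {G : Type*} [Group G] (γ : G) : MixedWordGroup G →* G :=
  Monoid.Coprod.lift (MonoidHom.id G) (zpowersHom G γ)

/-- Word length of `g` with respect to the set `S`. -/
noncomputable def wordLength {G : Type*} [Group G] (S : Set G) (g : G) : ℕ :=
  sInf {n | ∃ l : List G, (∀ a ∈ l, a ∈ S) ∧ l.length = n ∧ l.prod = g}

/-- The generating set `X ∪ {x, x⁻¹}` of `Γ ∗ ⟨x⟩`. -/
def mixedGenSet {G : Type*} [Group G] (X : Set G) : Set (MixedWordGroup G) :=
  (Monoid.Coprod.inl '' X) ∪ {xGen G, (xGen G)⁻¹}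


open scoped Pointwise commutatorElement

/-- If any two nontrivial elements of `W` fail to commute after conjugating one of them by an
element of `S ^ 5`, then for any set `T` of at most `2 ^ m` nontrivial elements of `S ^ n` some
nontrivial element of `S ^ (24 ^ m * n)` lies in every normal subgroup that meets `T`. -/
lemma exists_short_mem_of_normal_inter {W : Type*} [Group W] [DecidableEq W] (S : Finset W)
    (hS : S⁻¹ = S) (h1 : 1 ∈ S) (hne : ∃ x ∈ S, x ≠ 1)
    (hcomm : ∀ u v : W, u ≠ 1 → v ≠ 1 → ∃ g ∈ S ^ 5, ¬ Commute u (g * v * g⁻¹))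
    {n : ℕ} (hn : 0 < n) (m : ℕ) (T : Finset W) (hT : T ⊆ S ^ n) (hT1 : 1 ∉ T)
    (hcard : T.card ≤ 2 ^ m) :
    ∃ w ∈ S ^ (24 ^ m * n), w ≠ 1 ∧
      ∀ N : Subgroup W, N.Normal → ∀ t ∈ T, t ∈ N → w ∈ N := by
  have hinv : ∀ {k : ℕ} {w : W}, w ∈ S ^ k → w⁻¹ ∈ S ^ k := by
    intro k w hw
    have := Finset.inv_mem_inv hw
    rwa [← inv_pow, hS] at this
  have hmono : ∀ {k l : ℕ}, k ≤ l → S ^ k ⊆ S ^ l := fun h => Finset.pow_right_monotone h1 h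
  induction m generalizing T with
  | zero =>
    rcases T.eq_empty_or_nonempty with rfl | hne'
    · obtain ⟨x, hx, hx1⟩ := hne
      refine ⟨x, hmono (k := 1) (by simp; omega) (by simpa using hx), hx1, by simp⟩
    · obtain ⟨a, rfl⟩ := Finset.card_eq_one.1
        (le_antisymm (by simpa using hcard) hne'.card_pos)
      refine ⟨a, by simpa using hT, by simpa [eq_comm] using hT1, by simp⟩
  | succ m ih =>
    obtain ⟨T₁, hT₁, hc₁⟩ := Finset.exists_subset_card_eq (min_le_left T.card (2 ^ m))
    have hc₂ : (T \ T₁).card ≤ 2 ^ m := by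
      rw [Finset.card_sdiff_of_subset hT₁]
      rw [pow_succ] at hcard
      omega
    obtain ⟨u, hu, hu1, huN⟩ := ih T₁ (hT₁.trans hT) (fun h => hT1 (hT₁ h)) (by omega)
    obtain ⟨v, hv, hv1, hvN⟩ := ih (T \ T₁) (Finset.sdiff_subset.trans hT)
      (fun h => hT1 (Finset.sdiff_subset h)) hc₂
    obtain ⟨g, hg, hgc⟩ := hcomm u v hu1 hv1
    have hv' : g * v * g⁻¹ ∈ S ^ (5 + 24 ^ m * n + 5) := by
      rw [pow_add, pow_add]
      exact Finset.mul_mem_mul (Finset.mul_mem_mul hg hv) (hinv hg)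
    refine ⟨⁅u, g * v * g⁻¹⁆, ?_, ?_, ?_⟩
    · have hlen : 24 ^ m * n + (5 + 24 ^ m * n + 5) + 24 ^ m * n + (5 + 24 ^ m * n + 5)
          ≤ 24 ^ (m + 1) * n := by
        have : 0 < 24 ^ m * n := by positivity
        rw [pow_succ]
        linarith
      apply hmono hlen
      rw [commutatorElement_def, pow_add, pow_add, pow_add _ (24 ^ m * n)]
      exact Finset.mul_mem_mul (Finset.mul_mem_mul (Finset.mul_mem_mul hu hv') (hinv hu))
        (hinv hv')
    · rwa [Ne, commutatorElement_eq_one_iff_commute]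
    · intro N hN t ht htN
      rw [commutatorElement_def]
      by_cases h : t ∈ T₁
      · have := huN N hN t h htN
        rw [mul_assoc, mul_assoc, ← mul_assoc (g * v * g⁻¹)]
        exact N.mul_mem this (hN.conj_mem _ (N.inv_mem this) _)
      · have := hN.conj_mem _ (hvN N hN t (Finset.mem_sdiff.2 ⟨ht, h⟩) htN) g
        exact N.mul_mem (hN.conj_mem _ this _) (N.inv_mem this)

namespace Monoid.CoprodI

variable {ι : Type*} {M : ι → Type*} [∀ i, Group (M i)]

lemma NeWord.prod_ne_prod {i j k l : ι} (u : NeWord M i j) (v : NeWord M k l) (h : i ≠ k) :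
    u.prod ≠ v.prod := by
  classical
  intro he
  have := Word.equiv.symm.injective (a₁ := u.toWord) (a₂ := v.toWord) he
  have h2 : u.toList.head? = v.toList.head? := congrArg (fun w => w.toList.head?) this
  rw [u.toList_head?, v.toList_head?] at h2
  exact h (congrArg Sigma.fst (Option.some.inj h2))

lemma exists_neWord_prod_eq {u : CoprodI M} (hu : u ≠ 1) :
    ∃ (i j : ι) (w : NeWord M i j), w.prod = u := by
  classical
  have h : Word.equiv u ≠ Word.empty := by
    intro h
    apply hu
    rw [← Word.equiv.symm_apply_apply u, h]
    rfl
  obtain ⟨i, j, w, hw⟩ := NeWord.of_word _ h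
  refine ⟨i, j, w, ?_⟩
  rw [NeWord.prod, hw]
  exact Word.equiv.symm_apply_apply u

/-- Every nontrivial element of a free product is conjugate, by one of three prescribed elements
of a factor, to an element whose normal form starts and ends in that factor. -/
lemma exists_conj_eq_neWord_prod {i : ι} {s t : M i} (hs : s ≠ 1) (ht : t ≠ 1) (hst : s ≠ t)
    {u : CoprodI M} (hu : u ≠ 1) :
    ∃ c : M i, (c = 1 ∨ c = s ∨ c = t) ∧ ∃ w : NeWord M i i, w.prod = of c * u * (of c)⁻¹ := by
  have key : ∀ {q : ι} (w : NeWord M i q), q ≠ i → ∃ c : M i, (c = 1 ∨ c = s ∨ c = t) ∧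
      ∃ w' : NeWord M i i, w'.prod = of c * w.prod * (of c)⁻¹ := by
    intro q w hq
    have : ∃ c : M i, (c = s ∨ c = t) ∧ c ≠ 1 ∧ c * w.head ≠ 1 := by
      by_cases h : s * w.head = 1
      · exact ⟨t, .inr rfl, ht, fun h' => hst (mul_right_cancel (h.trans h'.symm))⟩
      · exact ⟨s, .inl rfl, hs, h⟩
    obtain ⟨c, hc, hc1, hcw⟩ := this
    exact ⟨c, .inr hc, (w.mulHead c hcw).append hq (.singleton c⁻¹ (inv_ne_one.2 hc1)), by simp⟩
  obtain ⟨p, q, w, rfl⟩ := exists_neWord_prod_eq hu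
  by_cases hp : p = i
  · subst hp
    by_cases hq : q = p
    · subst hq
      exact ⟨1, .inl rfl, w, by simp⟩
    · exact key w hq
  · by_cases hq : q = i
    · subst hq
      obtain ⟨c, hc, w', hw'⟩ := key w.inv hp
      exact ⟨c, hc, w'.inv, by simp [hw', mul_assoc]⟩
    · exact ⟨s, .inr (.inl rfl), ((NeWord.singleton s hs).append (Ne.symm hp) w).append hq
        (.singleton s⁻¹ (inv_ne_one.2 hs)), by simp⟩

end Monoid.CoprodI

section MixedWord

variable {G : Type*} [Group G]

/-- The embedding of `G ∗ ⟨x⟩` in the free product of two copies of `G × ⟨x⟩`. -/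
def mixedWordToCoprodI (G : Type*) [Group G] :
    MixedWordGroup G →* Monoid.CoprodI (fun _ : Bool => G × Multiplicative ℤ) :=
  Monoid.Coprod.lift
    ((Monoid.CoprodI.of (M := fun _ : Bool => G × Multiplicative ℤ) (i := true)).comp
      (MonoidHom.inl G (Multiplicative ℤ)))
    ((Monoid.CoprodI.of (M := fun _ : Bool => G × Multiplicative ℤ) (i := false)).comp
      (MonoidHom.inr G (Multiplicative ℤ)))

lemma mixedWordToCoprodI_injective : Function.Injective (mixedWordToCoprodI G) := by
  let r : Monoid.CoprodI (fun _ : Bool => G × Multiplicative ℤ) →* MixedWordGroup G :=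
    Monoid.CoprodI.lift (fun b => if b then Monoid.Coprod.inl.comp (MonoidHom.fst _ _)
      else Monoid.Coprod.inr.comp (MonoidHom.snd _ _))
  have h : r.comp (mixedWordToCoprodI G) = MonoidHom.id _ := by
    apply Monoid.Coprod.hom_ext <;> ext <;> simp [r, mixedWordToCoprodI]
  exact Function.LeftInverse.injective (g := r) (DFunLike.congr_fun h)

lemma exists_not_commute_conj {a : G} (ha : a ≠ 1) {u v : MixedWordGroup G} (hu : u ≠ 1)
    (hv : v ≠ 1) :
    ∃ k l : ℕ, k ≤ 2 ∧ l ≤ 2 ∧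
      ¬ Commute u (((xGen G ^ k)⁻¹ * Monoid.Coprod.inl a * xGen G ^ l) * v *
        ((xGen G ^ k)⁻¹ * Monoid.Coprod.inl a * xGen G ^ l)⁻¹) := by
  let M : Bool → Type _ := fun _ => G × Multiplicative ℤ
  let φ := mixedWordToCoprodI G
  have hφ (k : ℕ) : φ (xGen G ^ k) =
      Monoid.CoprodI.of (M := M) (i := false) (1, Multiplicative.ofAdd (k : ℤ)) := by
    rw [map_pow]
    simp only [φ, xGen, mixedWordToCoprodI, Monoid.Coprod.lift_apply_inr, MonoidHom.comp_apply]
    rw [← map_pow]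
    congr 1
    ext <;> simp
  have main {u : MixedWordGroup G} (hu : u ≠ 1) : ∃ k : ℕ, k ≤ 2 ∧
      ∃ w : Monoid.CoprodI.NeWord M false false,
        w.prod = φ (xGen G ^ k * u * (xGen G ^ k)⁻¹) := by
    have h1 : ((1, Multiplicative.ofAdd ((1 : ℕ) : ℤ)) : M false) ≠ 1 := by
      intro h
      have := congrArg (fun p => Multiplicative.toAdd p.2) h
      simp at this
    have h2 : ((1, Multiplicative.ofAdd ((2 : ℕ) : ℤ)) : M false) ≠ 1 := by
      intro h
      have := congrArg (fun p => Multiplicative.toAdd p.2) h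
      simp at this
    have h12 : ((1, Multiplicative.ofAdd ((1 : ℕ) : ℤ)) : M false) ≠
        (1, Multiplicative.ofAdd ((2 : ℕ) : ℤ)) := by
      intro h
      have := congrArg (fun p => Multiplicative.toAdd p.2) h
      simp at this
    obtain ⟨c, hc, w, hw⟩ := Monoid.CoprodI.exists_conj_eq_neWord_prod (M := M) (i := false) h1 h2 h12
      ((map_ne_one_iff φ mixedWordToCoprodI_injective).2 hu)
    rcases hc with rfl | rfl | rfl
    · exact ⟨0, by simp, w, by simpa using hw⟩
    · exact ⟨1, by simp, w, by rw [hw, map_mul, map_mul, map_inv, hφ]⟩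
    · exact ⟨2, le_rfl, w, by rw [hw, map_mul, map_mul, map_inv, hφ]⟩
  obtain ⟨k, hk, w, hw⟩ := main hu
  obtain ⟨l, hl, w', hw'⟩ := main hv
  refine ⟨k, l, hk, hl, fun hcomm => ?_⟩
  have ha' : ((a, 1) : M true) ≠ 1 := by
    intro h
    exact ha (congrArg Prod.fst h)
  let w'' := ((Monoid.CoprodI.NeWord.singleton (M := M) (i := true) (a, 1) ha').append (by decide) w').append
    (by decide) (.singleton (M := M) (i := true) ((a, 1) : M true)⁻¹ (inv_ne_one.2 ha'))
  have hw'' : w''.prod = φ (Monoid.Coprod.inl a * (xGen G ^ l * v * (xGen G ^ l)⁻¹) *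
      (Monoid.Coprod.inl a)⁻¹) := by
    simp only [w'', Monoid.CoprodI.NeWord.append_prod, hw', Monoid.CoprodI.NeWord.prod_singleton,
      map_mul, map_inv]
    rfl
  clear_value w''
  apply Monoid.CoprodI.NeWord.prod_ne_prod (w.append (by decide) w'') (w''.append (by decide) w)
    (by decide)
  rw [Monoid.CoprodI.NeWord.append_prod, Monoid.CoprodI.NeWord.append_prod, hw, hw'',
    ← map_mul, ← map_mul]
  congr 1
  simpa [mul_assoc] using congrArg (fun z => xGen G ^ k * z * (xGen G ^ k)⁻¹) hcomm.eq

end MixedWord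

section WordLength

variable {W : Type*} [Group W]

lemma wordLength_le_of_list {S : Set W} {l : List W} (hl : ∀ a ∈ l, a ∈ S) :
    wordLength S l.prod ≤ l.length :=
  Nat.sInf_le ⟨l, hl, rfl, rfl⟩

lemma wordLength_le_of_mem_pow [DecidableEq W] {S : Finset W} {n : ℕ} {w : W}
    (hw : w ∈ (insert 1 S) ^ n) : wordLength (S : Set W) w ≤ n := by
  suffices ∃ l : List W, (∀ a ∈ l, a ∈ S) ∧ l.length ≤ n ∧ l.prod = w by
    obtain ⟨l, hl, hn, rfl⟩ := this
    exact (wordLength_le_of_list (by simpa using hl)).trans hn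
  induction n generalizing w with
  | zero => exact ⟨[], by simp, by simp, by simpa [eq_comm] using hw⟩
  | succ n ih =>
    rw [pow_succ'] at hw
    obtain ⟨s, hs, y, hy, rfl⟩ := Finset.mem_mul.1 hw
    obtain ⟨l, hl, hn, rfl⟩ := ih hy
    rcases Finset.mem_insert.1 hs with rfl | hs
    · exact ⟨l, hl, by omega, by simp⟩
    · exact ⟨s :: l, by simpa using ⟨hs, hl⟩, by simpa using hn, by simp⟩

lemma mem_pow_of_wordLength_le [DecidableEq W] {S : Finset W}
    (hS : Submonoid.closure (S : Set W) = ⊤) {n : ℕ} {w : W}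
    (hw : wordLength (S : Set W) w ≤ n) : w ∈ (insert 1 S) ^ n := by
  have hne : {n | ∃ l : List W, (∀ a ∈ l, a ∈ (S : Set W)) ∧ l.length = n ∧
      l.prod = w}.Nonempty := by
    obtain ⟨l, hl, h⟩ := Submonoid.exists_list_of_mem_closure (hS ▸ Submonoid.mem_top w)
    exact ⟨_, l, hl, rfl, h⟩
  obtain ⟨l, hl, hlen, rfl⟩ := Nat.sInf_mem hne
  suffices h : l.prod ∈ (insert 1 S) ^ l.length from
    Finset.pow_right_monotone (Finset.mem_insert_self 1 S) (hlen.trans_le hw) h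
  clear hw hne hlen
  induction l with
  | nil => simp
  | cons a l ih =>
    rw [List.prod_cons, List.length_cons, pow_succ']
    exact Finset.mul_mem_mul (Finset.mem_insert_of_mem (by simpa using hl a (by simp)))
      (ih fun b hb => hl b (by simp [hb]))

end WordLength

lemma submonoid_closure_mixedGenSet {G : Type*} [Group G] {X : Set G}
    (hX : Submonoid.closure X = ⊤) : Submonoid.closure (mixedGenSet X) = ⊤ := by
  have hx : xGen G ∈ Submonoid.closure (mixedGenSet X) :=
    Submonoid.subset_closure (by simp [mixedGenSet])
  have hx' : (xGen G)⁻¹ ∈ Submonoid.closure (mixedGenSet X) :=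
    Submonoid.subset_closure (by simp [mixedGenSet])
  rw [eq_top_iff]
  rintro w -
  induction w using Monoid.Coprod.induction_on with
  | inl g =>
    have : (Submonoid.closure X).map Monoid.Coprod.inl ≤ Submonoid.closure (mixedGenSet X) := by
      rw [MonoidHom.map_mclosure]
      exact Submonoid.closure_mono Set.subset_union_left
    exact this ⟨g, by simp [hX], rfl⟩
  | inr z =>
    have hz : Monoid.Coprod.inr z = xGen G ^ Multiplicative.toAdd z := by
      rw [xGen, ← map_zpow, ← ofAdd_zsmul]
      simp
    rw [hz]
    obtain ⟨n, hn | hn⟩ := (Multiplicative.toAdd z).eq_nat_or_neg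
    · rw [hn, zpow_natCast]
      exact Submonoid.pow_mem _ hx n
    · rw [hn, _root_.zpow_neg, zpow_natCast, ← inv_pow]
      exact Submonoid.pow_mem _ hx' n
  | mul x y hx hy => exact Submonoid.mul_mem _ hx hy

theorem stmt2 {G : Type*} [Group G] (X : Finset G) (hXsymm : ∀ a ∈ X, a⁻¹ ∈ X)
    (hXgen : Subgroup.closure (X : Set G) = ⊤)
    (hsharp : ∃ C : ℝ, 0 < C ∧
      ∀ w : MixedWordGroup G, w ≠ 1 →
        ∃ γ : G, (wordLength (X : Set G) γ : ℝ) ≤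
            C * Real.log ((wordLength (mixedGenSet (X : Set G)) w : ℝ) + 1) ∧
          evalWord γ w ≠ 1) :
    ∃ C' : ℝ, 0 < C' ∧
      ∀ n : ℕ, 0 < n →
        ∃ γ : G, (wordLength (X : Set G) γ : ℝ) ≤ C' * n ∧
          ∀ w : MixedWordGroup G, w ≠ 1 →
            wordLength (mixedGenSet (X : Set G)) w ≤ n →
            evalWord γ w ≠ 1 := by
  classical
  obtain ⟨C, hC, hsharp⟩ := hsharp
  have hx1 : xGen G ≠ 1 := by
    rw [xGen, Ne, map_eq_one_iff _ Monoid.Coprod.inr_injective]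
    decide
  obtain ⟨a, haX, ha⟩ : ∃ a ∈ X, a ≠ 1 := by
    by_contra! h
    obtain ⟨γ, -, hγ⟩ := hsharp _ hx1
    have : γ ∈ Subgroup.closure (X : Set G) := hXgen ▸ Subgroup.mem_top γ
    rw [Subgroup.closure_eq_bot_iff.2 (fun b hb => h b hb),
      Subgroup.mem_bot] at this
    subst this
    simp [evalWord, xGen] at hγ
  let Y : Finset (MixedWordGroup G) :=
    X.image Monoid.Coprod.inl ∪ {xGen G, (xGen G)⁻¹}
  have hY : (Y : Set (MixedWordGroup G)) = mixedGenSet (X : Set G) := by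
    simp [Y, mixedGenSet]
  have hXmon : Submonoid.closure (X : Set G) = ⊤ := by
    have h := Subgroup.closure_toSubmonoid (X : Set G)
    rw [hXgen, Set.union_eq_self_of_subset_right
      (fun b hb => by simpa using hXsymm _ (Set.mem_inv.1 hb))] at h
    exact h.symm
  have hYmon : Submonoid.closure (Y : Set (MixedWordGroup G)) = ⊤ := by
    rw [hY]
    exact submonoid_closure_mixedGenSet hXmon
  have hYinv : (insert 1 Y)⁻¹ = insert 1 Y := by
    have hsub : ∀ y ∈ insert 1 Y, y⁻¹ ∈ insert 1 Y := by
      intro y hy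
      simp only [Y, Finset.mem_insert, Finset.mem_union, Finset.mem_image,
        Finset.mem_singleton] at hy ⊢
      rcases hy with rfl | ⟨b, hb, rfl⟩ | rfl | rfl
      · simp
      · exact .inr (.inl ⟨b⁻¹, hXsymm b hb, map_inv _ _⟩)
      · simp
      · simp
    ext y
    rw [Finset.mem_inv']
    exact ⟨fun h => by simpa using hsub _ h, hsub y⟩
  have h1Y : 1 ∈ insert 1 Y := Finset.mem_insert_self 1 Y
  have hxY : xGen G ∈ insert 1 Y := by simp [Y]
  have hcomm : ∀ u v : MixedWordGroup G, u ≠ 1 → v ≠ 1 →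
      ∃ g ∈ (insert 1 Y) ^ 5, ¬ Commute u (g * v * g⁻¹) := by
    intro u v hu hv
    obtain ⟨k, l, hk, hl, h⟩ := exists_not_commute_conj ha hu hv
    refine ⟨_, ?_, h⟩
    have hpow : ∀ {y} {k : ℕ}, y ∈ insert 1 Y → k ≤ 2 → y ^ k ∈ (insert 1 Y) ^ 2 :=
      fun hy hk => Finset.pow_right_monotone h1Y hk (Finset.pow_mem_pow hy)
    rw [show 5 = 2 + 1 + 2 from rfl, pow_add, pow_add, pow_one, ← inv_pow]
    refine Finset.mul_mem_mul (Finset.mul_mem_mul (hpow ?_ hk) ?_) (hpow hxY hl)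
    · simp [Y]
    · simp only [Y, Finset.mem_insert, Finset.mem_union, Finset.mem_image]
      exact .inr (.inl ⟨a, haX, rfl⟩)
  set d := (insert 1 Y).card
  refine ⟨C * (d * Real.log 24 + Real.log 2), by positivity, fun n hn => ?_⟩
  obtain ⟨w, hw, hw1, hwN⟩ := exists_short_mem_of_normal_inter (insert 1 Y) hYinv h1Y
    ⟨_, hxY, hx1⟩ hcomm hn (d * n) (((insert 1 Y) ^ n).erase 1) (Finset.erase_subset _ _)
    (Finset.notMem_erase _ _) (by
      refine (Finset.card_le_card (Finset.erase_subset _ _)).trans (Finset.card_pow_le.trans ?_)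
      rw [pow_mul]
      exact Nat.pow_le_pow_left Nat.lt_two_pow_self.le n)
  obtain ⟨γ, hγ, hγw⟩ := hsharp w hw1
  refine ⟨γ, hγ.trans ?_, fun v hv hvn hv1 => hγw ?_⟩
  · rw [mul_assoc]
    refine mul_le_mul_of_nonneg_left ?_ hC.le
    have hlen : wordLength (mixedGenSet (X : Set G)) w + 1 ≤ 24 ^ (d * n) * 2 ^ n := by
      have h1 := hY ▸ wordLength_le_of_mem_pow hw
      have h2 : n + 1 ≤ 2 ^ n := Nat.lt_two_pow_self
      have h3 : 1 ≤ 24 ^ (d * n) := Nat.one_le_pow _ _ (by norm_num)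
      nlinarith
    calc Real.log ((wordLength (mixedGenSet (X : Set G)) w : ℝ) + 1)
        ≤ Real.log (24 ^ (d * n) * 2 ^ n) :=
          Real.log_le_log (by positivity) (by exact_mod_cast hlen)
      _ = (d * Real.log 24 + Real.log 2) * n := by
          rw [Real.log_mul (by positivity) (by positivity), Real.log_pow, Real.log_pow]
          push_cast
          ring
  · rw [← hY] at hvn
    exact MonoidHom.mem_ker.1 (hwN (evalWord γ).ker inferInstance v
      (Finset.mem_erase.2 ⟨hv, mem_pow_of_wordLength_le hYmon hvn⟩) (MonoidHom.mem_ker.2 hv1))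
end

section
/- Let d ≥ 1 and let Γ ≤ GL_d(ℂ) be a finitely generated mixed identity free group. Then Γ is primitive: there exists a proper subgroup M of Γ that is maximal among proper subgroups of Γ and whose normal core ⋂_{γ ∈ Γ} γMγ⁻¹ is the trivial subgroup (equivalently, Γ admits a faithful primitive permutation action, namely on the coset space Γ/M). -/
open Matrix

/-- A group is mixed identity free if every nontrivial mixed word has a nontrivial value. -/
def IsMIF (G : Type*) [Group G] : Prop :=
  ∀ w : MixedWordGroup G, w ≠ 1 → ∃ γ : G, evalWord γ w ≠ 1

section MIF

variable {G : Type*} [Group G]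

lemma evalWord_inl (γ g : G) : evalWord γ (Monoid.Coprod.inl g) = g := by
  simp [evalWord]

lemma evalWord_xGen (γ : G) : evalWord γ (xGen G) = γ := by
  simp [evalWord, xGen]

lemma IsMIF.exists_pow_ne_one (h : IsMIF G) {n : ℕ} (hn : 0 < n) : ∃ γ : G, γ ^ n ≠ 1 := by
  obtain ⟨γ, hγ⟩ := h (xGen G ^ n) (by
    intro hw
    have := congrArg (Monoid.Coprod.snd : MixedWordGroup G →* _) hw
    simp only [xGen, map_pow, Monoid.Coprod.snd_apply_inr, map_one] at this
    rw [← ofAdd_nsmul] at this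
    have := congrArg Multiplicative.toAdd this
    simp at this
    omega)
  exact ⟨γ, by simpa [evalWord_xGen] using hγ⟩

lemma IsMIF.infinite (h : IsMIF G) : Infinite G := by
  by_contra hfin
  rw [not_infinite_iff_finite] at hfin
  obtain ⟨γ, hγ⟩ := h.exists_pow_ne_one (n := Nat.card G) Nat.card_pos
  exact hγ pow_card_eq_one'

/-- The permutation of `G ⊕ G` fixing both copies of `1` and exchanging the two copies elsewhere. -/
noncomputable def gluedSwap (G : Type*) [Group G] : Equiv.Perm (G ⊕ G) :=
  letI := Classical.decEq G
  (Equiv.sumComm G G : Equiv.Perm (G ⊕ G)) * Equiv.swap (Sum.inl 1) (Sum.inr 1)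

/-- The action of `G` on `G ⊕ G` by left translation on the first summand. -/
noncomputable def leftSumHom (G : Type*) [Group G] : G →* Equiv.Perm (G ⊕ G) :=
  (Equiv.Perm.sumCongrHom G G).comp ((MulAction.toPermHom G G).prod 1)

lemma conj_commutator_word_ne_one {a b : G} (ha : a ≠ 1) (hb : b ≠ 1) :
    (xGen G * Monoid.Coprod.inl a * (xGen G)⁻¹) * Monoid.Coprod.inl b ≠
      (Monoid.Coprod.inl b * (xGen G * Monoid.Coprod.inl a * (xGen G)⁻¹) : MixedWordGroup G) := by
  intro h
  have h1 := congrArg (Monoid.Coprod.lift (leftSumHom G) (zpowersHom _ (gluedSwap G))) h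
  simp only [xGen, map_mul, map_inv, Monoid.Coprod.lift_apply_inl, Monoid.Coprod.lift_apply_inr,
    zpowersHom_apply, toAdd_ofAdd, zpow_one] at h1
  have h2 := congrArg (fun p : Equiv.Perm (G ⊕ G) => p (Sum.inl 1)) h1
  have e1 : ∀ (g u : G), leftSumHom G g (Sum.inl u) = Sum.inl (g * u) := by
    intro g u; simp [leftSumHom]
  have e2 : ∀ (g u : G), leftSumHom G g (Sum.inr u) = Sum.inr u := by
    intro g u; simp [leftSumHom]
  have s1 : gluedSwap G (Sum.inl 1) = Sum.inl 1 := by simp [gluedSwap]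
  have s2 : ∀ u : G, u ≠ 1 → gluedSwap G (Sum.inl u) = Sum.inr u := by
    intro u hu
    simp [gluedSwap, Equiv.swap_apply_of_ne_of_ne, hu]
  have s3 : ∀ u : G, u ≠ 1 → gluedSwap G (Sum.inr u) = Sum.inl u := by
    intro u hu
    simp [gluedSwap, Equiv.swap_apply_of_ne_of_ne, hu]
  have t1 : (gluedSwap G)⁻¹ (Sum.inl 1) = Sum.inl 1 := by
    rw [Equiv.Perm.inv_eq_iff_eq, s1]
  have t2 : (gluedSwap G)⁻¹ (Sum.inl b) = Sum.inr b := by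
    rw [Equiv.Perm.inv_eq_iff_eq, s3 b hb]
  simp only [Equiv.Perm.mul_apply, e1, mul_one, t1, t2, e2, s2 a ha, s3 b hb] at h2
  cases h2

lemma IsMIF.exists_not_commute_conj (h : IsMIF G) {a b : G} (ha : a ≠ 1) (hb : b ≠ 1) :
    ∃ γ : G, ¬ Commute (γ * a * γ⁻¹) b := by
  have hw := conj_commutator_word_ne_one ha hb
  obtain ⟨γ, hγ⟩ := h _ (fun h1 => hw (mul_inv_eq_one.1 h1))
  refine ⟨γ, fun hc => hγ ?_⟩
  rw [map_mul, map_inv, mul_inv_eq_one]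
  simpa [evalWord_inl, evalWord_xGen] using hc.eq

lemma IsMIF.eq_bot_of_commute (h : IsMIF G) {N N' : Subgroup G} [N.Normal] (hN : N ≠ ⊥)
    (hc : ∀ a ∈ N, ∀ b ∈ N', Commute a b) : N' = ⊥ := by
  by_contra hN'
  obtain ⟨⟨a, haN⟩, ha⟩ := Subgroup.ne_bot_iff_exists_ne_one.1 hN
  obtain ⟨⟨b, hbN⟩, hb⟩ := Subgroup.ne_bot_iff_exists_ne_one.1 hN'
  obtain ⟨γ, hγ⟩ := h.exists_not_commute_conj (a := a) (by simpa using ha) (b := b)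
    (by simpa using hb)
  exact hγ (hc _ (Subgroup.Normal.conj_mem ‹_› a haN γ) b hbN)

lemma IsMIF.inf_ne_bot (h : IsMIF G) {N N' : Subgroup G} [N.Normal] [N'.Normal]
    (hN : N ≠ ⊥) (hN' : N' ≠ ⊥) :
    N ⊓ N' ≠ ⊥ := by
  intro hb
  exact hN' (h.eq_bot_of_commute hN fun a ha b hb' =>
    Subgroup.commute_of_normal_of_disjoint N N' ‹_› ‹_› (disjoint_iff.2 hb) a b ha hb')

lemma IsMIF.commutator_ne_bot (h : IsMIF G) {N : Subgroup G} [N.Normal] (hN : N ≠ ⊥) :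
    ⁅N, N⁆ ≠ ⊥ := by
  intro hb
  refine hN (h.eq_bot_of_commute hN fun a ha b hb' => ?_)
  have := Subgroup.commutator_mem_commutator ha hb'
  rw [hb, Subgroup.mem_bot, commutatorElement_eq_one_iff_commute] at this
  exact this

lemma IsMIF.infinite_of_ne_bot (h : IsMIF G) {N : Subgroup G} [N.Normal] (hN : N ≠ ⊥) :
    Infinite N := by
  by_contra hfin
  rw [not_infinite_iff_finite] at hfin
  have hC : Subgroup.centralizer (N : Set G) = ⊥ :=
    h.eq_bot_of_commute hN fun a ha b hb => Subgroup.mem_centralizer_iff.1 hb a ha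
  have hinj : Function.Injective (MulAut.conjNormal : G →* MulAut N) := by
    rw [← MonoidHom.ker_eq_bot_iff, eq_bot_iff, ← hC]
    intro g hg
    rw [Subgroup.mem_centralizer_iff]
    intro n hn
    have := congrArg (fun f : MulAut N => ((f ⟨n, hn⟩ : N) : G)) (MonoidHom.mem_ker.1 hg)
    simp only [MulAut.conjNormal_apply, MulAut.one_apply] at this
    rw [mul_inv_eq_iff_eq_mul] at this
    exact this.symm
  have : Finite (MulAut N) :=
    Finite.of_injective (fun f : MulAut N => (f : N → N)) DFunLike.coe_injective
  have := Finite.of_injective _ hinj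
  exact not_finite_iff_infinite.2 h.infinite this

end MIF

lemma top_mem_of_sSup_eq_top {G : Type*} [Group G] (hfg : Group.FG G) {S : Set (Subgroup G)}
    (hne : S.Nonempty) (hS : DirectedOn (· ≤ ·) S) (htop : sSup S = ⊤) : ⊤ ∈ S := by
  obtain ⟨s, hs⟩ := Group.fg_def.1 hfg
  have key : ∀ t : Finset G, ∃ H ∈ S, (t : Set G) ⊆ H := by
    classical
    intro t
    induction t using Finset.induction_on with
    | empty => exact hne.imp fun H hH => ⟨hH, by simp⟩
    | insert a t _ ih =>
      obtain ⟨H, hH, ht⟩ := ih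
      have ha : a ∈ sSup S := htop ▸ Subgroup.mem_top a
      obtain ⟨K, hK, haK⟩ := (Subgroup.mem_sSup_of_directedOn hne hS).1 ha
      obtain ⟨L, hL, hHL, hKL⟩ := hS H hH K hK
      refine ⟨L, hL, ?_⟩
      simp only [Finset.coe_insert, Set.insert_subset_iff]
      exact ⟨hKL haK, ht.trans hHL⟩
  obtain ⟨H, hH, hsH⟩ := key s
  rwa [← top_le_iff.1 (hs ▸ (Subgroup.closure_le H).2 hsH)]

/-- A proper subgroup of a finitely generated group mapping onto every proper quotient lies in a
maximal subgroup with trivial core. -/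
lemma exists_isCoatom_normalCore_eq_bot {G : Type*} [Group G] (hfg : Group.FG G) (H : Subgroup G)
    (hH : H ≠ ⊤) (hd : ∀ g : G, g ≠ 1 → ∀ γ : G, ∃ n ∈ Subgroup.normalClosure {g}, γ * n ∈ H) :
    ∃ M : Subgroup G, IsCoatom M ∧ M.normalCore = ⊥ := by
  have : IsCoatomic (Subgroup G) := by
    refine IsCoatomic.of_isChain_bounded fun c hc hne hc' => ⟨sSup c, fun h => hc' ?_,
      fun _ => le_sSup⟩
    exact top_mem_of_sSup_eq_top hfg hne hc.directedOn h
  obtain ⟨M, hM, hHM⟩ := (eq_top_or_exists_le_coatom H).resolve_left hH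
  refine ⟨M, hM, ?_⟩
  by_contra hcore
  obtain ⟨⟨g, hg⟩, hg1⟩ := Subgroup.ne_bot_iff_exists_ne_one.1 hcore
  have hle : Subgroup.normalClosure {g} ≤ M.normalCore :=
    Subgroup.normalClosure_le_normal (by simpa using hg)
  apply hM.1
  rw [eq_top_iff]
  intro γ _
  obtain ⟨n, hn, hγ⟩ := hd g (by simpa using hg1) γ
  have h1 := M.mul_mem (hHM hγ) (M.inv_mem (M.normalCore_le (hle hn)))
  simpa using h1

section Alternating

variable {G Ω : Type*} [Group G] [MulAction G Ω]

/-- Alternating products of nontrivial elements of two subgroups, with first factor in `F b`. -/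
inductive IsAlternating (F : Bool → Subgroup G) : Bool → G → Prop
  | one (b : Bool) : IsAlternating F b 1
  | cons (b : Bool) (g w : G) : g ∈ F b → g ≠ 1 → IsAlternating F (!b) w → IsAlternating F b (g * w)

lemma IsAlternating.exists_mul {F : Bool → Subgroup G} {b : Bool} {g : G} (hg : g ∈ F b) {w : G}
    (hw : ∃ b', IsAlternating F b' w) : ∃ b', IsAlternating F b' (g * w) := by
  obtain ⟨b', hw⟩ := hw
  by_cases hg1 : g = 1
  · exact ⟨b', by simpa [hg1] using hw⟩
  by_cases hb : b' = b
  · subst hb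
    cases hw with
    | one => exact ⟨b', .cons b' g 1 hg hg1 (.one _)⟩
    | cons _ g' w' hg' _ hw' =>
      rw [← mul_assoc]
      by_cases h1 : g * g' = 1
      · exact ⟨!b', by simpa [h1] using hw'⟩
      · exact ⟨b', .cons b' _ w' (mul_mem hg hg') h1 hw'⟩
  · have hb' : b' = !b := by cases b <;> cases b' <;> simp_all
    exact ⟨b, .cons b g w hg hg1 (hb' ▸ hw)⟩

lemma IsAlternating.of_mem_iSup {F : Bool → Subgroup G} {w : G} (hw : w ∈ ⨆ b, F b) :
    ∃ b, IsAlternating F b w := by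
  rw [Subgroup.iSup_eq_closure] at hw
  induction hw using Subgroup.closure_induction_left with
  | one => exact ⟨true, .one _⟩
  | mul_left x hx y _ ih =>
    obtain ⟨b, hb⟩ := Set.mem_iUnion.1 hx
    exact IsAlternating.exists_mul hb ih
  | inv_mul_cancel x hx y _ ih =>
    obtain ⟨b, hb⟩ := Set.mem_iUnion.1 hx
    exact IsAlternating.exists_mul (inv_mem hb) ih

lemma IsAlternating.smul_mem {F : Bool → Subgroup G} {V : Bool → Set Ω} {O : Set Ω}
    (hO : ∀ b, ∀ g ∈ F b, g ≠ 1 → ∀ x ∈ O, g • x ∈ V b)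
    (hV : ∀ b, ∀ g ∈ F b, g ≠ 1 → ∀ x ∈ V (!b), g • x ∈ V b) {b : Bool} {w : G}
    (hw : IsAlternating F b w) : w = 1 ∨ ∀ x ∈ O, w • x ∈ V b := by
  induction hw with
  | one b => exact .inl rfl
  | cons b g w hg hg1 _ ih =>
    right
    intro x hx
    rcases ih with rfl | ih
    · simpa using hO b g hg hg1 x hx
    · rw [mul_smul]
      exact hV b g hg hg1 _ (ih x hx)

/-- A form of the ping-pong lemma for two subgroups. -/
lemma smul_mem_of_mem_sup {H K : Subgroup G} {O U A : Set Ω}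
    (hHO : ∀ g ∈ H, g ≠ 1 → ∀ x ∈ O, g • x ∈ U) (hHA : ∀ g ∈ H, g ≠ 1 → ∀ x ∈ A, g • x ∈ U)
    (hKO : ∀ g ∈ K, g ≠ 1 → ∀ x ∈ O, g • x ∈ A) (hKU : ∀ g ∈ K, g ≠ 1 → ∀ x ∈ U, g • x ∈ A)
    {w : G} (hw : w ∈ H ⊔ K) (hw1 : w ≠ 1) {x : Ω} (hx : x ∈ O) : w • x ∈ U ∪ A := by
  have hw' : w ∈ ⨆ b : Bool, (bif b then H else K) := by
    rwa [← sup_eq_iSup]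
  obtain ⟨b, hb⟩ := IsAlternating.of_mem_iSup hw'
  have := hb.smul_mem (V := fun b => bif b then U else A) (O := O)
    (by rintro (_ | _) <;> simpa) (by rintro (_ | _) <;> simpa)
  cases b
  · exact .inr ((this.resolve_left hw1) x hx)
  · exact .inl ((this.resolve_left hw1) x hx)

end Alternating

section PingPong

variable {G Ω : Type*} [Group G] [MulAction G Ω]

/-- `g` eventually moves the sets `P n` off the sets `Z n`. -/
def MovesOff (P Z : ℕ → Set Ω) (g : G) : Prop :=
  ∃ n, ∀ x ∈ P n, g • x ∉ Z n

/-- Attracting sets `P n` and repelling sets `Z n` for which every nontrivial normal subgroup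
contains contractions and elements in general position. -/
structure IsPingPongTable (G : Type*) {Ω : Type*} [Group G] [MulAction G Ω] (P Z : ℕ → Set Ω) :
    Prop where
  antitone_attr : Antitone P
  antitone_rep : Antitone Z
  nonempty_inter : ∀ n, (P n ∩ Z n).Nonempty
  exists_contracting : ∀ N : Subgroup G, N.Normal → N ≠ ⊥ → ∀ n, ∃ t ∈ N, ∀ x, x ∉ Z n →
    t • x ∈ P n ∧ t⁻¹ • x ∈ P n
  exists_generic : ∀ N : Subgroup G, N.Normal → N ≠ ⊥ → ∀ L : List (G × G), ∃ y ∈ N, ∀ q ∈ L,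
    MovesOff P Z (q.1 * y * q.2) ∧ MovesOff P Z (q.1 * y⁻¹ * q.2)

/-- The nontrivial elements of `H` move `c • P n` off `c • Z n`. -/
def SubgroupMovesOff (P Z : ℕ → Set Ω) (H : Subgroup G) (c : G) (n : ℕ) : Prop :=
  ∀ h ∈ H, h ≠ 1 → ∀ p ∈ P n, (c⁻¹ * h * c) • p ∉ Z n

variable {P Z : ℕ → Set Ω}

lemma IsPingPongTable.exists_common (hT : IsPingPongTable G P Z) (L : List G)
    (hL : ∀ g ∈ L, MovesOff P Z g) (n : ℕ) :
    ∃ m, n ≤ m ∧ ∀ g ∈ L, ∀ x ∈ P m, g • x ∉ Z m := by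
  induction L with
  | nil => exact ⟨n, le_rfl, by simp⟩
  | cons a L ih =>
    obtain ⟨m, hnm, hm⟩ := ih fun g hg => hL g (by simp [hg])
    obtain ⟨k, hk⟩ := hL a (by simp)
    refine ⟨max m k, hnm.trans (le_max_left _ _), ?_⟩
    intro g hg x hx hz
    rcases List.mem_cons.1 hg with rfl | hg
    · exact hk x (hT.antitone_attr (le_max_right _ _) hx) (hT.antitone_rep (le_max_right _ _) hz)
    · exact hm g hg x (hT.antitone_attr (le_max_left _ _) hx)
        (hT.antitone_rep (le_max_left _ _) hz)

lemma IsPingPongTable.exists_generic_top [Nontrivial G] (hT : IsPingPongTable G P Z) (L : List G) :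
    ∃ y : G, ∀ g ∈ L, MovesOff P Z (g⁻¹ * y) ∧ MovesOff P Z (y⁻¹ * g) := by
  obtain ⟨y, -, hy⟩ := hT.exists_generic ⊤ inferInstance top_ne_bot
    (L.map (fun g => (g⁻¹, 1)) ++ L.map (fun g => (1, g)))
  refine ⟨y, fun g hg => ⟨?_, ?_⟩⟩
  · simpa using (hy (g⁻¹, 1) (by simp [hg])).1
  · simpa using (hy (1, g) (by simp [hg])).2

lemma SubgroupMovesOff.exists_sup_zpowers [Nontrivial G] (hT : IsPingPongTable G P Z)
    {H : Subgroup G} {c : G} {n : ℕ} (hH : SubgroupMovesOff P Z H c n) (γ : G) {N : Subgroup G}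
    (hN : N.Normal) (hN1 : N ≠ ⊥) :
    ∃ h c' n', γ⁻¹ * h ∈ N ∧ h ∉ H ∧ SubgroupMovesOff P Z (H ⊔ Subgroup.zpowers h) c' n' := by
  obtain ⟨a₁, ha₁⟩ := hT.exists_generic_top [c]
  obtain ⟨a₂, ha₂⟩ := hT.exists_generic_top [c, a₁]
  obtain ⟨a₃, ha₃⟩ := hT.exists_generic_top [c, a₁, a₂]
  obtain ⟨m, hnm, hm⟩ := hT.exists_common [c⁻¹ * a₁, c⁻¹ * a₂, c⁻¹ * a₃, a₁⁻¹ * c, a₂⁻¹ * c,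
    a₃⁻¹ * c,
    a₁⁻¹ * a₂, a₁⁻¹ * a₃, a₂⁻¹ * a₁, a₂⁻¹ * a₃, a₃⁻¹ * a₁, a₃⁻¹ * a₂] (by
      simp only [List.mem_cons, List.not_mem_nil, or_false, forall_eq_or_imp, forall_eq] at *
      tauto) n
  simp only [List.mem_cons, List.not_mem_nil, or_false, forall_eq_or_imp, forall_eq] at hm
  obtain ⟨b₁, b₂, b₃, d₁, d₂, d₃, e₁₂, e₁₃, e₂₁, e₂₃, e₃₁, e₃₂⟩ := hm
  obtain ⟨t₀, -, ht₀⟩ := hT.exists_contracting ⊤ inferInstance top_ne_bot m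
  set t := c * t₀ * c⁻¹ with ht
  have hH' : SubgroupMovesOff P Z H c m := fun h hh h1 p hp hz =>
    hH h hh h1 p (hT.antitone_attr hnm hp) (hT.antitone_rep hnm hz)
  have attr : ∀ a : G, (∀ x ∈ P m, (c⁻¹ * a) • x ∉ Z m) → ∀ x, (t * a)⁻¹ • x ∈ P m →
      c⁻¹ • x ∈ P m := by
    intro a ha x hx
    have h1 := (ht₀ _ (ha _ hx)).1
    simpa [smul_smul, ht, mul_assoc] using h1
  have rep : ∀ a : G, (∀ x ∈ P m, (a⁻¹ * c) • x ∉ Z m) → ∀ x, (t * a)⁻¹ • x ∈ Z m →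
      c⁻¹ • x ∈ Z m := by
    intro a ha x hx
    by_contra hx'
    have h1 := ha _ (ht₀ _ hx').2
    apply h1
    simpa [smul_smul, ht, mul_assoc] using hx
  have sep : ∀ a a' : G, (∀ x ∈ P m, (a'⁻¹ * a) • x ∉ Z m) → ∀ x, (t * a)⁻¹ • x ∈ P m →
      (t * a')⁻¹ • x ∉ Z m := by
    intro a a' ha x hx hx'
    apply ha _ hx
    simpa [smul_smul, mul_assoc] using hx'
  have P₁ := attr a₁ b₁
  have P₂ := attr a₂ b₂
  have P₃ := attr a₃ b₃
  have Z₁ := rep a₁ d₁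
  have Z₂ := rep a₂ d₂
  have Z₃ := rep a₃ d₃
  have S₁₂ := sep a₁ a₂ e₂₁
  have S₁₃ := sep a₁ a₃ e₃₁
  have S₂₁ := sep a₂ a₁ e₁₂
  have S₂₃ := sep a₂ a₃ e₃₂
  have S₃₁ := sep a₃ a₁ e₁₃
  have S₃₂ := sep a₃ a₂ e₂₃
  generalize t * a₁ = c₁ at *
  generalize t * a₂ = c₂ at *
  generalize t * a₃ = c₃ at *
  clear attr rep sep b₁ b₂ b₃ d₁ d₂ d₃ e₁₂ e₁₃ e₂₁ e₂₃ e₃₁ e₃₂ ha₁ ha₂ ha₃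
  obtain ⟨y, hyN, hy⟩ := hT.exists_generic N hN hN1 [(c₂⁻¹, γ * c₃), (c₃⁻¹ * γ⁻¹, c₂)]
  obtain ⟨m', hmm', hm'⟩ := hT.exists_common [c₂⁻¹ * y * (γ * c₃), c₃⁻¹ * γ⁻¹ * y⁻¹ * c₂] (by
      simp only [List.mem_cons, List.not_mem_nil, or_false, forall_eq_or_imp, forall_eq] at *
      tauto) m
  simp only [List.mem_cons, List.not_mem_nil, or_false, forall_eq_or_imp, forall_eq] at hm'
  obtain ⟨f₁, f₂⟩ := hm'
  obtain ⟨s₀, hs₀N, hs₀⟩ := hT.exists_contracting N hN hN1 m'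
  have hPm := hT.antitone_attr hmm'
  have hZm := hT.antitone_rep hmm'
  obtain ⟨h, hh⟩ : ∃ h, h = (c₂ * s₀ * c₂⁻¹) * y * γ * (c₃ * s₀ * c₃⁻¹) := ⟨_, rfl⟩
  have hmem : γ⁻¹ * h ∈ N := by
    have h1 := hN.conj_mem _ (mul_mem (hN.conj_mem _ hs₀N c₂) hyN) γ⁻¹
    have h2 := mul_mem h1 (hN.conj_mem _ hs₀N c₃)
    simpa [hh, mul_assoc] using h2
  have fwd : ∀ x, c₃⁻¹ • x ∉ Z m → c₂⁻¹ • h • x ∈ P m := by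
    intro x hx
    have h1 := f₁ _ (hs₀ _ (fun hz => hx (hZm hz))).1
    have h2 := hPm (hs₀ _ h1).1
    simpa [smul_smul, hh, mul_assoc] using h2
  have bwd : ∀ x, c₂⁻¹ • x ∉ Z m → c₃⁻¹ • h⁻¹ • x ∈ P m := by
    intro x hx
    have h1 := f₂ _ (hs₀ _ (fun hz => hx (hZm hz))).2
    have h2 := hPm (hs₀ _ h1).2
    simpa [smul_smul, hh, mul_assoc] using h2
  have pow_fwd : ∀ (k : ℕ) x, c₃⁻¹ • x ∉ Z m → c₂⁻¹ • h ^ (k + 1) • x ∈ P m := by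
    intro k
    induction k with
    | zero => simpa using fwd
    | succ k ih =>
      intro x hx
      rw [pow_succ', mul_smul]
      exact fwd _ (S₂₃ _ (ih x hx))
  have pow_bwd : ∀ (k : ℕ) x, c₂⁻¹ • x ∉ Z m → c₃⁻¹ • (h⁻¹) ^ (k + 1) • x ∈ P m := by
    intro k
    induction k with
    | zero => simpa using bwd
    | succ k ih =>
      intro x hx
      rw [pow_succ', mul_smul]
      exact bwd _ (S₃₂ _ (ih x hx))
  have zpow_mem : ∀ g ∈ Subgroup.zpowers h, g ≠ 1 → ∀ x, c₃⁻¹ • x ∉ Z m → c₂⁻¹ • x ∉ Z m →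
      c₂⁻¹ • g • x ∈ P m ∨ c₃⁻¹ • g • x ∈ P m := by
    intro g hg hg1 x hx hx'
    obtain ⟨k, rfl⟩ := Subgroup.mem_zpowers_iff.1 hg
    obtain ⟨k, rfl | rfl⟩ := k.eq_nat_or_neg
    · obtain ⟨k, rfl⟩ := Nat.exists_eq_succ_of_ne_zero (n := k) (by rintro rfl; simp at hg1)
      left
      simpa only [zpow_natCast] using pow_fwd k x hx
    · obtain ⟨k, rfl⟩ := Nat.exists_eq_succ_of_ne_zero (n := k) (by rintro rfl; simp at hg1)
      right
      simpa only [_root_.zpow_neg, zpow_natCast, inv_pow] using pow_bwd k x hx'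
  have hHP : ∀ g ∈ H, g ≠ 1 → ∀ x, c⁻¹ • x ∈ P m → c⁻¹ • g • x ∉ Z m := by
    intro g hg hg1 x hx
    simpa [smul_smul, mul_assoc] using hH' g hg hg1 _ hx
  refine ⟨h, c₁, m, hmem, ?_, ?_⟩
  · intro hhH
    obtain ⟨x, hxP, hxZ⟩ := hT.nonempty_inter m
    have hx1 : c₁⁻¹ • c₁ • x = x := by simp
    have h1 : c₁⁻¹ • c₁ • x ∈ P m := by rwa [hx1]
    have h2 : c₁⁻¹ • c₁ • x ∈ Z m := by rwa [hx1]
    have hne : h ≠ 1 := by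
      rintro rfl
      exact S₂₁ _ (by simpa using fwd _ (S₁₃ _ h1)) h2
    refine hHP h hhH hne _ (P₁ _ h1) (Z₂ _ ?_)
    by_contra h3
    exact S₃₁ _ (by simpa using bwd _ h3) h2
  · intro w hw hw1 p hp hz
    have := smul_mem_of_mem_sup (O := {x | c₁⁻¹ • x ∈ P m}) (U := {x | c⁻¹ • x ∉ Z m})
      (A := {x | c₂⁻¹ • x ∈ P m ∨ c₃⁻¹ • x ∈ P m})
      (fun g hg hg1 x hx => hHP g hg hg1 x (P₁ x hx))
      (fun g hg hg1 x hx => hHP g hg hg1 x (hx.elim (P₂ x) (P₃ x)))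
      (fun g hg hg1 x hx => zpow_mem g hg hg1 x (S₁₃ x hx) (S₁₂ x hx))
      (fun g hg hg1 x hx => zpow_mem g hg hg1 x (fun h => hx (Z₃ x h)) (fun h => hx (Z₂ x h)))
      hw hw1 (x := c₁ • p) (by simpa using hp)
    have hz' : c₁⁻¹ • w • c₁ • p ∈ Z m := by simpa [smul_smul, mul_assoc] using hz
    rcases this with h1 | h1 | h1
    · exact h1 (Z₁ _ hz')
    · exact S₂₁ _ h1 hz'
    · exact S₃₁ _ h1 hz'

/-- A finitely generated group with a ping-pong table is primitive. -/
theorem IsPingPongTable.exists_isCoatom [Nontrivial G] (hT : IsPingPongTable G P Z)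
    (hfg : Group.FG G) : ∃ M : Subgroup G, IsCoatom M ∧ M.normalCore = ⊥ := by
  have : Countable G := by
    obtain ⟨ι, hι, f, hf⟩ := Group.fg_iff_exists_freeGroup_hom_surjective_finite.1 hfg
    have : Countable (FreeGroup ι) := Quot.mk_surjective.countable
    exact hf.countable
  obtain ⟨g₀, hg₀⟩ := exists_ne (1 : G)
  have : Nonempty (G × {g : G // g ≠ 1}) := ⟨(1, ⟨g₀, hg₀⟩)⟩
  obtain ⟨e, he⟩ := exists_surjective_nat (G × {g : G // g ≠ 1})
  let S := {s : Subgroup G × G × ℕ // SubgroupMovesOff P Z s.1 s.2.1 s.2.2}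
  have step : ∀ (q : G × {g : G // g ≠ 1}) (s : S), ∃ s' : S, s.1.1 ≤ s'.1.1 ∧
      (∃ h ∈ s'.1.1, h ∉ s.1.1) ∧ ∃ n ∈ Subgroup.normalClosure {q.2.1}, q.1 * n ∈ s'.1.1 := by
    rintro ⟨γ, g, hg⟩ ⟨⟨H, c, n⟩, hs⟩
    obtain ⟨h, c', n', h1, h2, h3⟩ := hs.exists_sup_zpowers hT γ
      (N := Subgroup.normalClosure {g}) inferInstance (by
        intro hb
        apply hg
        rw [← Subgroup.mem_bot, ← hb]
        exact Subgroup.subset_normalClosure rfl)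
    have hmem : h ∈ H ⊔ Subgroup.zpowers h :=
      (le_sup_right : _ ≤ H ⊔ Subgroup.zpowers h) (Subgroup.mem_zpowers h)
    exact ⟨⟨⟨_, c', n'⟩, h3⟩, le_sup_left, ⟨h, hmem, h2⟩, γ⁻¹ * h, h1, by simpa using hmem⟩
  choose f hf1 hf2 hf3 using step
  let s₀ : S := ⟨(⊥, 1, 0), fun h hh h1 => (h1 (by simpa using hh)).elim⟩
  let s : ℕ → S := fun k => Nat.rec s₀ (fun k s => f (e k) s) k
  have hs : ∀ k, s (k + 1) = f (e k) (s k) := fun k => rfl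
  have hmono : Monotone fun k => (s k).1.1 :=
    monotone_nat_of_le_succ fun k => by rw [hs]; exact hf1 _ _
  refine exists_isCoatom_normalCore_eq_bot hfg (⨆ k, (s k).1.1) ?_ ?_
  · intro htop
    obtain ⟨k, hk⟩ := top_mem_of_sSup_eq_top hfg (Set.range_nonempty _)
      (directedOn_range.2 hmono.directed_le) htop
    obtain ⟨h, -, hh⟩ := hf2 (e k) (s k)
    exact hh (by simp only [hk]; trivial)
  · intro g hg γ
    obtain ⟨k, hk⟩ := he (γ, ⟨g, hg⟩)
    obtain ⟨n, hn, hm⟩ := hf3 (e k) (s k)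
    rw [← hs, hk] at hm
    rw [hk] at hn
    exact ⟨n, hn, (le_iSup (fun k => (s k).1.1) (k + 1)) hm⟩

end PingPong

section Irreducible

open TopologicalSpace Topology

lemma Homeomorph.image_mem_irreducibleComponents {X : Type*} [TopologicalSpace X] (e : X ≃ₜ X)
    {s : Set X} (hs : s ∈ irreducibleComponents X) : e '' s ∈ irreducibleComponents X := by
  refine ⟨hs.1.image e e.continuous.continuousOn, fun t ht hst => ?_⟩
  have h1 := hs.2 (ht.image e.symm e.symm.continuous.continuousOn) (by
    intro x hx
    exact ⟨e x, hst ⟨x, hx, rfl⟩, by simp⟩)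
  intro y hy
  exact ⟨e.symm y, h1 ⟨y, hy, rfl⟩, by simp⟩

/-- In a Noetherian group with continuous left translations there is a finite-index irreducible
subgroup which is invariant under all automorphisms that are homeomorphisms. -/
lemma exists_irreducible_subgroup {G : Type*} [Group G] [TopologicalSpace G] [NoetherianSpace G]
    (hmul : ∀ g : G, Continuous fun x : G => g * x) :
    ∃ H : Subgroup G, H.index ≠ 0 ∧ IsIrreducible (H : Set G) ∧
      ∀ φ : G ≃* G, Continuous φ → Continuous φ.symm → ∀ x ∈ H, φ x ∈ H := by
  let L : G → G ≃ₜ G := fun g =>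
    { toEquiv := Equiv.mulLeft g
      continuous_toFun := hmul g
      continuous_invFun := hmul g⁻¹ }
  have hL : ∀ g x, L g x = g * x := fun _ _ => rfl
  set Z := irreducibleComponent (1 : G) with hZdef
  have hZ : Z ∈ irreducibleComponents G := irreducibleComponent_mem_irreducibleComponents 1
  have h1Z : (1 : G) ∈ Z := mem_irreducibleComponent
  obtain ⟨o, ho, ⟨y, hy⟩, hoZ⟩ :=
    NoetherianSpace.exists_isOpen_nonempty_subset_irreducibleComponent Z hZ
  have huniq_y : ∀ W ∈ irreducibleComponents G, y ∈ W → W = Z := by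
    intro W hW hyW
    have h1 : W ⊆ Z := by
      have h2 := subset_closure_inter_of_isPreirreducible_of_isOpen hW.1.2 ho ⟨y, hyW, hy⟩
      exact h2.trans (closure_minimal (Set.inter_subset_right.trans hoZ)
        (isClosed_of_mem_irreducibleComponents Z hZ))
    exact h1.antisymm (hW.2 hZ.1 h1)
  have huniq : ∀ W ∈ irreducibleComponents G, 1 ∈ W → W = Z := by
    intro W hW h1W
    have e1 := huniq_y _ ((L y).image_mem_irreducibleComponents hW) ⟨1, h1W, by simp [hL]⟩
    have e2 := huniq_y _ ((L y).image_mem_irreducibleComponents hZ) ⟨1, h1Z, by simp [hL]⟩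
    exact (L y).injective.image_injective (e1.trans e2.symm)
  have hinv : ∀ g ∈ Z, L g⁻¹ '' Z = Z := fun g hg =>
    huniq _ ((L g⁻¹).image_mem_irreducibleComponents hZ) ⟨g, hg, by simp [hL]⟩
  have hinv_mem : ∀ g ∈ Z, g⁻¹ ∈ Z := by
    intro g hg
    have : g⁻¹ ∈ L g⁻¹ '' Z := ⟨1, h1Z, by simp [hL]⟩
    rwa [hinv g hg] at this
  let H : Subgroup G :=
    { carrier := Z
      one_mem' := h1Z
      inv_mem' := fun {g} hg => hinv_mem g hg
      mul_mem' := fun {a b} ha hb => by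
        have : a * b ∈ L (a⁻¹)⁻¹ '' Z := ⟨b, hb, by simp [hL]⟩
        rwa [hinv _ (hinv_mem a ha)] at this }
  refine ⟨H, ?_, hZ.1, ?_⟩
  · rw [← Subgroup.finiteIndex_iff, Subgroup.finiteIndex_iff_finite_quotient]
    have hfin : (irreducibleComponents G).Finite := NoetherianSpace.finite_irreducibleComponents
    have : Finite (irreducibleComponents G) := hfin
    let f : G ⧸ H → irreducibleComponents G := fun q =>
      ⟨L q.out '' Z, (L q.out).image_mem_irreducibleComponents hZ⟩
    refine Finite.of_injective f fun p q hpq => ?_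
    have h1 : L p.out '' Z = L q.out '' Z := congrArg Subtype.val hpq
    have h2 : q.out ∈ L p.out '' Z := by
      rw [h1]
      exact ⟨1, h1Z, by simp [hL]⟩
    obtain ⟨z, hz, hzq⟩ := h2
    rw [← p.out_eq', ← q.out_eq', QuotientGroup.eq]
    have : z = (p.out)⁻¹ * q.out := by rw [← hzq, hL]; group
    rw [← this]
    exact hz
  · intro φ hφ hφ' x hx
    let e : G ≃ₜ G :=
      { toEquiv := φ.toEquiv
        continuous_toFun := hφ
        continuous_invFun := hφ' }
    have : e '' Z = Z := huniq _ (e.image_mem_irreducibleComponents hZ) ⟨1, h1Z, map_one φ⟩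
    have h2 : φ x ∈ e '' Z := ⟨x, hx, rfl⟩
    rw [this] at h2
    exact h2

section Zariski

variable {k R G : Type*} [Field k] [Ring R] [Algebra k R] [Group G]
  (ρ : G →* R)

/-- The algebra of regular functions on `G` attached to a representation `ρ` in a
finite-dimensional algebra. -/
def regularFunctions (ρ : G →* R) : Subalgebra k (G → k) :=
  Algebra.adjoin k (Set.range fun (l : Module.Dual k (R × R)) (g : G) => l (ρ g, ρ g⁻¹))

variable (k) in
instance [FiniteDimensional k R] : IsNoetherianRing (regularFunctions (k := k) ρ) := by
  let φ : Module.Dual k (R × R) →ₗ[k] (G → k) :=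
    LinearMap.pi fun g => LinearMap.applyₗ (ρ g, ρ g⁻¹)
  have h1 : (LinearMap.range φ).FG := Module.Finite.iff_fg.1 inferInstance
  obtain ⟨s, hs⟩ := h1
  have h2 : regularFunctions (k := k) ρ = Algebra.adjoin k (s : Set (G → k)) := by
    rw [← Algebra.adjoin_span, hs]
    rfl
  rw [h2]
  have : Algebra.FiniteType k (Algebra.adjoin k (s : Set (G → k))) :=
    Subalgebra.fg_iff_finiteType _ |>.1 ⟨s, rfl⟩
  exact Algebra.FiniteType.isNoetherianRing k _

variable (k) in
/-- The Zariski topology on `G` induced by a representation. -/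
@[reducible] def zariskiTopology : TopologicalSpace G :=
  TopologicalSpace.induced (fun g => (⟨RingHom.ker
    ((Pi.evalRingHom (fun _ : G => k) g).comp (regularFunctions (k := k) ρ).val.toRingHom),
    RingHom.ker_isPrime _⟩ : PrimeSpectrum (regularFunctions (k := k) ρ))) inferInstance

lemma isOpen_zariski (l : Module.Dual k (R × R)) :
    IsOpen[zariskiTopology k ρ] {g : G | l (ρ g, ρ g⁻¹) ≠ 0} := by
  let := zariskiTopology k ρ
  have h := (PrimeSpectrum.isOpen_basicOpen (a := (⟨fun g => l (ρ g, ρ g⁻¹),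
    Algebra.subset_adjoin ⟨l, rfl⟩⟩ : regularFunctions (k := k) ρ)))
  exact isOpen_induced (t := inferInstance) h

lemma noetherianSpace_zariski [FiniteDimensional k R] :
    @NoetherianSpace G (zariskiTopology k ρ) := by
  let := zariskiTopology k ρ
  exact Topology.IsInducing.noetherianSpace (i := fun g => (⟨RingHom.ker
    ((Pi.evalRingHom (fun _ : G => k) g).comp (regularFunctions (k := k) ρ).val.toRingHom),
    RingHom.ker_isPrime _⟩ : PrimeSpectrum (regularFunctions (k := k) ρ))) ⟨rfl⟩

/-- A map transforming coordinates linearly is continuous for the Zariski topologies. -/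
lemma continuous_zariski {G' : Type*} [Group G'] (ρ' : G' →* R) (f : G' → G)
    (hf : ∀ l : Module.Dual k (R × R), ∃ l' : Module.Dual k (R × R),
      ∀ g, l (ρ (f g), ρ (f g)⁻¹) = l' (ρ' g, ρ' g⁻¹)) :
    Continuous[zariskiTopology k ρ', zariskiTopology k ρ] f := by
  let := zariskiTopology k ρ
  let := zariskiTopology k ρ'
  have hmem : ∀ u ∈ regularFunctions (k := k) ρ, u ∘ f ∈ regularFunctions (k := k) ρ' := by
    intro u hu
    induction hu using Algebra.adjoin_induction with
    | mem u hu =>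
      obtain ⟨l, rfl⟩ := hu
      obtain ⟨l', hl'⟩ := hf l
      exact Algebra.subset_adjoin ⟨l', funext fun g => (hl' g).symm⟩
    | algebraMap r => exact Subalgebra.algebraMap_mem _ r
    | add x y _ _ hx hy => exact add_mem hx hy
    | mul x y _ _ hx hy => exact mul_mem hx hy
  let F : regularFunctions (k := k) ρ →+* regularFunctions (k := k) ρ' :=
    { toFun := fun u => ⟨u.1 ∘ f, hmem u.1 u.2⟩
      map_one' := rfl
      map_mul' := fun _ _ => rfl
      map_zero' := rfl
      map_add' := fun _ _ => rfl }
  refine continuous_induced_rng.2 ?_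
  have : Continuous fun g => (⟨RingHom.ker
    ((Pi.evalRingHom (fun _ : G' => k) g).comp (regularFunctions (k := k) ρ').val.toRingHom),
    RingHom.ker_isPrime _⟩ : PrimeSpectrum (regularFunctions (k := k) ρ')) := continuous_induced_dom
  exact (PrimeSpectrum.continuous_comap F).comp this

/-- A normal subgroup `N` with a representation `ρ` on which the ambient group acts linearly by
conjugation has a normal subgroup of finite index on which finitely many nonvanishing conditions on
`ρ` can be satisfied simultaneously as soon as each of them can be satisfied. -/
lemma exists_normal_forall_ne_zero [FiniteDimensional k R] (N : Subgroup G) [N.Normal]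
    (ρ : N →* R) (α : G → R →ₗ[k] R) (hα : ∀ g x, ρ (MulAut.conjNormal g x) = α g (ρ x)) :
    ∃ N₁ ≤ N, N₁.Normal ∧ N₁.relIndex N ≠ 0 ∧ ∀ L : List (R × R →ₗ[k] R),
      (∀ l ∈ L, ∃ a : N, (a : G) ∈ N₁ ∧ l (ρ a, ρ a⁻¹) ≠ 0) →
        ∃ a : N, (a : G) ∈ N₁ ∧ ∀ l ∈ L, l (ρ a, ρ a⁻¹) ≠ 0 := by
  let := zariskiTopology k ρ
  have : NoetherianSpace N := noetherianSpace_zariski ρ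
  obtain ⟨H, hH1, hH2, hH3⟩ := exists_irreducible_subgroup (G := N) (by
    intro g
    refine continuous_zariski ρ ρ _ fun l => ⟨l.comp
      ((LinearMap.mulLeft k (ρ g)).prodMap (LinearMap.mulRight k (ρ g⁻¹))), fun x => ?_⟩
    simp [map_mul])
  have hconj : ∀ g : G, Continuous (MulAut.conjNormal g : N ≃* N) := by
    intro g
    refine continuous_zariski ρ ρ _ fun l => ⟨l.comp ((α g).prodMap (α g)), fun x => ?_⟩
    rw [← map_inv, hα, hα]
    rfl
  refine ⟨H.map N.subtype, Subgroup.map_subtype_le H, ⟨?_⟩, ?_, ?_⟩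
  · rintro _ ⟨x, hx, rfl⟩ g
    refine ⟨MulAut.conjNormal g x, hH3 _ (hconj g) ?_ x hx, by simp⟩
    have : ((MulAut.conjNormal g : N ≃* N)).symm = MulAut.conjNormal g⁻¹ := by
      rw [map_inv]; rfl
    rw [this]
    exact hconj g⁻¹
  · rwa [Subgroup.relIndex, Subgroup.subgroupOf,
      Subgroup.comap_map_eq_self_of_injective N.subtype_injective]
  · have key : ∀ L : List (R × R →ₗ[k] R), (∀ l ∈ L, ∃ a ∈ H, l (ρ a, ρ a⁻¹) ≠ 0) →
        ∃ U : Set N, IsOpen U ∧ ((H : Set N) ∩ U).Nonempty ∧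
          ∀ a ∈ U, ∀ l ∈ L, l (ρ a, ρ a⁻¹) ≠ 0 := by
      intro L
      induction L with
      | nil => exact fun _ => ⟨Set.univ, isOpen_univ, ⟨1, H.one_mem, trivial⟩, by simp⟩
      | cons l L ih =>
        intro h
        obtain ⟨U, hU, hUne, hUL⟩ := ih fun l hl => h l (by simp [hl])
        obtain ⟨a, ha, hal⟩ := h l (by simp)
        obtain ⟨φ, hφ⟩ : ∃ φ : Module.Dual k R, φ (l (ρ a, ρ a⁻¹)) ≠ 0 := by
          by_contra! hcon
          exact hal ((Module.forall_dual_apply_eq_zero_iff k _).1 hcon)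
        refine ⟨U ∩ {a | (φ ∘ₗ l) (ρ a, ρ a⁻¹) ≠ 0}, hU.inter (isOpen_zariski ρ _),
          hH2.2 _ _ hU (isOpen_zariski ρ _) hUne ⟨a, ha, hφ⟩, ?_⟩
        rintro b ⟨hbU, hb⟩ l' hl'
        rcases List.mem_cons.1 hl' with rfl | hl'
        · exact fun h0 => hb (by simp [h0])
        · exact hUL b hbU l' hl'
    intro L h
    obtain ⟨U, -, ⟨a, haH, haU⟩, hUL⟩ := key L fun l hl => by
      obtain ⟨a, ha, hal⟩ := h l hl
      refine ⟨a, ?_, hal⟩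
      simpa using ha
    exact ⟨a, ⟨a, haH, rfl⟩, hUL a haU⟩

end Zariski

end Irreducible

section Rank

variable {k B : Type*} [Field k] [Ring B] [Algebra k B]

/-- The dimension of the right ideal generated by an element. -/
noncomputable def rightRank (k : Type*) {B : Type*} [Field k] [Ring B] [Algebra k B] (x : B) : ℕ :=
  Module.finrank k (LinearMap.range (LinearMap.mulLeft k x))

lemma range_mulLeft_mul_le (x y : B) :
    LinearMap.range (LinearMap.mulLeft k (x * y)) ≤ LinearMap.range (LinearMap.mulLeft k x) := by
  rintro _ ⟨b, rfl⟩
  exact ⟨y * b, by simp⟩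

lemma rightRank_algEquiv (φ : B ≃ₐ[k] B) (x : B) : rightRank k (φ x) = rightRank k x := by
  have : LinearMap.range (LinearMap.mulLeft k (φ x)) =
      (LinearMap.range (LinearMap.mulLeft k x)).map φ.toLinearEquiv.toLinearMap := by
    ext z
    constructor
    · rintro ⟨b, rfl⟩
      exact ⟨x * φ.symm b, ⟨φ.symm b, rfl⟩, by simp⟩
    · rintro ⟨_, ⟨b, rfl⟩, rfl⟩
      exact ⟨φ b, by simp⟩
  rw [rightRank, rightRank, this]
  exact LinearEquiv.finrank_map_eq φ.toLinearEquiv _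

lemma rightRank_eq_finrank {x y : B} (h : x * y = 1) : rightRank k x = Module.finrank k B := by
  have : LinearMap.range (LinearMap.mulLeft k x) = ⊤ := by
    rw [eq_top_iff]
    intro b _
    exact ⟨y * b, by simp [← mul_assoc, h]⟩
  rw [rightRank, this, finrank_top]

variable [FiniteDimensional k B]

lemma rightRank_mul_le_left (x y : B) : rightRank k (x * y) ≤ rightRank k x :=
  Submodule.finrank_mono (range_mulLeft_mul_le x y)

lemma rightRank_mul_le_right (x y : B) : rightRank k (x * y) ≤ rightRank k y := by
  rw [rightRank, LinearMap.mulLeft_mul, LinearMap.range_comp]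
  exact Submodule.finrank_map_le _ _

lemma mul_mul_eq_zero_of_rightRank_eq {x y : B} (h : rightRank k (x * y) = rightRank k y) {b : B}
    (hb : x * y * b = 0) : y * b = 0 := by
  set W := LinearMap.range (LinearMap.mulLeft k y) with hW
  have h1 : Module.finrank k (LinearMap.range ((LinearMap.mulLeft k x).domRestrict W)) =
      Module.finrank k W := by
    rw [LinearMap.range_domRestrict]
    rw [rightRank, LinearMap.mulLeft_mul, LinearMap.range_comp, ← hW] at h
    exact h
  have h2 := LinearMap.finrank_range_add_finrank_ker ((LinearMap.mulLeft k x).domRestrict W)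
  rw [h1] at h2
  have h3 : LinearMap.ker ((LinearMap.mulLeft k x).domRestrict W) = ⊥ := by
    rw [← Submodule.finrank_eq_zero (R := k)]
    omega
  have h4 : (⟨y * b, b, rfl⟩ : W) ∈ LinearMap.ker ((LinearMap.mulLeft k x).domRestrict W) := by
    simpa [mul_assoc] using hb
  rw [h3] at h4
  simpa using congrArg Subtype.val (show (⟨y * b, b, rfl⟩ : W) = 0 by simpa using h4)

lemma mul_eq_zero_of_rightRank_eq {x y : B} (h : rightRank k (x * y) = rightRank k x) {b : B}
    (hb : b * (x * y) = 0) : b * x = 0 := by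
  have h1 := Submodule.eq_of_le_of_finrank_eq (range_mulLeft_mul_le (k := k) x y) h
  have h2 : x ∈ LinearMap.range (LinearMap.mulLeft k (x * y)) := by
    rw [h1]
    exact ⟨1, by simp⟩
  obtain ⟨c, hc⟩ := h2
  rw [← hc]
  simp only [LinearMap.mulLeft_apply]
  rw [← mul_assoc, hb, zero_mul]

lemma rightRank_le_finrank (x : B) : rightRank k x ≤ Module.finrank k B :=
  Submodule.finrank_le _

lemma rightRank_lt_finrank {x y : B} (h : x * y = 0) (hy : y ≠ 0) :
    rightRank k x < Module.finrank k B := by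
  have h2 := LinearMap.finrank_range_add_finrank_ker (LinearMap.mulLeft k x)
  have h3 : Module.finrank k (LinearMap.ker (LinearMap.mulLeft k x)) ≠ 0 := by
    rw [Ne, Submodule.finrank_eq_zero]
    intro h4
    have : y ∈ LinearMap.ker (LinearMap.mulLeft k x) := by simpa using h
    rw [h4] at this
    exact hy (by simpa using this)
  rw [rightRank]
  omega

end Rank

/-- A decomposition of `1` into central orthogonal prime idempotents permuted by `Γ`. -/
structure IsPrimeDecomposition (Γ : Type*) {B : Type*} [Group Γ] [Ring B] [MulSemiringAction Γ B]
    (J : Finset B) : Prop where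
  idem : ∀ e ∈ J, e * e = e
  ne_zero : ∀ e ∈ J, e ≠ 0
  comm : ∀ e ∈ J, ∀ b, e * b = b * e
  orth : ∀ e ∈ J, ∀ f ∈ J, e ≠ f → e * f = 0
  sum_eq : ∑ e ∈ J, e = 1
  smul_mem : ∀ (γ : Γ), ∀ e ∈ J, γ • e ∈ J
  prime : ∀ e ∈ J, ∀ x y, e * x ≠ 0 → e * y ≠ 0 → ∃ b, e * (x * b * y) ≠ 0

/-- `ρ` represents the normal subgroup `N₀` in `B`, compatibly with an action of the ambient group
on `B`, and every nontrivial normal subgroup contained in `N₀` spans `B`. -/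
structure IsConjRep (k : Type*) {Γ B : Type*} [Group Γ] [Field k] [Ring B] [Algebra k B]
    [MulSemiringAction Γ B] (N₀ : Subgroup Γ) (ρ : Γ → B) : Prop where
  normal : N₀.Normal
  ne_bot : N₀ ≠ ⊥
  map_one : ρ 1 = 1
  map_mul : ∀ a ∈ N₀, ∀ b ∈ N₀, ρ (a * b) = ρ a * ρ b
  smul_map : ∀ γ, ∀ a ∈ N₀, γ • ρ a = ρ (γ * a * γ⁻¹)
  smul_eq : ∀ a ∈ N₀, ∀ b, a • b = ρ a * b * ρ a⁻¹
  span_eq : ∀ N ≤ N₀, N.Normal → N ≠ ⊥ → Submodule.span k (ρ '' N) = ⊤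

section

variable {k Γ B : Type*} [Group Γ] [Field k] [Ring B] [Algebra k B] [MulSemiringAction Γ B]
  {N₀ : Subgroup Γ} {ρ : Γ → B} {J : Finset B}

namespace IsPrimeDecomposition

lemma exists_mul_eq_smul (hJ : IsPrimeDecomposition Γ J) {c : B}
    (hc : c ∈ Submodule.span k (J : Set B)) {e : B} (he : e ∈ J) : ∃ s : k, e * c = s • e := by
  induction hc using Submodule.span_induction with
  | mem x hx =>
    by_cases h : e = x
    · exact ⟨1, by rw [← h, hJ.idem e he, one_smul]⟩
    · exact ⟨0, by rw [hJ.orth e he x hx h, zero_smul]⟩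
  | zero => exact ⟨0, by simp⟩
  | add x y _ _ hx hy =>
    obtain ⟨s, hs⟩ := hx
    obtain ⟨t, ht⟩ := hy
    exact ⟨s + t, by rw [mul_add, hs, ht, add_smul]⟩
  | smul a x _ hx =>
    obtain ⟨s, hs⟩ := hx
    exact ⟨a * s, by rw [mul_smul_comm, hs, smul_smul]⟩

lemma comm_of_mem_span (hJ : IsPrimeDecomposition Γ J) {c : B}
    (hc : c ∈ Submodule.span k (J : Set B)) (b : B) : c * b = b * c := by
  induction hc using Submodule.span_induction with
  | mem x hx => exact hJ.comm x hx b
  | zero => simp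
  | add x y _ _ hx hy => rw [add_mul, mul_add, hx, hy]
  | smul a x _ hx => rw [smul_mul_assoc, mul_smul_comm, hx]

lemma mul_mem_span (hJ : IsPrimeDecomposition Γ J) {c d : B}
    (hc : c ∈ Submodule.span k (J : Set B)) (hd : d ∈ Submodule.span k (J : Set B)) :
    c * d ∈ Submodule.span k (J : Set B) := by
  induction hc using Submodule.span_induction with
  | mem x hx =>
    obtain ⟨s, hs⟩ := hJ.exists_mul_eq_smul hd hx
    rw [hs]
    exact Submodule.smul_mem _ _ (Submodule.subset_span hx)
  | zero => simp
  | add x y _ _ hx hy => rw [add_mul]; exact add_mem hx hy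
  | smul a x _ hx => rw [smul_mul_assoc]; exact Submodule.smul_mem _ _ hx

lemma smul_mem_span [SMulCommClass Γ k B] (hJ : IsPrimeDecomposition Γ J) (γ : Γ) {c : B}
    (hc : c ∈ Submodule.span k (J : Set B)) : γ • c ∈ Submodule.span k (J : Set B) := by
  induction hc using Submodule.span_induction with
  | mem x hx => exact Submodule.subset_span (hJ.smul_mem γ x hx)
  | zero => simp
  | add x y _ _ hx hy => rw [smul_add]; exact add_mem hx hy
  | smul a x _ hx => rw [smul_comm]; exact Submodule.smul_mem _ _ hx

lemma sum_mul (hJ : IsPrimeDecomposition Γ J) (b : B) : ∑ e ∈ J, e * b = b := by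
  rw [← Finset.sum_mul, hJ.sum_eq, one_mul]

lemma smul_mul_ne_zero (hJ : IsPrimeDecomposition Γ J) {x : B} (hx : ∀ e ∈ J, e * x ≠ 0) (γ : Γ) :
    ∀ e ∈ J, e * γ • x ≠ 0 := by
  intro e he h
  apply hx _ (hJ.smul_mem γ⁻¹ e he)
  have := congrArg (fun z => γ⁻¹ • z) h
  simpa [smul_mul'] using this

/-- An element of the span of `J` annihilated by no element of `J` is invertible. -/
lemma exists_mul_eq_one (hJ : IsPrimeDecomposition Γ J) {c : B}
    (hc : c ∈ Submodule.span k (J : Set B)) (h : ∀ e ∈ J, e * c ≠ 0) : ∃ d, c * d = 1 := by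
  have : ∀ e ∈ J, ∃ d, c * d = e := by
    intro e he
    obtain ⟨s, hs⟩ := hJ.exists_mul_eq_smul hc he
    have hs0 : s ≠ 0 := by
      rintro rfl
      exact h e he (by simpa using hs)
    exact ⟨s⁻¹ • e, by rw [mul_smul_comm, ← hJ.comm e he, hs, smul_smul, inv_mul_cancel₀ hs0,
      one_smul]⟩
  choose! f hf using this
  exact ⟨∑ e ∈ J, f e, by rw [Finset.mul_sum, Finset.sum_congr rfl hf, hJ.sum_eq]⟩

end IsPrimeDecomposition

namespace IsConjRep

lemma map_inv_mul (h : IsConjRep k N₀ ρ) {a : Γ} (ha : a ∈ N₀) : ρ a⁻¹ * ρ a = 1 := by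
  rw [← h.map_mul _ (inv_mem ha) _ ha, inv_mul_cancel, h.map_one]

lemma map_mul_inv (h : IsConjRep k N₀ ρ) {a : Γ} (ha : a ∈ N₀) : ρ a * ρ a⁻¹ = 1 := by
  rw [← h.map_mul _ ha _ (inv_mem ha), mul_inv_cancel, h.map_one]

/-- The action of a group element as an algebra automorphism. -/
def actionEquiv (k : Type*) {Γ B : Type*} [Group Γ] [Field k] [Ring B] [Algebra k B]
    [MulSemiringAction Γ B] [SMulCommClass Γ k B] (γ : Γ) : B ≃ₐ[k] B :=
  MulSemiringAction.toAlgEquiv k B γ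

lemma exists_ne_zero (h : IsConjRep k N₀ ρ) (hJ : IsPrimeDecomposition Γ J) {N : Subgroup Γ}
    (hN : N ≤ N₀) (hN' : N.Normal) (hN1 : N ≠ ⊥) {e x y : B} (he : e ∈ J) (hx : e * x ≠ 0)
    (hy : e * y ≠ 0) : ∃ a ∈ N, e * (x * ρ a * y) ≠ 0 := by
  by_contra! hcon
  obtain ⟨b, hb⟩ := hJ.prime e he x y hx hy
  have hmem : b ∈ Submodule.span k (ρ '' N) := by rw [h.span_eq N hN hN' hN1]; trivial
  apply hb
  clear hb
  induction hmem using Submodule.span_induction with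
  | mem x hx => obtain ⟨a, ha, rfl⟩ := hx; exact hcon a ha
  | zero => simp
  | add x y _ _ hx hy => rw [mul_add, add_mul, mul_add, hx, hy, add_zero]
  | smul a x _ hx => rw [mul_smul_comm, smul_mul_assoc, mul_smul_comm, hx, smul_zero]

/-- Simultaneous nonvanishing on a nontrivial normal subgroup. -/
lemma exists_forall_ne_zero [FiniteDimensional k B] [SMulCommClass Γ k B] (hM : IsMIF Γ)
    (h : IsConjRep k N₀ ρ) (hJ : IsPrimeDecomposition Γ J) {N : Subgroup Γ}
    (hN : N.Normal) (hN1 : N ≠ ⊥) (L : List (B × B))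
    (hL : ∀ p ∈ L, ∀ e ∈ J, e * p.1 ≠ 0 ∧ e * p.2 ≠ 0) :
    ∃ a ∈ N, a ∈ N₀ ∧ ∀ p ∈ L, ∀ e ∈ J,
      e * (p.1 * ρ a * p.2) ≠ 0 ∧ e * (p.1 * ρ a⁻¹ * p.2) ≠ 0 := by
  have := h.normal
  have hK : N ⊓ N₀ ≠ ⊥ := hM.inf_ne_bot hN1 h.ne_bot
  let ρ' : ↥(N ⊓ N₀) →* B :=
    { toFun := fun a => ρ a
      map_one' := h.map_one
      map_mul' := fun a b => h.map_mul _ a.2.2 _ b.2.2 }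
  obtain ⟨N₁, hN₁, hN₁n, hidx, hN₁'⟩ := exists_normal_forall_ne_zero (k := k) (N ⊓ N₀) ρ'
    (fun g => (actionEquiv k g : B ≃ₐ[k] B).toLinearMap) (by
      intro g x
      exact (h.smul_map g x x.2.2).symm)
  have hN₁1 : N₁ ≠ ⊥ := by
    rintro rfl
    have := hM.infinite_of_ne_bot hK
    rw [Subgroup.relIndex_bot_left] at hidx
    exact hidx Nat.card_eq_zero_of_infinite

  let φ : Bool → B × B × B → (B × B →ₗ[k] B) := fun i q =>
    LinearMap.mulLeft k q.1 ∘ₗ LinearMap.mulRight k q.2.2 ∘ₗ LinearMap.mulLeft k q.2.1 ∘ₗ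
      (if i then LinearMap.fst k B B else LinearMap.snd k B B)
  let T : List (B × B × B) := L.flatMap fun p => J.toList.map fun e => (e, p)
  obtain ⟨a, haN, ha⟩ := hN₁' (T.map (φ true) ++ T.map (φ false)) (by
    intro l hl
    have hT : ∃ i, ∃ p ∈ L, ∃ e ∈ J, l = φ i (e, p) := by
      simp only [List.mem_append, List.mem_map, T, List.mem_flatMap, Finset.mem_toList] at hl
      rcases hl with ⟨_, ⟨p, hp, e, he, rfl⟩, rfl⟩ | ⟨_, ⟨p, hp, e, he, rfl⟩, rfl⟩
      · exact ⟨_, p, hp, e, he, rfl⟩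
      · exact ⟨_, p, hp, e, he, rfl⟩
    obtain ⟨i, p, hp, e, he, rfl⟩ := hT
    obtain ⟨a, haN, ha⟩ := h.exists_ne_zero hJ (hN₁.trans inf_le_right) hN₁n hN₁1 he
      (hL p hp e he).1 (hL p hp e he).2
    cases i
    · refine ⟨⟨a⁻¹, inv_mem (hN₁ haN)⟩, inv_mem haN, ?_⟩
      simpa [φ, ρ', mul_assoc] using ha
    · refine ⟨⟨a, hN₁ haN⟩, haN, ?_⟩
      simpa [φ, ρ', mul_assoc] using ha)
  refine ⟨a, a.2.1, a.2.2, fun p hp e he => ?_⟩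
  have hT : (e, p) ∈ T := by
    simp only [T, List.mem_flatMap, List.mem_map, Finset.mem_toList]
    exact ⟨p, hp, e, he, rfl⟩
  constructor
  · have := ha _ (List.mem_append_left _ (List.mem_map_of_mem (f := φ true) hT))
    simpa [φ, ρ', mul_assoc] using this
  · have := ha _ (List.mem_append_right _ (List.mem_map_of_mem (f := φ false) hT))
    simpa [φ, ρ', mul_assoc] using this

end IsConjRep

end

lemma IsPrimeDecomposition.mul_mul_mul_self {Γ B : Type*} [Group Γ] [Ring B]
    [MulSemiringAction Γ B] {J : Finset B} (hJ : IsPrimeDecomposition Γ J) {e : B} (he : e ∈ J)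
    (x y : B) : e * x * (e * y) = e * (x * y) := by
  rw [hJ.comm e he x, mul_assoc, ← mul_assoc e e, hJ.idem e he, ← mul_assoc, ← hJ.comm e he x,
    mul_assoc]

section LimitPairs

open Filter Topology

variable {k Γ B : Type*} [Group Γ] [NontriviallyNormedField k] [ProperSpace k] [NormedRing B]
  [NormedAlgebra k B] [FiniteDimensional k B] [MulSemiringAction Γ B] [SMulCommClass Γ k B]
  {N₀ : Subgroup Γ} {ρ : Γ → B} {J : Finset B}

/-- Pairs consisting of a rescaled group element and a rescaled inverse. -/
def scaledPairs (k : Type*) {Γ B : Type*} [Group Γ] [Field k] [Ring B] [Algebra k B]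
    (N₀ : Subgroup Γ) (ρ : Γ → B) (J : Finset B) : Set (B × B) :=
  {p | ∃ g ∈ N₀, ∃ c ∈ Submodule.span k (J : Set B), ∃ d ∈ Submodule.span k (J : Set B),
    p = (c * ρ g, d * ρ g⁻¹)}

/-- Limits of rescaled pairs none of whose components vanish. -/
def limitPairs (k : Type*) {Γ B : Type*} [Group Γ] [Field k] [Ring B] [Algebra k B]
    [TopologicalSpace B] (N₀ : Subgroup Γ) (ρ : Γ → B) (J : Finset B) : Set (B × B) :=
  {p | p ∈ closure (scaledPairs k N₀ ρ J) ∧ ∀ e ∈ J, e * p.1 ≠ 0 ∧ e * p.2 ≠ 0}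

lemma limitPairs_swap {p : B × B} (hp : p ∈ limitPairs k N₀ ρ J) :
    p.swap ∈ limitPairs k N₀ ρ J := by
  refine ⟨map_mem_closure continuous_swap hp.1 ?_, fun e he => ⟨(hp.2 e he).2, (hp.2 e he).1⟩⟩
  rintro _ ⟨g, hg, c, hc, d, hd, rfl⟩
  exact ⟨g⁻¹, inv_mem hg, d, hd, c, hc, by simp⟩

lemma limitPairs_smul (h : IsConjRep k N₀ ρ) (hJ : IsPrimeDecomposition Γ J) {p : B × B}
    (hp : p ∈ limitPairs k N₀ ρ J) (γ : Γ) : (γ • p.1, γ • p.2) ∈ limitPairs k N₀ ρ J := by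
  have hc : Continuous fun b : B => γ • b :=
    (IsConjRep.actionEquiv k γ : B ≃ₐ[k] B).toLinearMap.continuous_of_finiteDimensional
  refine ⟨map_mem_closure (f := fun p : B × B => (γ • p.1, γ • p.2))
      ((hc.comp continuous_fst).prodMk (hc.comp continuous_snd)) hp.1 ?_,
    fun e he => ⟨hJ.smul_mul_ne_zero (fun e he => (hp.2 e he).1) γ e he,
      hJ.smul_mul_ne_zero (fun e he => (hp.2 e he).2) γ e he⟩⟩
  rintro _ ⟨g, hg, c, hc, d, hd, rfl⟩
  refine ⟨γ * g * γ⁻¹, h.normal.conj_mem g hg γ, γ • c, hJ.smul_mem_span γ hc, γ • d,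
    hJ.smul_mem_span γ hd, ?_⟩
  simp [smul_mul', h.smul_map γ g hg, h.smul_map γ _ (inv_mem hg), mul_assoc]

lemma limitPairs_mul (h : IsConjRep k N₀ ρ) (hJ : IsPrimeDecomposition Γ J) {p q : B × B}
    (hp : p ∈ limitPairs k N₀ ρ J) (hq : q ∈ limitPairs k N₀ ρ J) {a : Γ} (ha : a ∈ N₀)
    (hne : ∀ e ∈ J, e * (p.1 * ρ a * q.1) ≠ 0 ∧ e * (q.2 * ρ a⁻¹ * p.2) ≠ 0) :
    (p.1 * ρ a * q.1, q.2 * ρ a⁻¹ * p.2) ∈ limitPairs k N₀ ρ J := by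
  refine ⟨map_mem_closure₂ (f := fun p q : B × B => (p.1 * ρ a * q.1, q.2 * ρ a⁻¹ * p.2))
    (by fun_prop) hp.1 hq.1 ?_, hne⟩
  rintro _ ⟨g, hg, c, hc, d, hd, rfl⟩ _ ⟨g', hg', c', hc', d', hd', rfl⟩
  refine ⟨g * a * g', mul_mem (mul_mem hg ha) hg', c * c', hJ.mul_mem_span hc hc', d * d',
    hJ.mul_mem_span hd hd', ?_⟩
  have e1 : ρ (g * a * g') = ρ g * ρ a * ρ g' := by
    rw [h.map_mul _ (mul_mem hg ha) _ hg', h.map_mul _ hg _ ha]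
  have e2 : ρ (g * a * g')⁻¹ = ρ g'⁻¹ * ρ a⁻¹ * ρ g⁻¹ := by
    rw [_root_.mul_inv_rev, _root_.mul_inv_rev,
      h.map_mul _ (inv_mem hg') _ (mul_mem (inv_mem ha) (inv_mem hg)),
      h.map_mul _ (inv_mem ha) _ (inv_mem hg), mul_assoc]
  have c1 : ∀ u v, u * (c' * v) = c' * (u * v) := fun u v => by
    rw [← mul_assoc, ← hJ.comm_of_mem_span hc', mul_assoc]
  have c2 : ∀ u v, u * (d * v) = d * (u * v) := fun u v => by
    rw [← mul_assoc, ← hJ.comm_of_mem_span hd, mul_assoc]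
  rw [e1, e2]
  refine Prod.ext ?_ ?_
  · simp only [mul_assoc]
    rw [c1 (ρ a), c1 (ρ g)]
  · simp only [mul_assoc]
    rw [c2 (ρ a⁻¹), c2 (ρ g'⁻¹), c2 d']

lemma limitPairs_mul_mem_span (h : IsConjRep k N₀ ρ) (hJ : IsPrimeDecomposition Γ J) {p : B × B}
    (hp : p ∈ limitPairs k N₀ ρ J) :
    p.1 * p.2 ∈ Submodule.span k (J : Set B) ∧ p.2 * p.1 = p.1 * p.2 := by
  have hcl : IsClosed {p : B × B | p.1 * p.2 ∈ Submodule.span k (J : Set B) ∧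
      p.2 * p.1 = p.1 * p.2} := by
    refine IsClosed.inter ?_ (isClosed_eq (by fun_prop) (by fun_prop))
    exact (Submodule.closed_of_finiteDimensional (Submodule.span k (J : Set B))).preimage
      (continuous_fst.mul continuous_snd)
  refine hcl.closure_subset_iff.2 ?_ hp.1
  rintro _ ⟨g, hg, c, hc, d, hd, rfl⟩
  have e1 : c * ρ g * (d * ρ g⁻¹) = c * d := by
    rw [hJ.comm_of_mem_span hd, mul_assoc, ← mul_assoc (ρ g), h.map_mul_inv hg, one_mul]
  have e2 : d * ρ g⁻¹ * (c * ρ g) = c * d := by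
    rw [hJ.comm_of_mem_span hc, mul_assoc, ← mul_assoc (ρ _), h.map_inv_mul hg, one_mul,
      hJ.comm_of_mem_span hc]
  exact ⟨by simpa only [e1] using hJ.mul_mem_span hc hd, e2.trans e1.symm⟩

/-- If the projective images of the powers of some element are unbounded, some limit pair is
degenerate. -/
lemma exists_limitPair_mul_eq_zero (h : IsConjRep k N₀ ρ) (hJ : IsPrimeDecomposition Γ J)
    {e₀ : B} (he₀ : e₀ ∈ J) (hunb : ∀ C : ℝ, ∃ g ∈ N₀, C < ‖e₀ * ρ g‖ * ‖e₀ * ρ g⁻¹‖) :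
    ∃ p ∈ limitPairs k N₀ ρ J, e₀ * p.1 * p.2 = 0 := by
  obtain ⟨c₀, hc₀⟩ := NormedField.exists_one_lt_norm k
  have hproper : ProperSpace B := FiniteDimensional.proper k B
  set S : Set (B × B) := {p | p ∈ closure (scaledPairs k N₀ ρ J) ∧ ∀ e ∈ J,
    (1 / ‖c₀‖ ≤ ‖e * p.1‖ ∧ ‖e * p.1‖ ≤ 1) ∧ (1 / ‖c₀‖ ≤ ‖e * p.2‖ ∧ ‖e * p.2‖ ≤ 1)} with hS
  have hScl : IsClosed S := by
    refine isClosed_closure.inter ?_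
    have : {p : B × B | ∀ e ∈ J, (1 / ‖c₀‖ ≤ ‖e * p.1‖ ∧ ‖e * p.1‖ ≤ 1) ∧
        (1 / ‖c₀‖ ≤ ‖e * p.2‖ ∧ ‖e * p.2‖ ≤ 1)} = ⋂ e ∈ J, {p : B × B |
        (1 / ‖c₀‖ ≤ ‖e * p.1‖ ∧ ‖e * p.1‖ ≤ 1) ∧ (1 / ‖c₀‖ ≤ ‖e * p.2‖ ∧ ‖e * p.2‖ ≤ 1)} := by
      ext
      simp only [Set.mem_iInter, Set.mem_ofPred_eq]
    change IsClosed {p : B × B | ∀ e ∈ J, (1 / ‖c₀‖ ≤ ‖e * p.1‖ ∧ ‖e * p.1‖ ≤ 1) ∧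
        (1 / ‖c₀‖ ≤ ‖e * p.2‖ ∧ ‖e * p.2‖ ≤ 1)}
    rw [this]
    refine isClosed_biInter fun e he => ?_
    have h1 : Continuous fun p : B × B => ‖e * p.1‖ := by fun_prop
    have h2 : Continuous fun p : B × B => ‖e * p.2‖ := by fun_prop
    exact ((isClosed_le continuous_const h1).inter (isClosed_le h1 continuous_const)).inter
      ((isClosed_le continuous_const h2).inter (isClosed_le h2 continuous_const))
  have hbd : ∀ b : B, (∀ e ∈ J, ‖e * b‖ ≤ 1) → ‖b‖ ≤ J.card := by
    intro b hb
    rw [← hJ.sum_mul b]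
    calc ‖∑ e ∈ J, e * b‖ ≤ ∑ e ∈ J, (1 : ℝ) := norm_sum_le_of_le _ hb
      _ = J.card := by simp
  have hScomp : IsCompact S := by
    refine Metric.isCompact_of_isClosed_isBounded hScl ?_
    refine (Metric.isBounded_closedBall (x := (0 : B × B)) (r := J.card)).subset ?_
    intro p hp
    rw [mem_closedBall_zero_iff, Prod.norm_def]
    exact max_le (hbd _ fun e he => (hp.2 e he).1.2) (hbd _ fun e he => (hp.2 e he).2.2)
  have hshell : ∀ b : B, (∀ e ∈ J, e * b ≠ 0) → ∃ s : B → k, ∀ e ∈ J, s e ≠ 0 ∧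
      1 / ‖c₀‖ ≤ ‖s e • (e * b)‖ ∧ ‖s e • (e * b)‖ ≤ 1 := by
    intro b hb
    have : ∀ e ∈ J, ∃ s : k, s ≠ 0 ∧
      1 / ‖c₀‖ ≤ ‖s • (e * b)‖ ∧ ‖s • (e * b)‖ ≤ 1 := by
      intro e he
      obtain ⟨s, hs, h1, h2, -⟩ := rescale_to_shell hc₀ one_pos (hb e he)
      exact ⟨s, hs, h2, h1.le⟩
    choose! s hs using this
    exact ⟨s, hs⟩
  have hmulsum : ∀ (s : B → k) (b : B), ∀ e ∈ J, e * ((∑ f ∈ J, s f • f) * b) = s e • (e * b) := by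
    intro s b e he
    rw [← mul_assoc, Finset.mul_sum, Finset.sum_eq_single e]
    · rw [mul_smul_comm, hJ.idem e he, smul_mul_assoc]
    · intro f hf hfe
      rw [mul_smul_comm, hJ.orth e he f hf hfe.symm, smul_zero]
    · exact fun h => (h he).elim
  have hspan : ∀ s : B → k, ∑ f ∈ J, s f • f ∈ Submodule.span k (J : Set B) := fun s =>
    Submodule.sum_mem _ fun f hf => Submodule.smul_mem _ _ (Submodule.subset_span hf)
  have hne : ∀ g ∈ N₀, ∀ e ∈ J, e * ρ g ≠ 0 := by
    intro g hg e he h0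
    apply hJ.ne_zero e he
    rw [← mul_one e, ← h.map_mul_inv hg, ← mul_assoc, h0, zero_mul]
  have hsmall : ∀ δ > 0, ∃ p ∈ S, ‖e₀ * p.1 * p.2‖ < δ := by
    intro δ hδ
    obtain ⟨g, hg, hC⟩ := hunb (‖e₀‖ / δ)
    obtain ⟨s, hs⟩ := hshell _ (hne g hg)
    obtain ⟨t, ht⟩ := hshell _ (hne g⁻¹ (inv_mem hg))
    refine ⟨((∑ f ∈ J, s f • f) * ρ g, (∑ f ∈ J, t f • f) * ρ g⁻¹),
      ⟨subset_closure ⟨g, hg, _, hspan s, _, hspan t, rfl⟩, fun e he => ?_⟩, ?_⟩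
    · simp only [hmulsum _ _ e he]
      exact ⟨(hs e he).2, (ht e he).2⟩
    · have e1 : e₀ * ((∑ f ∈ J, s f • f) * ρ g) * ((∑ f ∈ J, t f • f) * ρ g⁻¹) =
          (s e₀ * t e₀) • e₀ := by
        rw [mul_assoc, ← hJ.mul_mul_mul_self he₀, hmulsum _ _ e₀ he₀, hmulsum _ _ e₀ he₀,
          smul_mul_smul_comm, hJ.mul_mul_mul_self he₀, h.map_mul_inv hg, mul_one]
      have h1 := (hs e₀ he₀).2.2
      have h2 := (ht e₀ he₀).2.2
      have h3 : 0 < ‖s e₀‖ * ‖t e₀‖ := by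
        have := (hs e₀ he₀).1
        have := (ht e₀ he₀).1
        positivity
      simp only at *
      rw [e1, norm_smul, norm_mul]
      rw [norm_smul] at h1 h2
      have h4 : (‖s e₀‖ * ‖t e₀‖) * (‖e₀ * ρ g‖ * ‖e₀ * ρ g⁻¹‖) ≤ 1 := by
        calc _ = (‖s e₀‖ * ‖e₀ * ρ g‖) * (‖t e₀‖ * ‖e₀ * ρ g⁻¹‖) := by ring
          _ ≤ 1 * 1 := by gcongr
          _ = 1 := one_mul 1
      rw [div_lt_iff₀ hδ] at hC
      nlinarith
  have hSne : S.Nonempty := by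
    obtain ⟨p, hp, -⟩ := hsmall 1 one_pos
    exact ⟨p, hp⟩
  obtain ⟨p, hp, hmin⟩ := hScomp.exists_isMinOn (f := fun p : B × B => ‖e₀ * p.1 * p.2‖) hSne
    (by fun_prop)
  refine ⟨p, ⟨hp.1, fun e he => ?_⟩, ?_⟩
  · have hpos : 0 < 1 / ‖c₀‖ := by positivity
    exact ⟨norm_pos_iff.1 (hpos.trans_le (hp.2 e he).1.1),
      norm_pos_iff.1 (hpos.trans_le (hp.2 e he).2.1)⟩
  · by_contra h0
    obtain ⟨q, hq, hlt⟩ := hsmall _ (norm_pos_iff.2 h0)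
    exact absurd (hmin hq) (not_le.2 hlt)

end LimitPairs

lemma LinearMap.exists_pos_mul_norm_le {k E F : Type*} [NontriviallyNormedField k]
    [CompleteSpace k] [NormedAddCommGroup E] [NormedSpace k E] [FiniteDimensional k E]
    [NormedAddCommGroup F] [NormedSpace k F] (f : E →ₗ[k] F) (W : Submodule k E)
    (hf : ∀ w ∈ W, f w = 0 → w = 0) : ∃ c > 0, ∀ w ∈ W, c * ‖w‖ ≤ ‖f w‖ := by
  obtain ⟨K, hK, h⟩ := LinearMap.exists_antilipschitzWith (f.domRestrict W) (by
    rw [LinearMap.ker_eq_bot']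
    intro w hw
    exact Subtype.ext (hf w w.2 hw))
  refine ⟨(K : ℝ)⁻¹, by positivity, fun w hw => ?_⟩
  have := h.le_mul_dist ⟨w, hw⟩ 0
  simp only [dist_zero_right, map_zero, LinearMap.domRestrict_apply] at this
  have h2 : ‖w‖ ≤ K * ‖f w‖ := this
  have hK' : (0 : ℝ) < K := hK
  rw [inv_mul_le_iff₀ hK']
  exact h2

/-- Limit pairs of minimal total rank. -/
structure IsMinimalPair (k : Type*) {Γ B : Type*} [Group Γ] [Field k] [Ring B] [Algebra k B]
    [TopologicalSpace B] (N₀ : Subgroup Γ) (ρ : Γ → B) (J : Finset B) (p : B × B) : Prop where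
  mem : p ∈ limitPairs k N₀ ρ J
  le : ∀ q ∈ limitPairs k N₀ ρ J,
    rightRank k p.1 + rightRank k p.2 ≤ rightRank k q.1 + rightRank k q.2

namespace IsMinimalPair

open Filter Topology

variable {k Γ B : Type*} [Group Γ] [NontriviallyNormedField k] [ProperSpace k] [NormedRing B]
  [NormedAlgebra k B] [FiniteDimensional k B] [MulSemiringAction Γ B] [SMulCommClass Γ k B]
  {N₀ : Subgroup Γ} {ρ : Γ → B} {J : Finset B} {p q : B × B}

lemma swap (hp : IsMinimalPair k N₀ ρ J p) : IsMinimalPair k N₀ ρ J p.swap :=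
  ⟨limitPairs_swap hp.mem, fun q hq => by
    rw [Prod.fst_swap, Prod.snd_swap, add_comm]
    exact hp.le q hq⟩

lemma smul (h : IsConjRep k N₀ ρ) (hJ : IsPrimeDecomposition Γ J)
    (hp : IsMinimalPair k N₀ ρ J p) (γ : Γ) : IsMinimalPair k N₀ ρ J (γ • p.1, γ • p.2) :=
  ⟨limitPairs_smul h hJ hp.mem γ, fun q hq => by
    have e (x : B) : rightRank k (γ • x) = rightRank k x :=
      rightRank_algEquiv (IsConjRep.actionEquiv k γ) x
    rw [e, e]
    exact hp.le q hq⟩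

lemma rightRank_mul (h : IsConjRep k N₀ ρ) (hJ : IsPrimeDecomposition Γ J)
    (hp : IsMinimalPair k N₀ ρ J p) (hq : IsMinimalPair k N₀ ρ J q) {a : Γ} (ha : a ∈ N₀)
    (hne : ∀ e ∈ J, e * (p.1 * ρ a * q.1) ≠ 0 ∧ e * (q.2 * ρ a⁻¹ * p.2) ≠ 0) :
    rightRank k (p.1 * ρ a * q.1) = rightRank k q.1 ∧
      rightRank k (q.2 * ρ a⁻¹ * p.2) = rightRank k q.2 := by
  have h1 := hp.le _ (limitPairs_mul h hJ hp.mem hq.mem ha hne)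
  have h2 := hq.le _ (limitPairs_mul h hJ hp.mem hq.mem ha hne)
  have h3 := rightRank_mul_le_right (k := k) (p.1 * ρ a) q.1
  have h4 := rightRank_mul_le_left (k := k) q.2 (ρ a⁻¹ * p.2)
  rw [← mul_assoc] at h4
  simp only at h1 h2
  omega

lemma mul_mul_eq_zero (h : IsConjRep k N₀ ρ) (hJ : IsPrimeDecomposition Γ J)
    (hp : IsMinimalPair k N₀ ρ J p) (hq : IsMinimalPair k N₀ ρ J q) {a : Γ} (ha : a ∈ N₀)
    (hne : ∀ e ∈ J, e * (p.1 * ρ a * q.1) ≠ 0 ∧ e * (q.2 * ρ a⁻¹ * p.2) ≠ 0) {b : B}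
    (hb : p.1 * ρ a * (q.1 * b * q.2) * (ρ a⁻¹ * p.2) = 0) : q.1 * b * q.2 = 0 := by
  obtain ⟨h1, h2⟩ := hp.rightRank_mul h hJ hq ha hne
  have h3 := mul_mul_eq_zero_of_rightRank_eq h1 (b := b * q.2 * (ρ a⁻¹ * p.2)) (by
    rw [← hb]
    noncomm_ring)
  rw [mul_assoc] at h2
  exact mul_eq_zero_of_rightRank_eq h2 (b := q.1 * b) (by
    rw [← h3]
    noncomm_ring)

/-- If some limit pair is degenerate, so is a minimal one. -/
lemma exists_mul_eq_zero (h : IsConjRep k N₀ ρ) (hJ : IsPrimeDecomposition Γ J)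
    (hp : IsMinimalPair k N₀ ρ J p) (hq : q ∈ limitPairs k N₀ ρ J) {e₀ : B} (he₀ : e₀ ∈ J)
    (h0 : e₀ * q.1 * q.2 = 0) : ∃ e ∈ J, e * (p.2 * p.1) = 0 := by
  by_contra! hcon
  obtain ⟨hspan, hcomm⟩ := limitPairs_mul_mem_span h hJ hp.mem
  rw [hcomm] at hcon
  obtain ⟨d, hd⟩ := hJ.exists_mul_eq_one hspan hcon
  have h1 : rightRank k p.1 = Module.finrank k B := rightRank_eq_finrank (y := p.2 * d) (by
    rw [← mul_assoc, hd])
  have h2 : rightRank k p.2 = Module.finrank k B := rightRank_eq_finrank (y := p.1 * d) (by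
    rw [← mul_assoc, hcomm, hd])
  have h3 := hp.le q hq
  have h4 : rightRank k q.1 < Module.finrank k B :=
    rightRank_lt_finrank (y := e₀ * q.2) (by
      rw [← mul_assoc, ← hJ.comm e₀ he₀, h0]) (hq.2 e₀ he₀).2
  have h5 := rightRank_le_finrank (k := k) q.2
  omega

/-- The elements that are nonzero and lie in one of the factors. -/
def factorSet {B : Type*} [Ring B] (J : Finset B) : Set B := {b | b ≠ 0 ∧ ∃ e ∈ J, e * b = b}

lemma smul_mem_factorSet (hJ : IsPrimeDecomposition Γ J) {b : B} (hb : b ∈ factorSet J) (γ : Γ) :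
    γ • b ∈ factorSet J := by
  obtain ⟨h0, e, he, h⟩ := hb
  exact ⟨(smul_ne_zero_iff_ne γ).2 h0, γ • e, hJ.smul_mem γ e he, by rw [← smul_mul', h]⟩

/-- The space of sandwiches `P * b * Q`. -/
def sandwich (k : Type*) {B : Type*} [Field k] [Ring B] [Algebra k B] (P Q : B) :
    Submodule k B :=
  LinearMap.range (LinearMap.mulLeft k P ∘ₗ LinearMap.mulRight k Q)

lemma mem_sandwich {P Q w : B} : w ∈ sandwich k P Q ↔ ∃ b, P * b * Q = w := by
  simp [sandwich, mul_assoc]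

/-- The attracting neighbourhoods. -/
def attr (k : Type*) {B : Type*} [NontriviallyNormedField k] [NormedRing B] [NormedAlgebra k B]
    (J : Finset B) (p : B × B) (n : ℕ) : Set B :=
  {b | b ∈ factorSet J ∧ ∃ w ∈ sandwich k p.1 p.2, ‖b - w‖ ≤ 1 / ((n : ℝ) + 1) * ‖b‖}

/-- The repelling neighbourhoods. -/
def rep {B : Type*} [NormedRing B] (J : Finset B) (p : B × B) (n : ℕ) : Set B :=
  {b | b ∈ factorSet J → ‖p.2 * b * p.1‖ ≤ 1 / ((n : ℝ) + 1) * ‖b‖}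

lemma movesOff_of_injOn (hJ : IsPrimeDecomposition Γ J) {γ : Γ}
    (hinj : ∀ w ∈ sandwich k p.1 p.2, p.2 * (γ • w) * p.1 = 0 → w = 0) :
    MovesOff (attr k J p) (rep J p) γ := by
  let g : B →ₗ[k] B := (IsConjRep.actionEquiv k γ : B ≃ₐ[k] B).toLinearMap
  let f : B →ₗ[k] B := LinearMap.mulRight k p.1 ∘ₗ LinearMap.mulLeft k p.2 ∘ₗ g
  have hf : ∀ b, f b = p.2 * (γ • b) * p.1 := fun b => rfl
  obtain ⟨c, hc, hcW⟩ := f.exists_pos_mul_norm_le _ hinj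
  obtain ⟨F, hF0, hF⟩ := (LinearMap.toContinuousLinearMap f).isBoundedLinearMap.bound
  obtain ⟨K, hK0, hK⟩ := (LinearMap.toContinuousLinearMap g).isBoundedLinearMap.bound
  obtain ⟨n, hn⟩ := exists_nat_one_div_lt (show 0 < c / (c + F + K) by positivity)
  refine ⟨n, fun b hb hbad => ?_⟩
  obtain ⟨hb0, w, hw, hbw⟩ := hb
  have h1 := hbad (smul_mem_factorSet hJ hb0 γ)
  have hbpos : 0 < ‖b‖ := norm_pos_iff.2 hb0.1
  set ε : ℝ := 1 / ((n : ℝ) + 1) with hε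
  have hε0 : 0 < ε := by positivity
  rw [lt_div_iff₀ (by positivity)] at hn
  have h2 : ‖f b‖ ≤ ε * ‖γ • b‖ := h1
  have h3 : ‖γ • b‖ ≤ K * ‖b‖ := hK b
  have h4 : ‖f (b - w)‖ ≤ F * ‖b - w‖ := hF _
  have h5 := hcW w hw
  have h6 : ‖f w‖ ≤ ‖f b‖ + ‖f (b - w)‖ := by
    rw [map_sub]
    exact norm_le_norm_add_norm_sub _ _
  have h7 : ‖b‖ ≤ ‖w‖ + ‖b - w‖ := by
    exact norm_le_norm_add_norm_sub' _ _
  have h8 : ε * ‖γ • b‖ ≤ ε * (K * ‖b‖) := by gcongr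
  have h9 : F * ‖b - w‖ ≤ F * (ε * ‖b‖) := by gcongr
  have h10 : c * ‖b‖ ≤ c * ‖w‖ + c * ‖b - w‖ := by rw [← mul_add]; gcongr
  have h11 : c * ‖b - w‖ ≤ c * (ε * ‖b‖) := by gcongr
  nlinarith

lemma movesOff (h : IsConjRep k N₀ ρ) (hJ : IsPrimeDecomposition Γ J)
    (hp : IsMinimalPair k N₀ ρ J p) {γ₁ γ₂ y : Γ} (hy : y ∈ N₀)
    (h1 : ∀ e ∈ J, e * ((γ₁⁻¹ • p.2) * ρ y * (γ₂ • p.1)) ≠ 0)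
    (h2 : ∀ e ∈ J, e * ((γ₂ • p.2) * ρ y⁻¹ * (γ₁⁻¹ • p.1)) ≠ 0) :
    MovesOff (attr k J p) (rep J p) (γ₁ * y * γ₂) := by
  refine movesOff_of_injOn hJ fun w hw h0 => ?_
  obtain ⟨b, rfl⟩ := mem_sandwich.1 hw
  have h3 := mul_mul_eq_zero h hJ (hp.smul h hJ γ₁⁻¹).swap (hp.smul h hJ γ₂) hy
    (fun e he => ⟨h1 e he, h2 e he⟩) (b := γ₂ • b) (by
      have h4 := congrArg (fun z => γ₁⁻¹ • z) h0
      simp only [mul_smul, smul_mul', smul_zero, inv_smul_smul, h.smul_eq y hy] at h4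
      have h5 : ∀ u, ρ y⁻¹ * (ρ y * u) = u := fun u => by
        rw [← mul_assoc, h.map_inv_mul hy, one_mul]
      simpa only [Prod.fst_swap, Prod.snd_swap, mul_assoc, h5] using h4)
  simp only [← smul_mul'] at h3
  exact (smul_eq_zero_iff_eq γ₂).1 h3

lemma eventually_contracting (h : IsConjRep k N₀ ρ) (hJ : IsPrimeDecomposition Γ J)
    (hp : IsMinimalPair k N₀ ρ J p) {a : Γ} (ha : a ∈ N₀)
    (hne : ∀ e ∈ J, e * (p.1 * ρ a * p.2) ≠ 0 ∧ e * (p.1 * ρ a⁻¹ * p.2) ≠ 0) {ε : ℝ}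
    (hε : 0 < ε) :
    ∀ᶠ r in 𝓝 p, ∀ g ∈ N₀, ∀ c ∈ Submodule.span k (J : Set B),
      ∀ d ∈ Submodule.span k (J : Set B), r = (c * ρ g, d * ρ g⁻¹) → ∀ b ∈ factorSet J,
      ε * ‖b‖ < ‖p.2 * b * p.1‖ → ∃ w ∈ sandwich k p.1 p.2,
      ‖(g * a * g⁻¹) • b - w‖ ≤ ε * ‖(g * a * g⁻¹) • b‖ := by
  let f : B →ₗ[k] B := LinearMap.mulLeft k (p.1 * ρ a) ∘ₗ LinearMap.mulRight k (ρ a⁻¹ * p.2)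
  have hf : ∀ b, f b = p.1 * ρ a * (b * (ρ a⁻¹ * p.2)) := fun b => rfl
  obtain ⟨δ, hδ, hδW⟩ := f.exists_pos_mul_norm_le (sandwich k p.2 p.1) (by
    intro w hw h0
    obtain ⟨b, rfl⟩ := mem_sandwich.1 hw
    refine mul_mul_eq_zero h hJ hp hp.swap ha hne ?_
    rw [hf] at h0
    simpa only [Prod.fst_swap, Prod.snd_swap, mul_assoc] using h0)
  have hη : 0 < δ * ε ^ 2 / (1 + ε) := by positivity
  have hcont : Continuous fun r : B × B =>
      ‖r.1 * ρ a * r.2 - p.1 * ρ a * p.2‖ * ‖r.1 * ρ a⁻¹ * r.2‖ +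
      ‖p.1 * ρ a * p.2‖ * ‖r.1 * ρ a⁻¹ * r.2 - p.1 * ρ a⁻¹ * p.2‖ := by fun_prop
  filter_upwards [hcont.continuousAt.eventually_lt_const (by simpa using hη)]
  rintro r hr g hg c hc d hd rfl b ⟨hb0, e, he, heb⟩ hbr
  have hbpos : 0 < ‖b‖ := norm_pos_iff.2 hb0
  simp only at hr
  set X := c * ρ g with hX
  set Y := d * ρ g⁻¹ with hY
  set t := g * a * g⁻¹ with ht
  have htN : t ∈ N₀ := mul_mem (mul_mem hg ha) (inv_mem hg)
  set z := X * ρ a * Y * b * (X * ρ a⁻¹ * Y) with hz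
  set w := p.1 * ρ a * p.2 * b * (p.1 * ρ a⁻¹ * p.2) with hw
  have hconj : ∀ x ∈ N₀, X * ρ x * Y = c * d * ρ (g * x * g⁻¹) := by
    intro x hx
    have e1 : ∀ u v, u * (d * v) = d * (u * v) := fun u v => by
      rw [← mul_assoc, ← hJ.comm_of_mem_span hd, mul_assoc]
    rw [h.map_mul _ (mul_mem hg hx) _ (inv_mem hg), h.map_mul _ hg _ hx, hX, hY]
    simp only [mul_assoc]
    rw [e1 (ρ x), e1 (ρ g)]
  have hcd := hJ.mul_mem_span hc hd
  have hte : t • e ∈ J := hJ.smul_mem t e he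
  have hzt : z = c * d * (c * d) * (t • b) := by
    have e1 : t⁻¹ = g * a⁻¹ * g⁻¹ := by simp [ht, mul_assoc]
    rw [hz, hconj a ha, hconj a⁻¹ (inv_mem ha), h.smul_eq t htN, e1]
    have e2 : ∀ u v : B, c * d * u * (c * d * v) = c * d * (c * d) * (u * v) := by
      intro u v
      rw [mul_assoc _ u, ← mul_assoc u, ← hJ.comm_of_mem_span hcd u]
      simp only [mul_assoc]
    rw [mul_assoc (c * d) _ b, e2]
  obtain ⟨s, hs⟩ := hJ.exists_mul_eq_smul (hJ.mul_mem_span hcd hcd) hte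
  have hzs : z = s • (t • b) := by
    rw [hzt]
    conv_lhs => rw [← heb, smul_mul', ← mul_assoc, ← hJ.comm _ hte, hs]
    rw [smul_mul_assoc, ← smul_mul', heb]
  have hwW : w ∈ sandwich k p.1 p.2 := mem_sandwich.2
    ⟨ρ a * p.2 * b * (p.1 * ρ a⁻¹), by rw [hw]; simp only [mul_assoc]⟩
  have hwn : δ * (ε * ‖b‖) ≤ ‖w‖ := by
    have h1 := hδW (p.2 * b * p.1) (mem_sandwich.2 ⟨b, rfl⟩)
    have h2 : f (p.2 * b * p.1) = w := by rw [hf, hw]; simp only [mul_assoc]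
    rw [h2] at h1
    refine le_trans ?_ h1
    gcongr
  have hzw : ‖z - w‖ ≤ δ * ε ^ 2 / (1 + ε) * ‖b‖ := by
    have e1 : z - w = (X * ρ a * Y - p.1 * ρ a * p.2) * b * (X * ρ a⁻¹ * Y) +
        p.1 * ρ a * p.2 * b * (X * ρ a⁻¹ * Y - p.1 * ρ a⁻¹ * p.2) := by
      rw [hz, hw]; simp only [sub_mul, mul_sub]; abel
    rw [e1]
    refine (norm_add_le _ _).trans ?_
    calc _ ≤ ‖X * ρ a * Y - p.1 * ρ a * p.2‖ * ‖b‖ * ‖X * ρ a⁻¹ * Y‖ +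
          ‖p.1 * ρ a * p.2‖ * ‖b‖ * ‖X * ρ a⁻¹ * Y - p.1 * ρ a⁻¹ * p.2‖ := by
            gcongr <;> refine norm_mul_le_of_le (norm_mul_le _ _) le_rfl
      _ = (‖X * ρ a * Y - p.1 * ρ a * p.2‖ * ‖X * ρ a⁻¹ * Y‖ +
          ‖p.1 * ρ a * p.2‖ * ‖X * ρ a⁻¹ * Y - p.1 * ρ a⁻¹ * p.2‖) * ‖b‖ := by ring
      _ ≤ _ := by gcongr
  have hzn : ‖w‖ ≤ ‖z‖ + ‖z - w‖ := norm_le_norm_add_norm_sub _ _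
  set η := δ * ε ^ 2 / (1 + ε) with hηd
  have hη1 : η * (1 + ε) = δ * ε ^ 2 := by rw [hηd]; field_simp
  have hzε : ‖z - w‖ ≤ ε * ‖z‖ := by
    have : η * (1 + ε) * ‖b‖ = δ * ε ^ 2 * ‖b‖ := by rw [hη1]
    nlinarith
  have hz0 : z ≠ 0 := by
    intro h0
    rw [h0, norm_zero, mul_zero] at hzε
    rw [h0, norm_zero, zero_add] at hzn
    have : 0 < δ * (ε * ‖b‖) := by positivity
    linarith
  have hs0 : s ≠ 0 := by
    rintro rfl
    exact hz0 (by rw [hzs, zero_smul])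
  refine ⟨s⁻¹ • w, Submodule.smul_mem _ _ hwW, ?_⟩
  have e1 : t • b = s⁻¹ • z := by rw [hzs, inv_smul_smul₀ hs0]
  rw [e1, ← smul_sub, norm_smul, norm_smul, mul_left_comm]
  gcongr

theorem isPingPongTable [Nontrivial B] (hM : IsMIF Γ) (h : IsConjRep k N₀ ρ)
    (hJ : IsPrimeDecomposition Γ J) (hp : IsMinimalPair k N₀ ρ J p) {e₀ : B} (he₀ : e₀ ∈ J)
    (h0 : e₀ * (p.2 * p.1) = 0) : IsPingPongTable Γ (attr k J p) (rep J p) where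
  antitone_attr := by
    rintro m n hmn b ⟨hb, w, hw, hbw⟩
    refine ⟨hb, w, hw, hbw.trans ?_⟩
    gcongr
  antitone_rep := by
    intro m n hmn b hb hbJ
    refine (hb hbJ).trans ?_
    gcongr
  nonempty_inter := by
    intro n
    obtain ⟨b, hb⟩ := hJ.prime e₀ he₀ p.1 p.2 (hp.mem.2 e₀ he₀).1 (hp.mem.2 e₀ he₀).2
    have hee : e₀ * (e₀ * (p.1 * b * p.2)) = e₀ * (p.1 * b * p.2) := by
      rw [← mul_assoc, hJ.idem e₀ he₀]
    refine ⟨e₀ * (p.1 * b * p.2), ⟨⟨hb, e₀, he₀, hee⟩, e₀ * (p.1 * b * p.2),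
      mem_sandwich.2 ⟨e₀ * b, ?_⟩, ?_⟩, fun _ => ?_⟩
    · rw [← mul_assoc, ← hJ.comm e₀ he₀]
      simp only [mul_assoc]
    · rw [sub_self, norm_zero]
      positivity
    · have e1 : p.2 * (e₀ * (p.1 * b * p.2)) = e₀ * (p.2 * p.1) * (b * p.2) := by
        rw [← mul_assoc, ← hJ.comm e₀ he₀]
        simp only [mul_assoc]
      rw [e1, h0, zero_mul, zero_mul, norm_zero]
      positivity
  exists_contracting := by
    intro N hN hN1 n
    obtain ⟨a, haN, ha, hne⟩ := h.exists_forall_ne_zero hM hJ hN hN1 [p] (by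
      simpa using hp.mem.2)
    have hne' := hne p (by simp)
    have hε : (0 : ℝ) < 1 / ((n : ℝ) + 1) := by positivity
    have ev := (hp.eventually_contracting h hJ ha hne' hε).and
      (hp.eventually_contracting h hJ (inv_mem ha)
        (fun e he => ⟨(hne' e he).2, by rw [inv_inv]; exact (hne' e he).1⟩) hε)
    obtain ⟨r, ⟨g, hg, c, hc, d, hd, hr⟩, ev1, ev2⟩ :=
      ((mem_closure_iff_frequently.1 hp.mem.1).and_eventually ev).exists
    refine ⟨g * a * g⁻¹, hN.conj_mem a haN g, fun b hb => ?_⟩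
    simp only [rep, Set.mem_ofPred_eq, not_forall, not_le] at hb
    obtain ⟨hbJ, hb⟩ := hb
    refine ⟨⟨smul_mem_factorSet hJ hbJ _, ev1 g hg c hc d hd hr b hbJ hb⟩,
      ⟨smul_mem_factorSet hJ hbJ _, ?_⟩⟩
    have e1 : (g * a * g⁻¹)⁻¹ = g * a⁻¹ * g⁻¹ := by simp [mul_assoc]
    rw [e1]
    exact ev2 g hg c hc d hd hr b hbJ hb
  exists_generic := by
    intro N hN hN1 L
    have hq := fun γ => hp.smul h hJ γ
    obtain ⟨y, hyN, hy, hne⟩ := h.exists_forall_ne_zero hM hJ hN hN1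
      (L.flatMap fun q => [(q.1⁻¹ • p.2, q.2 • p.1), (q.2 • p.2, q.1⁻¹ • p.1)]) (by
        intro r hr
        simp only [List.mem_flatMap, List.mem_cons, List.not_mem_nil, or_false] at hr
        obtain ⟨q, -, rfl | rfl⟩ := hr
        · exact fun e he => ⟨((hq q.1⁻¹).mem.2 e he).2, ((hq q.2).mem.2 e he).1⟩
        · exact fun e he => ⟨((hq q.2).mem.2 e he).2, ((hq q.1⁻¹).mem.2 e he).1⟩)
    refine ⟨y, hyN, fun q hqL => ?_⟩
    have h1 := hne (q.1⁻¹ • p.2, q.2 • p.1) (List.mem_flatMap.2 ⟨q, hqL, by simp⟩)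
    have h2 := hne (q.2 • p.2, q.1⁻¹ • p.1) (List.mem_flatMap.2 ⟨q, hqL, by simp⟩)
    refine ⟨hp.movesOff h hJ hy (fun e he => (h1 e he).1) (fun e he => (h2 e he).2),
      hp.movesOff h hJ (inv_mem hy) (fun e he => (h1 e he).2) (fun e he => ?_)⟩
    rw [inv_inv]
    exact (h2 e he).1

end IsMinimalPair

/-- A finitely generated mixed identity free group acting on a finite-dimensional algebra over a
local field with unbounded projective image is primitive. -/
theorem IsConjRep.exists_isCoatom {k Γ B : Type*} [Group Γ] [NontriviallyNormedField k]
    [ProperSpace k] [NormedRing B] [NormedAlgebra k B] [FiniteDimensional k B]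
    [MulSemiringAction Γ B] [SMulCommClass Γ k B] {N₀ : Subgroup Γ} {ρ : Γ → B} {J : Finset B}
    (hfg : Group.FG Γ) (hM : IsMIF Γ) (h : IsConjRep k N₀ ρ) (hJ : IsPrimeDecomposition Γ J)
    {e₀ : B} (he₀ : e₀ ∈ J) (hunb : ∀ C : ℝ, ∃ g ∈ N₀, C < ‖e₀ * ρ g‖ * ‖e₀ * ρ g⁻¹‖) :
    ∃ M : Subgroup Γ, IsCoatom M ∧ M.normalCore = ⊥ := by
  have : Nontrivial B := ⟨e₀, 0, hJ.ne_zero e₀ he₀⟩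
  have : Nontrivial Γ := by
    have := hM.infinite
    infer_instance
  obtain ⟨q, hq, hq0⟩ := exists_limitPair_mul_eq_zero h hJ he₀ hunb
  obtain ⟨p, hp, hmin⟩ := exists_minimal_of_wellFoundedLT
    (fun n => ∃ p ∈ limitPairs k N₀ ρ J, rightRank k p.1 + rightRank k p.2 = n) ⟨_, q, hq, rfl⟩
  obtain ⟨p, hp, rfl⟩ := hp
  have hp' : IsMinimalPair k N₀ ρ J p := ⟨hp, fun r hr => by
    by_contra! hlt
    exact absurd (hmin ⟨r, hr, rfl⟩ hlt.le) (not_le.2 hlt)⟩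
  obtain ⟨e, he, h0⟩ := hp'.exists_mul_eq_zero h hJ hq he₀ hq0
  exact (hp'.isPingPongTable hM h hJ he h0).exists_isCoatom hfg

section Clifford

variable {Γ B V : Type*} [Group Γ] [Ring B] [AddCommGroup V] [Module B V]
  [MulSemiringAction Γ B] [DistribMulAction Γ V]

/-- A semilinear group action permutes the submodules. -/
def submoduleOrderIso (hcompat : ∀ (γ : Γ) (b : B) (v : V), γ • b • v = (γ • b) • γ • v) (γ : Γ) :
    Submodule B V ≃o Submodule B V where
  toFun S :=
    { carrier := {v | γ⁻¹ • v ∈ S}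
      add_mem' := fun {a b} ha hb => by
        change γ⁻¹ • (a + b) ∈ S
        rw [smul_add]
        exact add_mem ha hb
      zero_mem' := by
        change γ⁻¹ • (0 : V) ∈ S
        simp
      smul_mem' := fun b v hv => by
        change γ⁻¹ • b • v ∈ S
        rw [hcompat]
        exact S.smul_mem _ hv }
  invFun S :=
    { carrier := {v | γ • v ∈ S}
      add_mem' := fun {a b} ha hb => by
        change γ • (a + b) ∈ S
        rw [smul_add]
        exact add_mem ha hb
      zero_mem' := by
        change γ • (0 : V) ∈ S
        simp
      smul_mem' := fun b v hv => by
        change γ • b • v ∈ S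
        rw [hcompat]
        exact S.smul_mem _ hv }
  left_inv S := by
    ext v
    change γ⁻¹ • γ • v ∈ S ↔ v ∈ S
    rw [inv_smul_smul]
  right_inv S := by
    ext v
    change γ • γ⁻¹ • v ∈ S ↔ v ∈ S
    rw [smul_inv_smul]
  map_rel_iff' {S T} := by
    constructor
    · intro h v hv
      have := @h (γ • v) (show γ⁻¹ • γ • v ∈ S by rwa [inv_smul_smul])
      have h2 : γ⁻¹ • γ • v ∈ T := this
      rwa [inv_smul_smul] at h2
    · exact fun h v hv => h hv

/-- Clifford's theorem. -/
theorem isSemisimpleModule_of_irreducible [IsArtinian B V] [Nontrivial V]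
    (hcompat : ∀ (γ : Γ) (b : B) (v : V), γ • b • v = (γ • b) • γ • v)
    (hirr : ∀ W : Submodule B V, (∀ γ : Γ, ∀ w ∈ W, γ • w ∈ W) → W = ⊥ ∨ W = ⊤) :
    IsSemisimpleModule B V := by
  refine .of_sSup_simples_eq_top ?_
  simp only [isSimpleModule_iff_isAtom]
  refine (hirr _ fun γ w hw => ?_).resolve_left ?_
  · let T := submoduleOrderIso hcompat γ
    have h1 : γ • w ∈ T (sSup {m | IsAtom m}) := by
      change γ⁻¹ • γ • w ∈ sSup {m : Submodule B V | IsAtom m}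
      rwa [inv_smul_smul]
    rw [OrderIso.map_sSup] at h1
    refine (iSup₂_le fun S hS => le_sSup ?_ : (⨆ a ∈ {m | IsAtom m}, T a) ≤ _) h1
    exact (OrderIso.isAtom_iff T S).2 hS
  · obtain h | ⟨S, hS, -⟩ := IsAtomic.eq_bot_or_exists_atom_le (⊤ : Submodule B V)
    · exact absurd h top_ne_bot
    · intro h0
      exact hS.1 (le_bot_iff.1 (h0 ▸ le_sSup hS))

theorem isSemisimpleRing_of_irreducible [IsArtinian B V] [Nontrivial V]
    (hcompat : ∀ (γ : Γ) (b : B) (v : V), γ • b • v = (γ • b) • γ • v)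
    (hirr : ∀ W : Submodule B V, (∀ γ : Γ, ∀ w ∈ W, γ • w ∈ W) → W = ⊥ ∨ W = ⊤)
    {ι : Type*} [Finite ι] (v : ι → V) (hv : ∀ b : B, (∀ i, b • v i = 0) → b = 0) :
    IsSemisimpleRing B := by
  have := isSemisimpleModule_of_irreducible hcompat hirr
  let f : B →ₗ[B] (ι → V) := LinearMap.pi fun i => LinearMap.toSpanSingleton B V (v i)
  refine IsSemisimpleModule.of_injective f ((injective_iff_map_eq_zero f).2 fun b hb => hv b ?_)
  exact fun i => congrFun hb i

end Clifford

theorem IsSemisimpleRing.exists_isPrimeDecomposition (Γ : Type*) {B : Type*} [Group Γ] [Ring B]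
    [MulSemiringAction Γ B] [IsSemisimpleRing B] : ∃ J : Finset B, IsPrimeDecomposition Γ J := by
  classical
  obtain ⟨n, D, d, _, hd, ⟨φ⟩⟩ := IsSemisimpleRing.exists_ringEquiv_pi_matrix_divisionRing B
  let E : Fin n → B := fun i => φ.symm (Pi.single i 1)
  have hφ : ∀ i, φ (E i) = Pi.single i 1 := fun i => φ.apply_symm_apply _
  have hE : ∀ i x, φ (E i * x) = Pi.single i (φ x i) := by
    intro i x
    rw [map_mul, hφ]
    ext1 j
    by_cases h : j = i
    · subst h; simp
    · simp [h]
  have hEne : ∀ i x, E i * x ≠ 0 ↔ φ x i ≠ 0 := by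
    intro i x
    rw [← φ.map_ne_zero_iff, hE, Ne, Pi.single_eq_zero_iff]
  have hcomm : ∀ i b, E i * b = b * E i := by
    intro i b
    apply φ.injective
    rw [hE, map_mul, hφ]
    ext1 j
    by_cases h : j = i
    · subst h; simp
    · simp [h]
  have hidem : ∀ i, E i * E i = E i := by
    intro i
    apply φ.injective
    rw [hE, hφ, Pi.single_eq_same]
  have hne : ∀ i, E i ≠ 0 := by
    intro i
    have := hd i
    have h := (hEne i 1).2 (by rw [map_one]; exact one_ne_zero)
    rwa [mul_one] at h
  have horth : ∀ i j, i ≠ j → E i * E j = 0 := by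
    intro i j hij
    apply φ.injective
    rw [hE, hφ, Pi.single_eq_of_ne hij, Pi.single_zero, map_zero]
  have hsum : ∑ i, E i = 1 := by
    apply φ.injective
    rw [map_sum, map_one]
    simp only [hφ]
    exact Finset.univ_sum_single 1
  have hprime : ∀ i x y, E i * x ≠ 0 → E i * y ≠ 0 → ∃ b, E i * (x * b * y) ≠ 0 := by
    intro i x y hx hy
    rw [hEne] at hx hy
    obtain ⟨p, q, hpq⟩ : ∃ p q, φ x i p q ≠ 0 := by
      by_contra! h
      exact hx (Matrix.ext h)
    obtain ⟨r, s, hrs⟩ : ∃ r s, φ y i r s ≠ 0 := by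
      by_contra! h
      exact hy (Matrix.ext h)
    refine ⟨φ.symm (Pi.single i (Matrix.single q r 1)), ?_⟩
    rw [hEne]
    intro h0
    have h1 := congrFun (congrFun h0 p) s
    rw [map_mul, map_mul, φ.apply_symm_apply, Pi.mul_apply, Pi.mul_apply, Pi.single_eq_same,
      Matrix.mul_apply, Finset.sum_eq_single r] at h1
    · rw [Matrix.mul_single_apply_same, mul_one] at h1
      exact (mul_ne_zero hpq hrs) h1
    · intro j _ hj
      rw [Matrix.mul_single_apply_of_ne _ _ _ _ _ hj, zero_mul]
    · simp
  have hprim : ∀ e f : B, f * f = f → (∀ b, f * b = b * f) →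
      (∀ x y, e * x ≠ 0 → e * y ≠ 0 → ∃ b, e * (x * b * y) ≠ 0) → e * f ≠ 0 → e * f = e := by
    intro e f hf hfc he hef
    by_contra hne'
    obtain ⟨b, hb⟩ := he f (1 - f) hef (by
      rw [mul_sub, mul_one]
      exact sub_ne_zero.2 (Ne.symm hne'))
    apply hb
    rw [hfc b, mul_assoc b, mul_sub, mul_one, hf, sub_self, mul_zero, mul_zero]
  refine ⟨Finset.univ.image E, ?_, ?_, ?_, ?_, ?_, ?_, ?_⟩
  · simpa using hidem
  · simpa using hne
  · simpa using hcomm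
  · simp only [Finset.mem_image, Finset.mem_univ, true_and, forall_exists_index,
      forall_apply_eq_imp_iff]
    exact fun i j hij => horth i j fun h => hij (congrArg E h)
  · rw [Finset.sum_image, hsum]
    intro i _ j _ hij
    by_contra h
    exact hne i (by rw [← hidem i]; nth_rewrite 2 [hij]; exact horth i j h)
  · simp only [Finset.mem_image, Finset.mem_univ, true_and, forall_exists_index,
      forall_apply_eq_imp_iff]
    intro γ i
    set f := γ • E i with hf
    have hinj : ∀ x : B, E i * x ≠ 0 ↔ f * (γ • x) ≠ 0 := by
      intro x
      rw [hf, ← smul_mul', smul_ne_zero_iff_ne]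
    have hsurj : ∀ x : B, ∃ y, γ • y = x := fun x => ⟨γ⁻¹ • x, smul_inv_smul _ _⟩
    have hff : f * f = f := by rw [hf, ← smul_mul', hidem]
    have hfc : ∀ b, f * b = b * f := by
      intro b
      obtain ⟨b, rfl⟩ := hsurj b
      rw [hf, ← smul_mul', hcomm, smul_mul']
    have hfp : ∀ x y, f * x ≠ 0 → f * y ≠ 0 → ∃ b, f * (x * b * y) ≠ 0 := by
      intro x y hx hy
      obtain ⟨x, rfl⟩ := hsurj x
      obtain ⟨y, rfl⟩ := hsurj y
      obtain ⟨b, hb⟩ := hprime i x y ((hinj x).2 hx) ((hinj y).2 hy)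
      exact ⟨γ • b, by rw [← smul_mul', ← smul_mul', ← hinj]; exact hb⟩
    obtain ⟨j, hj⟩ : ∃ j, f * E j ≠ 0 := by
      by_contra! h
      have : f = 0 := by
        rw [← mul_one f, ← hsum, Finset.mul_sum, Finset.sum_eq_zero fun i _ => h i]
      exact hne i ((smul_eq_zero_iff_eq γ).1 this)
    have h1 := hprim f (E j) (hidem j) (hcomm j) hfp hj
    have h2 := hprim (E j) f hff hfc (hprime j) (by rwa [hcomm j])
    exact ⟨j, by rw [← h2, hcomm, h1]⟩
  · simpa using hprime

section Place

open Cardinal Polynomial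

/-- Embeddings of a countable ring into two algebraically closed fields of cardinality continuum
differ by an isomorphism. -/
theorem exists_ringEquiv_comp_eq {L K F : Type} [CommRing L] [Nontrivial L] [Countable L]
    [Field K] [IsAlgClosed K] [Field F] [IsAlgClosed F] (hK : #K = 𝔠) (hF : #F = 𝔠)
    (i : L →+* K) (j : L →+* F) (hi : Function.Injective i) (hj : Function.Injective j) :
    ∃ σ : K ≃+* F, ∀ x, σ (i x) = j x := by
  let := i.toAlgebra
  let := j.toAlgebra
  have : FaithfulSMul L K := (faithfulSMul_iff_algebraMap_injective L K).2 hi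
  have : FaithfulSMul L F := (faithfulSMul_iff_algebraMap_injective L F).2 hj
  have hL : #L ≤ ℵ₀ := mk_le_aleph0
  obtain ⟨s, hs⟩ := exists_isTranscendenceBasis L K
  obtain ⟨t, ht⟩ := exists_isTranscendenceBasis L F
  have h1 := IsAlgClosed.cardinal_eq_cardinal_transcendence_basis_of_aleph0_lt' _ hs hL
    (hK ▸ aleph0_lt_continuum)
  have h2 := IsAlgClosed.cardinal_eq_cardinal_transcendence_basis_of_aleph0_lt' _ ht hL
    (hF ▸ aleph0_lt_continuum)
  obtain ⟨e⟩ := Cardinal.eq.1 (show #s = #t by rw [← h1, ← h2, hK, hF])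
  let := IsAlgClosed.isAlgClosure_of_transcendence_basis _ hs
  let := IsAlgClosed.isAlgClosure_of_transcendence_basis _ ht
  let E : Algebra.adjoin L (Set.range ((↑) : s → K)) ≃ₐ[L]
      Algebra.adjoin L (Set.range ((↑) : t → F)) :=
    (hs.1.aevalEquiv.symm.trans (MvPolynomial.renameEquiv L e)).trans ht.1.aevalEquiv
  refine ⟨IsAlgClosure.equivOfEquiv K F E.toRingEquiv, fun x => ?_⟩
  have h3 := IsAlgClosure.equivOfEquiv_algebraMap K F E.toRingEquiv (algebraMap L _ x)
  rw [← IsScalarTower.algebraMap_apply] at h3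
  refine h3.trans ?_
  have h4 : E.toRingEquiv (algebraMap L _ x) = algebraMap L _ x := E.commutes x
  rw [h4, ← IsScalarTower.algebraMap_apply]
  rfl

lemma mk_padicAlgCl (p : ℕ) [Fact p.Prime] : #(PadicAlgCl p) = 𝔠 := by
  have h1 : #ℚ_[p] ≤ 𝔠 := by
    refine (mk_quotient_le (s := CauSeq.equiv)).trans ((mk_subtype_le _).trans ?_)
    simp
  apply le_antisymm
  · exact (Algebra.IsAlgebraic.cardinalMk_le_max ℚ_[p] (PadicAlgCl p)).trans
      (max_le h1 aleph0_le_continuum)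
  · exact (continuum_le_cardinal_of_nontriviallyNormedField ℚ_[p]).trans
      (mk_le_of_injective (algebraMap ℚ_[p] (PadicAlgCl p)).injective)

lemma Rat.exists_int_of_forall_norm_le_one (q : ℚ)
    (h : ∀ (p : ℕ) [Fact p.Prime], ‖(q : ℚ_[p])‖ ≤ 1) : ∃ n : ℤ, (n : ℚ) = q := by
  have : q.den = 1 := by
    by_contra hd
    obtain ⟨p, hp, hpd⟩ := Nat.exists_prime_and_dvd hd
    have : Fact p.Prime := ⟨hp⟩
    have h1 : ‖(q.den : ℚ_[p])‖ < 1 := by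
      rw [← Int.cast_natCast, Padic.norm_intCast_lt_one_iff]
      exact_mod_cast hpd
    have h2 : ‖(q.num : ℚ_[p])‖ < 1 := by
      have h3 : (q.num : ℚ_[p]) = q * q.den := by exact_mod_cast (Rat.mul_den_eq_num q).symm
      rw [h3, norm_mul]
      calc _ ≤ 1 * ‖(q.den : ℚ_[p])‖ := by gcongr; exact h p
        _ < 1 := by rwa [one_mul]
    rw [Padic.norm_intCast_lt_one_iff] at h2
    exact hp.one_lt.ne' (Nat.eq_one_of_dvd_coprimes q.reduced
      (Int.natCast_dvd.1 h2) hpd)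
  exact ⟨q.num, by rw [Rat.coe_int_num_of_den_eq_one this]⟩

lemma Polynomial.norm_coeff_le_one_of_roots {F : Type*} [NormedField F] [IsUltrametricDist F]
    {f : F[X]} (hf : f.Monic) (hs : f.Splits) (hr : ∀ y ∈ f.roots, ‖y‖ ≤ 1) (n : ℕ) :
    ‖f.coeff n‖ ≤ 1 := by
  let V : Subring F :=
    { carrier := {x | ‖x‖ ≤ 1}
      mul_mem' := fun {a b} ha hb => by
        change ‖a * b‖ ≤ 1
        rw [norm_mul]
        exact mul_le_one₀ ha (norm_nonneg _) hb
      one_mem' := by simp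
      add_mem' := fun {a b} ha hb => (IsUltrametricDist.norm_add_le_max a b).trans (max_le ha hb)
      zero_mem' := by simp
      neg_mem' := fun {a} ha => by
        change ‖-a‖ ≤ 1
        rwa [norm_neg] }
  have h1 : f ∈ Polynomial.lifts V.subtype := by
    rw [hs.eq_prod_roots_of_monic hf]
    refine Subsemiring.multiset_prod_mem _ _ fun g hg => ?_
    obtain ⟨y, hy, rfl⟩ := Multiset.mem_map.1 hg
    exact ⟨X - C ⟨y, hr y hy⟩, by simp⟩
  obtain ⟨x, hx⟩ := (Polynomial.lifts_iff_coeff_lifts f).1 h1 n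
  rw [← hx]
  exact x.2

end Place

section Place

open Cardinal Polynomial

lemma Polynomial.countable_rat : Countable ℚ[X] := by
  rw [← mk_le_aleph0_iff]
  simp

/-- Conjugates of an algebraic number are images under isomorphisms of the ambient field. -/
lemma exists_ringEquiv_apply_eq_of_aeval_minpoly {F : Type} [Field F] [IsAlgClosed F] [Algebra ℚ F]
    (hF : #F = 𝔠) {z : ℂ} (hz : IsIntegral ℚ z) {y : F} (hy : aeval y (minpoly ℚ z) = 0) :
    ∃ σ : ℂ ≃+* F, σ z = y := by
  have : Fact (Irreducible (minpoly ℚ z)) := ⟨minpoly.irreducible hz⟩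
  have := Polynomial.countable_rat
  have : Countable (AdjoinRoot (minpoly ℚ z)) := AdjoinRoot.mk_surjective.countable
  let i : AdjoinRoot (minpoly ℚ z) →+* ℂ := AdjoinRoot.lift (algebraMap ℚ ℂ) z (minpoly.aeval ℚ z)
  let j : AdjoinRoot (minpoly ℚ z) →+* F := AdjoinRoot.lift (algebraMap ℚ F) y hy
  obtain ⟨σ, hσ⟩ := exists_ringEquiv_comp_eq mk_complex hF i j i.injective j.injective
  refine ⟨σ, ?_⟩
  have h := hσ (AdjoinRoot.root _)
  have h1 : i (AdjoinRoot.root _) = z := AdjoinRoot.lift_root _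
  have h2 : j (AdjoinRoot.root _) = y := AdjoinRoot.lift_root _
  rwa [h1, h2] at h

lemma exists_ringEquiv_norm_gt {z : ℂ} (hz : Transcendental ℚ z) (m : ℝ) :
    ∃ σ : ℂ ≃+* ℂ, m < ‖σ z‖ := by
  have hz0 : z ≠ 0 := by
    rintro rfl
    exact hz isAlgebraic_zero
  obtain ⟨n, hn⟩ := exists_nat_gt (max m 0 / ‖z‖)
  have hn0 : n ≠ 0 := by
    rintro rfl
    have : 0 ≤ max m 0 / ‖z‖ := by positivity
    simp only [Nat.cast_zero] at hn
    linarith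
  have hw : Transcendental ℚ (n • z) := by
    intro h
    apply hz
    have h2 := h.smul ((n : ℚ)⁻¹)
    rwa [← Nat.cast_smul_eq_nsmul ℚ, smul_smul, inv_mul_cancel₀ (Nat.cast_ne_zero.2 hn0),
      one_smul] at h2
  have := Polynomial.countable_rat
  obtain ⟨σ, hσ⟩ := exists_ringEquiv_comp_eq mk_complex mk_complex
    (aeval z : ℚ[X] →ₐ[ℚ] ℂ).toRingHom (aeval (n • z) : ℚ[X] →ₐ[ℚ] ℂ).toRingHom
    (transcendental_iff_injective.1 hz) (transcendental_iff_injective.1 hw)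
  refine ⟨σ, ?_⟩
  have h1 : σ z = n • z := by simpa using hσ X
  rw [h1, nsmul_eq_mul, norm_mul, Complex.norm_natCast]
  rw [div_lt_iff₀ (norm_pos_iff.2 hz0)] at hn
  exact (le_max_left _ _).trans_lt hn

lemma isIntegral_int_of_forall_norm_le_one {z : ℂ} (hz : IsIntegral ℚ z)
    (h : ∀ (p : ℕ) [Fact p.Prime] (σ : ℂ ≃+* PadicAlgCl p), ‖σ z‖ ≤ 1) : IsIntegral ℤ z := by
  have h1 : ∀ n, ∃ k : ℤ, (k : ℚ) = (minpoly ℚ z).coeff n := by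
    refine fun n => Rat.exists_int_of_forall_norm_le_one _ fun p _ => ?_
    have hm : ((minpoly ℚ z).map (algebraMap ℚ (PadicAlgCl p))).Monic :=
      (minpoly.monic hz).map _
    have h2 := Polynomial.norm_coeff_le_one_of_roots hm (IsAlgClosed.splits _) (fun y hy => ?_) n
    · rw [coeff_map] at h2
      have h3 : algebraMap ℚ (PadicAlgCl p) ((minpoly ℚ z).coeff n) =
          (((minpoly ℚ z).coeff n : ℚ_[p]) : PadicAlgCl p) := by
        simp
      rwa [h3, PadicAlgCl.norm_extends] at h2
    · rw [mem_roots hm.ne_zero, IsRoot.def, eval_map_algebraMap] at hy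
      obtain ⟨σ, rfl⟩ := exists_ringEquiv_apply_eq_of_aeval_minpoly (mk_padicAlgCl p) hz hy
      exact h p σ
  obtain ⟨f, hf, hdeg, hmon⟩ := lifts_and_degree_eq_and_monic
    ((lifts_iff_coeff_lifts (f := Int.castRingHom ℚ) (minpoly ℚ z)).2 fun n => h1 n)
    (minpoly.monic hz)
  refine ⟨f, hmon, ?_⟩
  have h4 := minpoly.aeval ℚ z
  rw [← hf, aeval_def, eval₂_map] at h4
  have h5 : algebraMap ℤ ℂ = (algebraMap ℚ ℂ).comp (Int.castRingHom ℚ) := Subsingleton.elim _ _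
  rw [h5]
  exact h4

lemma exists_ringHom_numberField (A : Type) [CommRing A] [Nontrivial A] [Algebra ℚ A]
    [Algebra.FiniteType ℚ A] :
    ∃ (E : Type) (_ : Field E) (_ : NumberField E), Nonempty (A →+* E) := by
  obtain ⟨I, hI⟩ := Ideal.exists_maximal A
  let iE : Field (A ⧸ I) := Ideal.Quotient.field I
  have hfin : @Module.Finite ℚ (A ⧸ I) _ _ (Ideal.Quotient.algebra ℚ).toModule :=
    finite_of_finite_type_of_isJacobsonRing ℚ (A ⧸ I)
  have hchar : CharZero (A ⧸ I) := algebraRat.charZero _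
  refine ⟨A ⧸ I, iE, { to_charZero := hchar, to_finiteDimensional := ?_ }, ⟨Ideal.Quotient.mk I⟩⟩
  have halg : Ideal.Quotient.algebra ℚ = (DivisionRing.toRatAlgebra : Algebra ℚ (A ⧸ I)) :=
    Subsingleton.elim _ _
  rwa [halg] at hfin

/-- Infinitely many elements of a finitely generated algebra are unbounded at some place. -/
theorem exists_large_conjugate (A : Subalgebra ℚ ℂ) (hA : A.FG) {T : Set ℂ} (hTA : T ⊆ A)
    (hT : T.Infinite) (m : ℝ) : (∃ z ∈ T, ∃ σ : ℂ ≃+* ℂ, m < ‖σ z‖) ∨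
      ∃ z ∈ T, ∃ (p : ℕ) (_ : Fact p.Prime) (σ : ℂ ≃+* PadicAlgCl p), 1 < ‖σ z‖ := by
  by_contra! hcon
  obtain ⟨hcon1, hcon2⟩ := hcon
  have hTint : ∀ z ∈ T, IsIntegral ℚ z := by
    intro z hz
    by_contra h
    obtain ⟨σ, hσ⟩ := exists_ringEquiv_norm_gt (fun h' => h h'.isIntegral) m
    exact absurd (hcon1 z hz σ) (not_le.2 hσ)
  have hintZ : ∀ z ∈ T, IsIntegral ℤ z := fun z hz =>
    isIntegral_int_of_forall_norm_le_one (hTint z hz) fun p hp σ => hcon2 z hz p hp σ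
  have : Algebra.FiniteType ℚ A := (Subalgebra.fg_iff_finiteType A).1 hA
  obtain ⟨E, _, _, ⟨φ⟩⟩ := exists_ringHom_numberField A
  have hφ : ∀ a : A, IsIntegral ℚ (a : ℂ) → φ a = 0 → a = 0 := by
    intro a ha h0
    by_contra hne
    have hne' : (a : ℂ) ≠ 0 := fun h => hne (Subtype.ext h)
    have hinv : (a : ℂ)⁻¹ ∈ Algebra.adjoin ℚ {(a : ℂ)} :=
      Subalgebra.inv_mem_of_algebraic (A := Algebra.adjoin ℚ {(a : ℂ)})
        (x := ⟨a, Algebra.self_mem_adjoin_singleton ℚ _⟩) ha.isAlgebraic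
    have hinvA : (a : ℂ)⁻¹ ∈ A := by
      refine (Algebra.adjoin_le ?_ : Algebra.adjoin ℚ {(a : ℂ)} ≤ A) hinv
      simp
    have h1 : a * ⟨(a : ℂ)⁻¹, hinvA⟩ = 1 := Subtype.ext (mul_inv_cancel₀ hne')
    have h2 := congrArg φ h1
    rw [map_mul, h0, zero_mul, map_one] at h2
    exact zero_ne_one h2
  have hfin := NumberField.Embeddings.finite_of_norm_le E ℂ m
  let ψ : T → E := fun z => φ ⟨z, hTA z.2⟩
  have hψinj : Function.Injective ψ := by
    intro z z' h
    have h1 := hφ (⟨z, hTA z.2⟩ - ⟨z', hTA z'.2⟩) ((hTint z z.2).sub (hTint z' z'.2))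
      (by rw [map_sub]; exact sub_eq_zero.2 h)
    exact Subtype.ext (sub_eq_zero.1 (congrArg (Subtype.val : A → ℂ) h1))
  have hψ : ∀ z, IsIntegral ℤ (ψ z) ∧ ∀ τ : E →+* ℂ, ‖τ (ψ z)‖ ≤ m := by
    intro z
    have hzA : IsIntegral ℤ (⟨z, hTA z.2⟩ : A) :=
      (isIntegral_algHom_iff A.val.toRingHom.toIntAlgHom Subtype.val_injective).1 (hintZ z z.2)
    refine ⟨hzA.map φ.toIntAlgHom, fun τ => ?_⟩
    have h1 : aeval (τ (ψ z)) (minpoly ℚ (z : ℂ)) = 0 := by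
      have h2 : aeval (⟨z, hTA z.2⟩ : A) (minpoly ℚ (z : ℂ)) = 0 := by
        apply Subtype.ext
        have := minpoly.aeval ℚ (z : ℂ)
        rw [ZeroMemClass.coe_zero, ← this]
        exact (aeval_algHom_apply A.val _ _).symm
      have h3 := aeval_algHom_apply (τ.comp φ).toRatAlgHom (⟨z, hTA z.2⟩ : A)
        (minpoly ℚ (z : ℂ))
      rw [h2, map_zero] at h3
      exact h3
    obtain ⟨σ, hσ⟩ := exists_ringEquiv_apply_eq_of_aeval_minpoly mk_complex (hTint z z.2) h1
    rw [← hσ]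
    exact hcon1 z z.2 σ
  apply hT
  rw [← Set.finite_coe_iff] at hfin ⊢
  exact Finite.of_injective (fun z : T => (⟨ψ z, hψ z⟩ :
    {x : E | IsIntegral ℤ x ∧ ∀ τ : E →+* ℂ, ‖τ x‖ ≤ m})) fun z z' h =>
      hψinj (congrArg Subtype.val h)

end Place

section SpanAlgebra

variable {k Γ A : Type*} [Group Γ] [Field k] [Ring A] [Algebra k A]

/-- The subalgebra generated by the image of a subgroup. -/
def spanAlgebra (k : Type*) {Γ A : Type*} [Group Γ] [Field k] [Ring A] [Algebra k A]
    (τ : Γ →* A) (N : Subgroup Γ) : Subalgebra k A :=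
  Algebra.adjoin k (τ '' N)

lemma toSubmodule_spanAlgebra (τ : Γ →* A) (N : Subgroup Γ) :
    Subalgebra.toSubmodule (spanAlgebra k τ N) = Submodule.span k (τ '' N) := by
  have h : (τ '' (N : Set Γ)) = (N.toSubmonoid.map τ : Submonoid A) := rfl
  rw [spanAlgebra, Algebra.adjoin_eq_span, h, Submonoid.closure_eq]

lemma apply_mem_spanAlgebra (τ : Γ →* A) {N : Subgroup Γ} {a : Γ} (ha : a ∈ N) :
    τ a ∈ spanAlgebra k τ N :=
  Algebra.subset_adjoin ⟨a, ha, rfl⟩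

lemma conj_mem_spanAlgebra (τ : Γ →* A) {N : Subgroup Γ} (hN : N.Normal) (γ : Γ) {b : A}
    (hb : b ∈ spanAlgebra k τ N) : τ γ * b * τ γ⁻¹ ∈ spanAlgebra k τ N := by
  rw [← Subalgebra.mem_toSubmodule, toSubmodule_spanAlgebra] at hb ⊢
  induction hb using Submodule.span_induction with
  | mem x hx =>
    obtain ⟨a, ha, rfl⟩ := hx
    refine Submodule.subset_span ⟨γ * a * γ⁻¹, hN.conj_mem a ha γ, ?_⟩
    rw [map_mul, map_mul]
  | zero => simp
  | add x y _ _ hx hy => rw [mul_add, add_mul]; exact add_mem hx hy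
  | smul c x _ hx => rw [mul_smul_comm, smul_mul_assoc]; exact Submodule.smul_mem _ _ hx

lemma apply_inv_mul_apply (τ : Γ →* A) (γ : Γ) : τ γ⁻¹ * τ γ = 1 := by
  rw [← map_mul, inv_mul_cancel, map_one]

/-- The conjugation action of the ambient group on the algebra spanned by a normal subgroup. -/
@[reducible] def conjAction (τ : Γ →* A) {N : Subgroup Γ} (hN : N.Normal) :
    MulSemiringAction Γ (spanAlgebra k τ N) where
  smul γ b := ⟨τ γ * b * τ γ⁻¹, conj_mem_spanAlgebra τ hN γ b.2⟩
  one_smul b := Subtype.ext (by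
    change τ 1 * (b : A) * τ 1⁻¹ = b
    simp)
  mul_smul γ δ b := Subtype.ext (by
    change τ (γ * δ) * (b : A) * τ (γ * δ)⁻¹ = τ γ * (τ δ * b * τ δ⁻¹) * τ γ⁻¹
    simp only [_root_.mul_inv_rev, map_mul, mul_assoc])
  smul_zero γ := Subtype.ext (by
    change τ γ * (0 : A) * τ γ⁻¹ = 0
    simp)
  smul_add γ b c := Subtype.ext (by
    change τ γ * ((b : A) + c) * τ γ⁻¹ = τ γ * b * τ γ⁻¹ + τ γ * c * τ γ⁻¹
    rw [mul_add, add_mul])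
  smul_one γ := Subtype.ext (by
    change τ γ * (1 : A) * τ γ⁻¹ = 1
    rw [mul_one, ← map_mul, mul_inv_cancel, map_one])
  smul_mul γ b c := Subtype.ext (by
    change τ γ * ((b : A) * c) * τ γ⁻¹ = τ γ * b * τ γ⁻¹ * (τ γ * c * τ γ⁻¹)
    calc _ = τ γ * b * 1 * c * τ γ⁻¹ := by simp only [mul_one, mul_assoc]
      _ = _ := by rw [← apply_inv_mul_apply τ γ]; simp only [mul_assoc])

lemma conjAction_smulCommClass (τ : Γ →* A) {N : Subgroup Γ} (hN : N.Normal) :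
    let := conjAction (k := k) τ hN
    SMulCommClass Γ k (spanAlgebra k τ N) := by
  intro
  refine ⟨fun γ c b => Subtype.ext ?_⟩
  change τ γ * (c • (b : A)) * τ γ⁻¹ = c • (τ γ * b * τ γ⁻¹)
  rw [mul_smul_comm, smul_mul_assoc]

open Classical in
/-- A homomorphism seen as a map to the algebra spanned by a subgroup; it is constant outside the
subgroup. -/
noncomputable def toSpanAlgebra (k : Type*) {Γ A : Type*} [Group Γ] [Field k] [Ring A]
    [Algebra k A] (τ : Γ →* A) (N : Subgroup Γ) (a : Γ) : spanAlgebra k τ N :=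
  if h : a ∈ N then ⟨τ a, apply_mem_spanAlgebra τ h⟩ else 1

lemma coe_toSpanAlgebra (τ : Γ →* A) {N : Subgroup Γ} {a : Γ} (ha : a ∈ N) :
    (toSpanAlgebra k τ N a : A) = τ a := by
  rw [toSpanAlgebra, dif_pos ha]

lemma isConjRep_toSpanAlgebra (τ : Γ →* A) {N₀ : Subgroup Γ} (hN : N₀.Normal) (hne : N₀ ≠ ⊥)
    (hspan : ∀ N ≤ N₀, N.Normal → N ≠ ⊥ → ∀ a ∈ N₀, τ a ∈ Submodule.span k (τ '' N)) :
    let := conjAction (k := k) τ hN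
    IsConjRep k N₀ (toSpanAlgebra k τ N₀) := by
  intro
  refine ⟨hN, hne, ?_, ?_, ?_, ?_, ?_⟩
  · exact Subtype.ext (by rw [coe_toSpanAlgebra τ N₀.one_mem, map_one]; rfl)
  · intro a ha b hb
    apply Subtype.ext
    rw [MulMemClass.coe_mul, coe_toSpanAlgebra τ ha, coe_toSpanAlgebra τ hb,
      coe_toSpanAlgebra τ (mul_mem ha hb), map_mul]
  · intro γ a ha
    apply Subtype.ext
    rw [coe_toSpanAlgebra τ (hN.conj_mem a ha γ), map_mul, map_mul,
      ← coe_toSpanAlgebra (k := k) τ ha]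
    rfl
  · intro a ha b
    apply Subtype.ext
    rw [MulMemClass.coe_mul, MulMemClass.coe_mul, coe_toSpanAlgebra τ ha,
      coe_toSpanAlgebra τ (inv_mem ha)]
    rfl
  · intro N hle hNn hNb
    rw [eq_top_iff]
    intro b _
    have h1 : (spanAlgebra k τ N₀).val.toLinearMap '' (toSpanAlgebra k τ N₀ '' N) = τ '' N := by
      rw [Set.image_image]
      exact Set.image_congr fun a ha => coe_toSpanAlgebra (k := k) τ (hle ha)
    have h2 : (b : A) ∈ (Submodule.span k (toSpanAlgebra k τ N₀ '' N)).map
        (spanAlgebra k τ N₀).val.toLinearMap := by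
      rw [Submodule.map_span, h1]
      have hb := b.2
      rw [← Subalgebra.mem_toSubmodule, toSubmodule_spanAlgebra] at hb
      refine Submodule.span_le.2 ?_ hb
      rintro _ ⟨a, ha, rfl⟩
      exact hspan N hle hNn hNb a ha
    obtain ⟨c, hc, hcb⟩ := h2
    rwa [← Subtype.ext (a1 := c) (a2 := b) hcb]

end SpanAlgebra

section

open Filter Topology

variable {k Γ V : Type*} [Group Γ]

lemma isSemisimpleRing_spanAlgebra [Field k] [AddCommGroup V] [Module k V]
    [FiniteDimensional k V] [Nontrivial V] {A : Type*} [Ring A] [Algebra k A] [Module A V]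
    [IsScalarTower k A V] [FaithfulSMul A V] (τ : Γ →* A) {N : Subgroup Γ} (hN : N.Normal)
    (hirr : ∀ W : Submodule k V, (∀ γ, ∀ w ∈ W, τ γ • w ∈ W) → W = ⊥ ∨ W = ⊤) :
    IsSemisimpleRing (spanAlgebra k τ N) := by
  let := conjAction (k := k) τ hN
  let : DistribMulAction Γ V := DistribMulAction.compHom V τ
  have hst : IsScalarTower k (spanAlgebra k τ N) V :=
    ⟨fun c b v => smul_assoc c (b : A) v⟩
  have : IsArtinian (spanAlgebra k τ N) V := isArtinian_of_tower k inferInstance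
  let v := Module.finBasis k V
  refine isSemisimpleRing_of_irreducible (Γ := Γ) (V := V) ?_ ?_ v ?_
  · intro γ b w
    change τ γ • (b : A) • w = (τ γ * b * τ γ⁻¹) • τ γ • w
    rw [smul_smul, smul_smul, mul_assoc _ _ (τ γ), apply_inv_mul_apply, mul_one]
  · intro W hW
    rcases hirr (W.restrictScalars k) hW with h | h
    · left
      exact (Submodule.restrictScalars_eq_bot_iff k _ V).1 h
    · right
      exact (Submodule.restrictScalars_eq_top_iff k _ V).1 h
  · intro b hb
    apply Subtype.ext
    refine eq_of_smul_eq_smul (α := V) fun w => ?_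
    rw [ZeroMemClass.coe_zero, zero_smul, ← v.sum_repr w, Finset.smul_sum]
    refine Finset.sum_eq_zero fun i _ => ?_
    have h : b • v i = 0 := hb i
    have h' : (b : A) • v i = 0 := h
    have h2 : (b : A) • v.repr w i • v i = v.repr w i • (b : A) • v i := by
      have : SMulCommClass k A V := IsScalarTower.to_smulCommClass
      rw [smul_comm]
    rw [h2, h', smul_zero]

lemma det_one_sub_add_mul_eq_one [NontriviallyNormedField k] [NormedAddCommGroup V]
    [NormedSpace k V] (τ : Γ →* (V →L[k] V)) {N₀ : Subgroup Γ} {e : V →L[k] V}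
    (hidem : e * e = e) (hcomm : ∀ a ∈ N₀, e * τ a = τ a * e) {h : Γ} (hh : h ∈ ⁅N₀, N₀⁆) :
    (1 - e + e * τ h).det = 1 := by
  let D : N₀ →* k :=
    { toFun := fun h => (1 - e + e * τ h).det
      map_one' := by
        rw [OneMemClass.coe_one, map_one, mul_one, sub_add_cancel]
        exact LinearMap.det_id
      map_mul' := fun a b => by
        have h1 : e * τ a * (e * τ b) = e * τ (a * b) := by
          rw [hcomm a a.2, mul_assoc, ← mul_assoc e e, hidem, ← mul_assoc, ← hcomm a a.2,
            mul_assoc, map_mul]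
        have h2 : e * τ a * e = e * τ a := by
          rw [hcomm a a.2, mul_assoc, hidem]
        have h3 : 1 - e + e * τ ((a * b : N₀) : Γ) = (1 - e + e * τ a) * (1 - e + e * τ b) := by
          rw [Subgroup.coe_mul, ← h1, add_mul, mul_add, mul_add, sub_mul, one_mul, mul_sub, mul_one,
            hidem, sub_self, sub_zero, mul_sub, mul_one, h2, sub_self, sub_mul, one_mul,
            ← mul_assoc e e, hidem, sub_self, add_zero, zero_add]
        rw [h3]
        exact LinearMap.det.map_mul _ _ }
  have hle : ⁅N₀, N₀⁆ ≤ D.toHomUnits.ker.map N₀.subtype := by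
    refine Subgroup.commutator_le.2 fun a ha b hb =>
      ⟨(⟨a, ha⟩ * ⟨b, hb⟩ * ⟨a, ha⟩⁻¹ * ⟨b, hb⟩⁻¹ : N₀), ?_, rfl⟩
    rw [SetLike.mem_coe, MonoidHom.mem_ker, map_mul, map_mul, map_mul, map_inv, map_inv,
      mul_comm (D.toHomUnits _), mul_inv_cancel_right, mul_inv_cancel]
  obtain ⟨x, hx, rfl⟩ := hle hh
  exact congrArg Units.val (MonoidHom.mem_ker.1 hx)

/-- An irreducible representation in which a commutator has an expanding eigenvector. -/
theorem exists_isCoatom_of_eigenvector [NontriviallyNormedField k] [ProperSpace k]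
    [NormedAddCommGroup V] [NormedSpace k V] [FiniteDimensional k V] [Nontrivial V]
    (hfg : Group.FG Γ) (hM : IsMIF Γ) (τ : Γ →* (V →L[k] V))
    (hirr : ∀ W : Submodule k V, (∀ γ, ∀ w ∈ W, τ γ w ∈ W) → W = ⊥ ∨ W = ⊤)
    {N₀ : Subgroup Γ} (hN : N₀.Normal) (hne : N₀ ≠ ⊥)
    (hspan : ∀ N ≤ N₀, N.Normal → N ≠ ⊥ → ∀ a ∈ N₀, τ a ∈ Submodule.span k (τ '' N))
    {g : Γ} (hg : g ∈ ⁅N₀, N₀⁆) {c : k} (hc : 1 < ‖c‖) {v : V} (hv : v ≠ 0) (hgv : τ g v = c • v) :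
    ∃ M : Subgroup Γ, IsCoatom M ∧ M.normalCore = ⊥ := by
  have : IsScalarTower k (V →L[k] V) V := ⟨fun _ _ _ => rfl⟩
  have hss : IsSemisimpleRing (spanAlgebra k τ N₀) := isSemisimpleRing_spanAlgebra τ hN hirr
  let := conjAction (k := k) τ hN
  have := conjAction_smulCommClass (k := k) τ hN
  have hrep := isConjRep_toSpanAlgebra τ hN hne hspan
  obtain ⟨J, hJ⟩ := IsSemisimpleRing.exists_isPrimeDecomposition Γ (B := spanAlgebra k τ N₀)
  have hgN : g ∈ N₀ := Subgroup.commutator_le_self N₀ hg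
  obtain ⟨e, he, hev⟩ : ∃ e ∈ J, (e : V →L[k] V) v ≠ 0 := by
    by_contra! h
    apply hv
    have h1 : ((∑ e ∈ J, e : spanAlgebra k τ N₀) : V →L[k] V) v = v := by
      rw [hJ.sum_eq]
      rfl
    rw [← h1, AddSubmonoidClass.coe_finsetSum, _root_.sum_apply]
    exact Finset.sum_eq_zero h
  have hcomm : ∀ b : spanAlgebra k τ N₀, (e : V →L[k] V) * b = b * e := fun b =>
    congrArg Subtype.val (hJ.comm e he b)
  have hidem : (e : V →L[k] V) * e = e := congrArg Subtype.val (hJ.idem e he)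
  have hdet : ∀ h ∈ ⁅N₀, N₀⁆, (1 - (e : V →L[k] V) + e * τ h).det = 1 :=
    fun h hh => det_one_sub_add_mul_eq_one τ hidem
      (fun a ha => by rw [← coe_toSpanAlgebra (k := k) τ ha]; exact hcomm _) hh
  refine IsConjRep.exists_isCoatom hfg hM hrep hJ he ?_
  by_contra! hbdd
  obtain ⟨C, hC⟩ := hbdd
  have hpow : ∀ i : ℕ, ((e : V →L[k] V) * τ (g ^ i)) v = c ^ i • (e : V →L[k] V) v := by
    intro i
    have h1 : τ (g ^ i) v = c ^ i • v := by
      induction i with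
      | zero => simp
      | succ i ih =>
        rw [pow_succ, map_mul, ContinuousLinearMap.mul_def, ContinuousLinearMap.comp_apply, hgv,
          map_smul, ih, smul_smul, pow_succ']
    rw [ContinuousLinearMap.mul_def, ContinuousLinearMap.comp_apply, h1, map_smul]
  have hw : 0 < ‖(e : V →L[k] V) v‖ := norm_pos_iff.2 hev
  have hv' : 0 < ‖v‖ := norm_pos_iff.2 hv
  have hle : ∀ i : ℕ, ‖(e : V →L[k] V) * τ (g ^ i)⁻¹‖ ≤
      C * ‖v‖ / ‖(e : V →L[k] V) v‖ * (‖c‖⁻¹) ^ i := by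
    intro i
    have h1 : ‖c‖ ^ i * ‖(e : V →L[k] V) v‖ ≤ ‖(e : V →L[k] V) * τ (g ^ i)‖ * ‖v‖ := by
      rw [← norm_pow, ← norm_smul, ← hpow]
      exact ContinuousLinearMap.le_opNorm _ _
    have h2 : ‖(e : V →L[k] V) * τ (g ^ i)‖ * ‖(e : V →L[k] V) * τ (g ^ i)⁻¹‖ ≤ C := by
      have := hC (g ^ i) (pow_mem hgN i)
      rw [← coe_toSpanAlgebra (k := k) τ (pow_mem hgN i),
        ← coe_toSpanAlgebra (k := k) τ (inv_mem (pow_mem hgN i))]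
      exact this
    have h3 : 0 < ‖c‖ ^ i := by positivity
    rw [inv_pow, ← div_eq_mul_inv, le_div_iff₀ h3, le_div_iff₀ hw]
    calc _ = ‖c‖ ^ i * ‖(e : V →L[k] V) v‖ * ‖(e : V →L[k] V) * τ (g ^ i)⁻¹‖ := by ring
      _ ≤ ‖(e : V →L[k] V) * τ (g ^ i)‖ * ‖v‖ * ‖(e : V →L[k] V) * τ (g ^ i)⁻¹‖ := by gcongr
      _ = ‖(e : V →L[k] V) * τ (g ^ i)‖ * ‖(e : V →L[k] V) * τ (g ^ i)⁻¹‖ * ‖v‖ := by ring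
      _ ≤ _ := by gcongr
  have hlim : Tendsto (fun i : ℕ => (e : V →L[k] V) * τ (g ^ i)⁻¹) atTop (𝓝 0) := by
    refine squeeze_zero_norm hle ?_
    have h0 := (tendsto_pow_atTop_nhds_zero_of_lt_one (inv_nonneg.2 (norm_nonneg c))
      (inv_lt_one_of_one_lt₀ hc)).const_mul (C * ‖v‖ / ‖(e : V →L[k] V) v‖)
    rwa [mul_zero] at h0
  have hdet1 : (1 - (e : V →L[k] V)).det = 1 := by
    have hlim2 := ((ContinuousLinearMap.continuous_det (𝕜 := k) (E := V)).tendsto _).comp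
      (hlim.const_add (1 - (e : V →L[k] V)))
    rw [add_zero] at hlim2
    refine tendsto_nhds_unique hlim2 (tendsto_const_nhds.congr fun i => ?_)
    exact (hdet _ (inv_mem (pow_mem hg i))).symm
  have hdet0 : (1 - (e : V →L[k] V)).det = 0 := by
    refine LinearMap.det_eq_zero_iff_ker_ne_bot.2 fun h => hev ?_
    refine LinearMap.ker_eq_bot'.1 h _ ?_
    change (e : V →L[k] V) v - ((e : V →L[k] V) * e) v = 0
    rw [hidem, sub_self]
  exact one_ne_zero (hdet1.symm.trans hdet0)

end

section

variable {k Γ V : Type*} [Group Γ] [Field k] [AddCommGroup V] [Module k V] [FiniteDimensional k V]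
  {m : ℕ}

lemma ker_ne_bot_of_finrank_lt
    (hmin : ∀ n < m, ∀ f : Γ →* Matrix (Fin n) (Fin n) ℂ, ¬ Function.Injective f)
    (j : k →+* ℂ) (τ : Γ →* Module.End k V) (h : Module.finrank k V < m) : τ.ker ≠ ⊥ := by
  intro hker
  have hτ := (MonoidHom.ker_eq_bot_iff τ).1 hker
  refine hmin _ h ((MonoidHomClass.toMonoidHom j.mapMatrix).comp
    ((MonoidHomClass.toMonoidHom (LinearMap.toMatrixAlgEquiv (Module.finBasis k V))).comp τ)) ?_
  exact (Matrix.map_injective j.injective).comp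
    ((LinearMap.toMatrixAlgEquiv (Module.finBasis k V)).injective.comp hτ)

/-- A faithful representation of minimal dimension is irreducible. -/
theorem irreducible_of_minimal (hM : IsMIF Γ)
    (hmin : ∀ n < m, ∀ f : Γ →* Matrix (Fin n) (Fin n) ℂ, ¬ Function.Injective f)
    (j : k →+* ℂ) (τ : Γ →* Module.End k V) (hτ : Function.Injective τ)
    (hV : Module.finrank k V = m) (W : Submodule k V) (hW : ∀ γ, ∀ w ∈ W, τ γ w ∈ W) :
    W = ⊥ ∨ W = ⊤ := by
  by_contra! hcon
  obtain ⟨hbot, htop⟩ := hcon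
  let τ₁ : Γ →* Module.End k W :=
    { toFun := fun γ => (τ γ).restrict (hW γ)
      map_one' := by ext; simp
      map_mul' := fun a b => by ext; simp }
  let τ₂ : Γ →* Module.End k (V ⧸ W) :=
    { toFun := fun γ => W.mapQ W (τ γ) (hW γ)
      map_one' := by ext; simp
      map_mul' := fun a b => by ext; simp }
  have h1 : τ₁.ker ≠ ⊥ := ker_ne_bot_of_finrank_lt hmin j τ₁
    (hV ▸ Submodule.finrank_lt htop)
  have h2 : τ₂.ker ≠ ⊥ := by
    refine ker_ne_bot_of_finrank_lt hmin j τ₂ ?_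
    have h3 := W.finrank_quotient_add_finrank
    have h4 : Module.finrank k W ≠ 0 := fun h => hbot (Submodule.finrank_eq_zero.1 h)
    omega
  have hne := hM.inf_ne_bot h1 h2
  have hz : ∀ a ∈ τ₁.ker ⊓ τ₂.ker, ∀ b ∈ τ₁.ker ⊓ τ₂.ker, (τ a - 1) * (τ b - 1) = 0 := by
    intro a ha b hb
    ext v
    have hbv : τ b v - v ∈ W := by
      rw [← Submodule.Quotient.mk_eq_zero, Submodule.Quotient.mk_sub, sub_eq_zero]
      exact congrArg (fun f => f (Submodule.Quotient.mk v)) (MonoidHom.mem_ker.1 hb.2)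
    have h5 : τ a (τ b v - v) = τ b v - v :=
      congrArg Subtype.val (congrArg (fun f => f ⟨τ b v - v, hbv⟩) (MonoidHom.mem_ker.1 ha.1))
    change τ a (τ b v - v) - (τ b v - v) = 0
    rw [h5, sub_self]
  refine hne (hM.eq_bot_of_commute hne fun a ha b hb => hτ ?_)
  have h6 := hz a ha b hb
  have h7 := hz b hb a ha
  rw [sub_mul, mul_sub, mul_sub, one_mul, one_mul, mul_one] at h6 h7
  rw [map_mul, map_mul, ← sub_eq_zero]
  calc τ a * τ b - τ b * τ a = (τ a * τ b - τ a - (τ b - 1)) - (τ b * τ a - τ b - (τ a - 1)) := by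
        abel
    _ = 0 := by rw [h6, h7, sub_zero]

end

section

variable {Γ : Type*} [Group Γ]

/-- A nontrivial normal subgroup whose linear span is minimal. -/
lemma exists_normal_span_eq {k A : Type*} [Field k] [Ring A] [Algebra k A] [FiniteDimensional k A]
    [Nontrivial Γ] (τ : Γ →* A) : ∃ N₀ : Subgroup Γ, N₀.Normal ∧ N₀ ≠ ⊥ ∧
      ∀ N ≤ N₀, N.Normal → N ≠ ⊥ → Submodule.span k (τ '' N) = Submodule.span k (τ '' N₀) := by
  obtain ⟨N₀, ⟨hn, hb⟩, hmin⟩ := exists_minimalFor_of_wellFoundedLT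
    (fun N : Subgroup Γ => N.Normal ∧ N ≠ ⊥)
    (fun N => Module.finrank k (Submodule.span k (τ '' (N : Set Γ)))) ⟨⊤, inferInstance, top_ne_bot⟩
  refine ⟨N₀, hn, hb, fun N hN hNn hNb => ?_⟩
  have hle : Submodule.span k (τ '' (N : Set Γ)) ≤ Submodule.span k (τ '' (N₀ : Set Γ)) :=
    Submodule.span_mono (Set.image_mono hN)
  exact Submodule.eq_of_le_of_finrank_le hle
    (hmin ⟨hNn, hNb⟩ (Submodule.finrank_mono hle))

/-- Linear dependence of matrices descends along an extension of fields. -/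
lemma Matrix.mem_span_of_map_mem_span {k K ι ι' : Type*} [Field k] [Field K] [Fintype ι]
    [Fintype ι'] (j : k →+* K) {S : Set (Matrix ι ι' k)} {x : Matrix ι ι' k}
    (h : x.map j ∈ Submodule.span K ((fun y : Matrix ι ι' k => y.map j) '' S)) :
    x ∈ Submodule.span k S := by
  classical
  by_contra hx
  obtain ⟨f, hfx, hf⟩ := Submodule.exists_le_ker_of_notMem hx
  let F : Matrix ι ι' K →ₗ[K] K :=
    ∑ a, ∑ b, j (f (Matrix.single a b 1)) • Matrix.entryLinearMap K K a b
  have hF : ∀ y : Matrix ι ι' k, F (y.map j) = j (f y) := by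
    intro y
    conv_rhs => rw [Matrix.matrix_eq_sum_single y]
    simp only [F, LinearMap.sum_apply, LinearMap.smul_apply, Matrix.entryLinearMap_apply,
      Matrix.map_apply, smul_eq_mul, map_sum]
    refine Finset.sum_congr rfl fun a _ => Finset.sum_congr rfl fun b _ => ?_
    rw [← map_mul, mul_comm, ← smul_eq_mul, ← map_smul, Matrix.smul_single, smul_eq_mul, mul_one]
  have hle : Submodule.span K ((fun y : Matrix ι ι' k => y.map j) '' S) ≤ F.ker := by
    rw [Submodule.span_le]
    rintro _ ⟨y, hy, rfl⟩
    have h0 : f y = 0 := hf (Submodule.subset_span hy)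
    change F (y.map j) = 0
    rw [hF, h0, map_zero]
  have h1 : F (x.map j) = 0 := hle h
  rw [hF, map_eq_zero] at h1
  exact hfx h1

/-- In an irreducible representation in characteristic zero, the trace takes infinitely many values
on a normal subgroup that spans the same algebra as a larger normal subgroup. -/
theorem infinite_trace_image {k V : Type*} [Field k] [CharZero k] [AddCommGroup V] [Module k V]
    [FiniteDimensional k V] [Nontrivial V] (τ : Γ →* Module.End k V) (hτ : Function.Injective τ)
    (hirr : ∀ W : Submodule k V, (∀ γ, ∀ w ∈ W, τ γ w ∈ W) → W = ⊥ ∨ W = ⊤)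
    {N : Subgroup Γ} (hN : N.Normal) [Infinite N] :
    ((fun g => LinearMap.trace k V (τ g)) '' (N : Set Γ)).Infinite := by
  have hss : IsSemisimpleRing (spanAlgebra k τ N) := isSemisimpleRing_spanAlgebra τ hN hirr
  have hnd : ∀ b : spanAlgebra k τ N,
      (∀ x : spanAlgebra k τ N, LinearMap.trace k V (x * b : Module.End k V) = 0) → b = 0 := by
    intro b hb
    obtain ⟨e, he, hbe⟩ := IsSemisimpleRing.ideal_eq_span_idempotent (Ideal.span {b})
    obtain ⟨x, hx⟩ := Ideal.mem_span_singleton'.1 (hbe ▸ Ideal.mem_span_singleton_self e)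
    have h0 : (e : Module.End k V) = 0 := by
      refine LinearMap.IsIdempotentElem.eq_zero_of_trace_eq_zero (congrArg Subtype.val he) ?_
      rw [← hx]
      exact hb x
    have h1 : e = 0 := Subtype.ext h0
    rw [h1, Ideal.span_singleton_eq_bot.2 rfl] at hbe
    exact Ideal.span_singleton_eq_bot.1 hbe
  intro hfin
  obtain ⟨f, hf, hspan, -⟩ := Submodule.exists_fun_fin_finrank_span_eq k (τ '' (N : Set Γ))
  choose a haN ha using hf
  have := hfin.to_subtype
  let Φ : N → (Fin _ → (fun g => LinearMap.trace k V (τ g)) '' (N : Set Γ)) :=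
    fun g i => ⟨_, a i * g, mul_mem (haN i) g.2, rfl⟩
  refine not_injective_infinite_finite Φ fun g g' hgg => ?_
  have h2 : (⟨τ g, apply_mem_spanAlgebra τ g.2⟩ : spanAlgebra k τ N) -
      ⟨τ g', apply_mem_spanAlgebra τ g'.2⟩ = 0 := by
    refine hnd _ fun x => ?_
    have hx := x.2
    rw [← Subalgebra.mem_toSubmodule, toSubmodule_spanAlgebra, ← hspan] at hx
    change LinearMap.trace k V (x * (τ g - τ g')) = 0
    generalize (x : Module.End k V) = x' at hx ⊢
    induction hx using Submodule.span_induction with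
    | mem y hy =>
      obtain ⟨i, rfl⟩ := hy
      have h3 := congrArg Subtype.val (congrFun hgg i)
      change LinearMap.trace k V (τ (a i * g)) = LinearMap.trace k V (τ (a i * g')) at h3
      rw [← ha, mul_sub, map_sub, ← map_mul, ← map_mul, h3, sub_self]
    | zero => rw [zero_mul, map_zero]
    | add y z _ _ hy hz => rw [add_mul, map_add, hy, hz, add_zero]
    | smul c y _ hy => rw [smul_mul_assoc, map_smul, hy, smul_zero]
  exact Subtype.ext (hτ (congrArg Subtype.val (sub_eq_zero.1 h2)))

end

section

variable {Γ : Type*} [Group Γ] {m : ℕ}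

lemma exists_root_norm_gt_one_of_lt {A : Matrix (Fin m) (Fin m) ℂ} (h : (m : ℝ) < ‖A.trace‖) :
    ∃ c, 1 < ‖c‖ ∧ A.charpoly.IsRoot c := by
  by_contra! hcon
  apply h.not_ge
  rw [Matrix.trace_eq_sum_roots_charpoly]
  refine (norm_multiset_sum_le _).trans ((Multiset.sum_le_card_nsmul _ 1 ?_).trans ?_)
  · intro x hx
    obtain ⟨y, hy, rfl⟩ := Multiset.mem_map.1 hx
    exact not_lt.1 fun hlt => hcon y hlt (Polynomial.isRoot_of_mem_roots hy)
  · rw [Multiset.card_map, nsmul_eq_mul, mul_one, Nat.cast_le]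
    refine (Polynomial.card_roots' _).trans ?_
    rw [Matrix.charpoly_natDegree_eq_dim, Fintype.card_fin]

lemma exists_root_norm_gt_one_of_isUltrametricDist {F : Type*} [NormedField F] [IsAlgClosed F]
    [IsUltrametricDist F] {A : Matrix (Fin m) (Fin m) F} (h : 1 < ‖A.trace‖) :
    ∃ c, 1 < ‖c‖ ∧ A.charpoly.IsRoot c := by
  by_contra! hcon
  apply h.not_ge
  rw [Matrix.trace_eq_sum_roots_charpoly]
  refine Multiset.sum_induction (fun x : F => ‖x‖ ≤ 1) _
    (fun a b ha hb => (IsUltrametricDist.norm_add_le_max a b).trans (max_le ha hb)) (by simp)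
    fun y hy => not_lt.1 fun hlt => hcon y hlt (Polynomial.isRoot_of_mem_roots hy)

lemma forall_entries_mem_of_closure_eq_top {K σ : Type*} [CommRing K] [SetLike σ K]
    [SubringClass σ K] (R : Γ →* Matrix (Fin m) (Fin m) K) {S : Set Γ}
    (hS : Submonoid.closure S = ⊤) (P : σ) (h : ∀ s ∈ S, ∀ a b, R s a b ∈ P) (γ : Γ) :
    ∀ a b, R γ a b ∈ P := by
  have hγ : γ ∈ Submonoid.closure S := hS ▸ Submonoid.mem_top γ
  induction hγ using Submonoid.closure_induction with
  | mem s hs => exact h s hs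
  | one =>
    intro a b
    rw [map_one, Matrix.one_apply]
    split_ifs
    exacts [one_mem P, zero_mem P]
  | mul x y _ _ hx hy =>
    intro a b
    rw [map_mul, Matrix.mul_apply]
    exact sum_mem fun i _ => mul_mem (hx a i) (hy i b)

lemma exists_monoidHom_map_eq {k K : Type*} [Field k] [CommRing K] [Nontrivial K] (i : k →+* K)
    (R : Γ →* Matrix (Fin m) (Fin m) K) (h : ∀ γ a b, ∃ x, i x = R γ a b) :
    ∃ R' : Γ →* Matrix (Fin m) (Fin m) k, ∀ γ, (R' γ).map i = R γ := by
  choose r hr using h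
  have hval : Function.Injective (i.mapMatrix : Matrix (Fin m) (Fin m) k →+* _) :=
    Matrix.map_injective i.injective
  have hmap : ∀ γ, i.mapMatrix (Matrix.of (r γ)) = R γ := fun γ => by
    ext a b
    exact hr γ a b
  exact ⟨{  toFun := fun γ => Matrix.of (r γ)
            map_one' := hval (by rw [hmap, map_one, map_one])
            map_mul' := fun x y => hval (by rw [map_mul, hmap, hmap, hmap, map_mul]) }, hmap⟩

/-- The conclusion holds once a faithful representation of minimal dimension has, over some local
field, an expanding eigenvalue in the derived subgroup of a normal subgroup of minimal span. -/
theorem exists_isCoatom_of_isRoot_charpoly (hfg : Group.FG Γ) (hM : IsMIF Γ) (hm : 0 < m)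
    (hmin : ∀ n < m, ∀ f : Γ →* Matrix (Fin n) (Fin n) ℂ, ¬ Function.Injective f)
    (R₀ : Γ →* Matrix (Fin m) (Fin m) ℂ) (hR₀ : Function.Injective R₀)
    {N₀ : Subgroup Γ} (hN : N₀.Normal) (hne : N₀ ≠ ⊥)
    (hspan : ∀ N ≤ N₀, N.Normal → N ≠ ⊥ →
      Submodule.span ℂ (R₀ '' N) = Submodule.span ℂ (R₀ '' N₀))
    {k : Type*} [NontriviallyNormedField k] [ProperSpace k] (j : k →+* ℂ)
    (R : Γ →* Matrix (Fin m) (Fin m) k) (hR : ∀ γ, (R γ).map j = R₀ γ)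
    {g : Γ} (hg : g ∈ ⁅N₀, N₀⁆) {c : k} (hc : 1 < ‖c‖) (hroot : (R g).charpoly.IsRoot c) :
    ∃ M : Subgroup Γ, IsCoatom M ∧ M.normalCore = ⊥ := by
  have : NeZero m := ⟨hm.ne'⟩
  let τ₁ : Γ →* Module.End k (Fin m → k) :=
    (MonoidHomClass.toMonoidHom (Matrix.toLinAlgEquiv' (R := k) (n := Fin m))).comp R
  let Ψ := (Matrix.toLinAlgEquiv' (R := k) (n := Fin m)).trans
    (Module.End.toContinuousLinearMap (𝕜 := k) (Fin m → k))
  let τ : Γ →* ((Fin m → k) →L[k] (Fin m → k)) := (MonoidHomClass.toMonoidHom Ψ).comp R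
  have hinj : Function.Injective R := fun a b h => hR₀ (by rw [← hR, h, hR])
  have hirr := irreducible_of_minimal hM hmin j τ₁
    ((Matrix.toLinAlgEquiv' (R := k) (n := Fin m)).injective.comp hinj) (by simp)
  have hspan' : ∀ N ≤ N₀, N.Normal → N ≠ ⊥ → ∀ a ∈ N₀, τ a ∈ Submodule.span k (τ '' N) := by
    intro N hle hNn hNb a ha
    have h1 : R a ∈ Submodule.span k (R '' N) := by
      apply Matrix.mem_span_of_map_mem_span j
      rw [Set.image_image]
      simp only [hR]
      change R₀ a ∈ Submodule.span ℂ (R₀ '' N)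
      rw [hspan N hle hNn hNb]
      exact Submodule.subset_span ⟨a, ha, rfl⟩
    have h2 := Submodule.mem_map_of_mem (f := Ψ.toLinearMap) h1
    rw [Submodule.map_span, Set.image_image] at h2
    exact h2
  rw [← Matrix.charpoly_toLin', ← Module.End.hasEigenvalue_iff_isRoot_charpoly] at hroot
  obtain ⟨v, hv⟩ := hroot.exists_hasEigenvector
  exact exists_isCoatom_of_eigenvector hfg hM τ hirr hN hne hspan' hg hc hv.2 hv.apply_eq_smul

theorem exists_isCoatom_of_injective (hfg : Group.FG Γ) (hM : IsMIF Γ)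
    {d : ℕ} (f : Γ →* Matrix (Fin d) (Fin d) ℂ) (hf : Function.Injective f) :
    ∃ M : Subgroup Γ, IsCoatom M ∧ M.normalCore = ⊥ := by
  classical
  have hex : ∃ m, ∃ f : Γ →* Matrix (Fin m) (Fin m) ℂ, Function.Injective f := ⟨d, f, hf⟩
  obtain ⟨R₀, hR₀⟩ := Nat.find_spec hex
  have hmin : ∀ n < Nat.find hex, ∀ f : Γ →* Matrix (Fin n) (Fin n) ℂ, ¬ Function.Injective f :=
    fun n hn f hf => Nat.find_min hex hn ⟨f, hf⟩
  generalize Nat.find hex = m at R₀ hR₀ hmin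
  have hinf : Infinite Γ := hM.infinite
  have hm : 0 < m := by
    rw [Nat.pos_iff_ne_zero]
    rintro rfl
    exact not_subsingleton Γ hR₀.subsingleton
  have : NeZero m := ⟨hm.ne'⟩
  obtain ⟨N₀, hN, hne, hspan⟩ := exists_normal_span_eq (k := ℂ) R₀
  have hN' : (⁅N₀, N₀⁆ : Subgroup Γ).Normal := inferInstance
  have hinf' : Infinite (⁅N₀, N₀⁆ : Subgroup Γ) := hM.infinite_of_ne_bot (hM.commutator_ne_bot hne)
  let τ₀ : Γ →* Module.End ℂ (Fin m → ℂ) :=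
    (MonoidHomClass.toMonoidHom (Matrix.toLinAlgEquiv' (R := ℂ) (n := Fin m))).comp R₀
  have hτ₀ : Function.Injective τ₀ :=
    (Matrix.toLinAlgEquiv' (R := ℂ) (n := Fin m)).injective.comp hR₀
  have htrace : ((fun g => (R₀ g).trace) '' ((⁅N₀, N₀⁆ : Subgroup Γ) : Set Γ)).Infinite := by
    have h := infinite_trace_image τ₀ hτ₀
      (irreducible_of_minimal hM hmin (RingHom.id ℂ) τ₀ hτ₀ (by simp)) hN'
    refine h.mono (Set.image_congr fun g _ => ?_).subset
    exact Matrix.trace_toLin'_eq _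
  obtain ⟨S, hS⟩ := (Monoid.fg_def.1 (Group.fg_iff_monoid_fg.1 hfg))
  have hfinE : (⋃ s ∈ S, ⋃ a, ⋃ b, {R₀ s a b} : Set ℂ).Finite := by
    refine S.finite_toSet.biUnion fun s _ => Set.finite_iUnion fun a =>
      Set.finite_iUnion fun b => ?_
    exact Set.finite_singleton _
  have hA := forall_entries_mem_of_closure_eq_top R₀ hS
    (Algebra.adjoin ℚ (⋃ s ∈ S, ⋃ a, ⋃ b, {R₀ s a b})) fun s hs a b =>
      Algebra.subset_adjoin (by simp only [Set.mem_iUnion]; exact ⟨s, hs, a, b, rfl⟩)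
  have hplace := exists_large_conjugate _ (Subalgebra.fg_def.2 ⟨_, hfinE, rfl⟩)
    (by rintro _ ⟨g, -, rfl⟩; exact sum_mem fun a _ => hA g a a) htrace m
  rcases hplace with ⟨_, ⟨g, hg, rfl⟩, σ, hσ⟩ | ⟨_, ⟨g, hg, rfl⟩, p, _, σ, hσ⟩
  · obtain ⟨c, hc, hroot⟩ := exists_root_norm_gt_one_of_lt
      (A := σ.toRingHom.mapMatrix (R₀ g)) (by
        rwa [RingHom.mapMatrix_apply, ← AddMonoidHom.map_trace])
    refine exists_isCoatom_of_isRoot_charpoly hfg hM hm hmin R₀ hR₀ hN hne hspan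
      σ.symm.toRingHom ((MonoidHomClass.toMonoidHom σ.toRingHom.mapMatrix).comp R₀) (fun γ => ?_)
      hg hc hroot
    ext a b
    exact σ.symm_apply_apply _
  · obtain ⟨c, hc, hroot⟩ := exists_root_norm_gt_one_of_isUltrametricDist
      (A := σ.toRingHom.mapMatrix (R₀ g)) (by
        rwa [RingHom.mapMatrix_apply, ← AddMonoidHom.map_trace])
    let k := IntermediateField.adjoin ℚ_[p]
      (insert c (σ '' ⋃ s ∈ S, ⋃ a, ⋃ b, {R₀ s a b}))
    have hfinE' := (hfinE.image σ).insert c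
    have := hfinE'.to_subtype
    have hfd : FiniteDimensional ℚ_[p] k := IntermediateField.finiteDimensional_adjoin
      fun x _ => Algebra.IsIntegral.isIntegral x
    have : ProperSpace k := FiniteDimensional.proper ℚ_[p] k
    have hk := forall_entries_mem_of_closure_eq_top
      ((MonoidHomClass.toMonoidHom σ.toRingHom.mapMatrix).comp R₀) hS k fun s hs a b =>
        IntermediateField.subset_adjoin _ _ (Or.inr ⟨R₀ s a b, by
          simp only [Set.mem_iUnion]; exact ⟨s, hs, a, b, rfl⟩, rfl⟩)
    have hck : c ∈ k := IntermediateField.subset_adjoin _ _ (Or.inl rfl)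
    obtain ⟨R, hR⟩ := exists_monoidHom_map_eq (algebraMap k (PadicAlgCl p))
      ((MonoidHomClass.toMonoidHom σ.toRingHom.mapMatrix).comp R₀)
      fun γ a b => ⟨⟨_, hk γ a b⟩, rfl⟩
    refine exists_isCoatom_of_isRoot_charpoly hfg hM hm hmin R₀ hR₀ hN hne hspan
      (σ.symm.toRingHom.comp (algebraMap k (PadicAlgCl p))) R (fun γ => ?_)
      hg (c := ⟨c, hck⟩) hc ?_
    · rw [RingHom.coe_comp, ← Matrix.map_map, hR]
      ext a b
      exact σ.symm_apply_apply _
    · rw [← Polynomial.isRoot_map_iff (algebraMap k (PadicAlgCl p)).injective,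
        ← Matrix.charpoly_map, hR]
      exact hroot

end

theorem stmt8 (d : ℕ) (hd : 1 ≤ d) (Γ : Subgroup (GL (Fin d) ℂ))
    (hfg : Group.FG Γ)
    (hMIF : ∀ w : MixedWordGroup Γ, w ≠ 1 → ∃ γ : Γ, evalWord γ w ≠ 1) :
    ∃ M : Subgroup Γ, IsCoatom M ∧ M.normalCore = ⊥ :=
  exists_isCoatom_of_injective hfg hMIF ((Units.coeHom _).comp Γ.subtype)
    (Units.val_injective.comp Subtype.val_injective)
end
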